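/- arXiv:1112.5737 — 4 statements merged into one kernel-verified Lean document; each statement's English description precedes it below -/
import Mathlib

section
/- For every d ≥ 1 and all positive integers k_1 and k_2, N_d(k_1·N_d(k_2) + k_2·N_d(k_1) − k_1·k_2) ≤ N_d(k_1)·N_d(k_2). -/
open MeasureTheory Set Metric
open scoped ENNReal
noncomputable section

abbrev Euc (d : ℕ) := EuclideanSpace ℝ (Fin d)

/-- A nice measure on ℝ^d: a probability measure with a continuous,
strictly positive density with respect to Lebesgue measure. -/
def NiceMeasure (d : ℕ) (μ : Measure (Euc d)) : Prop :=
  IsProbabilityMeasure μ ∧ ∃ f : Euc d → ℝ, Continuous f ∧ (∀ x, 0 < f x) ∧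
    μ = volume.withDensity (fun x => ENNReal.ofReal (f x))

/-- The affine hyperplane with normal vector `v` and offset `c`. -/
def Hyperplane {d : ℕ} (v : Euc d) (c : ℝ) : Set (Euc d) := {x | inner (𝕜 := ℝ) v x = c}

/-- A set `H` avoids a set `C` if `H` is disjoint from the interior of `C`. -/
def Avoids {d : ℕ} (H C : Set (Euc d)) : Prop := H ∩ interior C = ∅

/-- A convex partition of ℝ^d into `n` parts: `n` closed convex sets with pairwise
disjoint interiors whose union is all of ℝ^d. -/
def IsConvexPartition {d n : ℕ} (C : Fin n → Set (Euc d)) : Prop :=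
  (∀ i, IsClosed (C i)) ∧ (∀ i, Convex ℝ (C i)) ∧
  (∀ i j, i ≠ j → interior (C i) ∩ interior (C j) = ∅) ∧ (⋃ i, C i) = univ

/-- A `k`-equipartition of `μ` into `n` parts: a convex partition into `n` parts,
each of measure `1/n`, such that every hyperplane avoids at least `k` parts. -/
def IsEquipartition {d n : ℕ} (μ : Measure (Euc d)) (k : ℕ) (C : Fin n → Set (Euc d)) : Prop :=
  IsConvexPartition C ∧ (∀ i, μ (C i) = (n : ℝ≥0∞)⁻¹) ∧
  ∀ v : Euc d, ∀ c : ℝ, v ≠ 0 → k ≤ {i | Avoids (Hyperplane v c) (C i)}.ncard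

/-- Every nice measure on ℝ^d admits a `k`-equipartition into `n` parts. -/
def HasEquipartition (d k n : ℕ) : Prop :=
  ∀ μ : Measure (Euc d), NiceMeasure d μ → ∃ C : Fin n → Set (Euc d), IsEquipartition μ k C

/-- `N_d(k)`: the smallest positive `n` such that every nice measure on ℝ^d admits a
`k`-equipartition into `n` parts. -/
def Nd (d k : ℕ) : ℕ := sInf {n | 0 < n ∧ HasEquipartition d k n}


lemma approx_nice {d : ℕ} (ν : Measure (Euc d)) [IsProbabilityMeasure ν] (hν : ν ≪ volume)
    {ε₀ : ℝ} (hε₀ : 0 < ε₀) :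
    ∃ ν' : Measure (Euc d), NiceMeasure d ν' ∧
      ∀ A, MeasurableSet A → ν.real A ≤ ν'.real A + ε₀ := by
  obtain ⟨ε, hε, hε1, hε2⟩ : ∃ ε : ℝ, 0 < ε ∧ ε < 1 / 4 ∧ 4 * ε ≤ ε₀ := by
    refine ⟨min (1/8) (ε₀/4), by positivity, ?_, ?_⟩
    · exact lt_of_le_of_lt (min_le_left _ _) (by norm_num)
    · have := min_le_right (1/8 : ℝ) (ε₀/4)
      linarith
  set f : Euc d → ℝ := fun x => (ν.rnDeriv volume x).toReal with hf
  have hfi : Integrable f volume := Measure.integrable_toReal_rnDeriv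
  have hfA : ∀ A, ∫ x in A, f x = ν.real A := fun A => Measure.setIntegral_toReal_rnDeriv hν A
  have hf1 : ∫ x, f x = 1 := by
    have := hfA univ
    simpa using this
  have hf0 : ∀ x, 0 ≤ f x := fun x => ENNReal.toReal_nonneg
  obtain ⟨h, -, hfh, hhc, hhi⟩ := hfi.exists_hasCompactSupport_integral_sub_le hε
  set g : Euc d → ℝ := fun x => (1 + ‖x‖) ^ (-((d : ℝ) + 1)) with hg
  have hgi : Integrable g volume := integrable_one_add_norm (by simp)
  have hg0 : ∀ x, 0 < g x := fun x => by
    have : 0 < 1 + ‖x‖ := by positivity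
    exact Real.rpow_pos_of_pos this _
  have hgc : Continuous g := by
    refine Continuous.rpow_const (by fun_prop) (fun x => Or.inl ?_)
    have : 0 < 1 + ‖x‖ := by positivity
    exact this.ne'
  set J := ∫ x, g x with hJ
  have hJ0 : 0 ≤ J := integral_nonneg fun x => (hg0 x).le
  set δ := ε / (J + 1) with hδ
  have hδ0 : 0 < δ := by positivity
  have hδJ : δ * J ≤ ε := by
    rw [hδ, div_mul_eq_mul_div, div_le_iff₀ (by positivity)]
    nlinarith
  set q : Euc d → ℝ := fun x => |h x| + δ * g x with hq
  have hqc : Continuous q := by fun_prop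
  have hq0 : ∀ x, 0 < q x := fun x => by
    have := mul_pos hδ0 (hg0 x)
    have := abs_nonneg (h x)
    simp only [hq]; linarith
  have hqi : Integrable q volume := hhi.abs.add (hgi.const_mul δ)
  have hfq : ∫ x, |f x - q x| ≤ 2 * ε := by
    calc ∫ x, |f x - q x| ≤ ∫ x, (‖f x - h x‖ + δ * g x) := by
          refine integral_mono (hfi.sub hqi).abs ((hfi.sub hhi).norm.add (hgi.const_mul δ)) ?_
          intro x
          have h1 : abs (f x - abs (h x)) ≤ abs (f x - h x) := by
            have := abs_abs_sub_abs_le_abs_sub (f x) (h x)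
            rwa [abs_of_nonneg (hf0 x)] at this
          have h2 := mul_pos hδ0 (hg0 x)
          simp only [hq, Real.norm_eq_abs]
          calc abs (f x - (abs (h x) + δ * g x)) = abs ((f x - abs (h x)) - δ * g x) := by ring_nf
            _ ≤ abs (f x - abs (h x)) + abs (δ * g x) := abs_sub _ _
            _ ≤ _ := by rw [abs_of_pos h2]; linarith
      _ = (∫ x, ‖f x - h x‖) + δ * J := by
          have hn : Integrable (fun x => ‖f x - h x‖) volume := (hfi.sub hhi).norm
          rw [integral_add hn (hgi.const_mul δ), integral_const_mul]
      _ ≤ 2 * ε := by linarith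
  have hfqA : ∀ A, |(∫ x in A, f x) - ∫ x in A, q x| ≤ 2 * ε := by
    intro A
    rw [← integral_sub hfi.integrableOn hqi.integrableOn]
    refine (abs_integral_le_integral_abs).trans (le_trans ?_ hfq)
    exact setIntegral_le_integral (hfi.sub hqi).abs (Filter.Eventually.of_forall fun x => abs_nonneg _)
  set I := ∫ x, q x with hI
  have hI1 : |1 - I| ≤ 2 * ε := by
    have := hfqA univ
    simpa [hf1] using this
  rw [abs_le] at hI1
  have hI0 : 0 < I := by linarith
  have hqIi : Integrable (fun x => q x / I) volume := hqi.div_const I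
  refine ⟨volume.withDensity (fun x => ENNReal.ofReal (q x / I)), ⟨⟨?_⟩, fun x => q x / I,
    by fun_prop, fun x => div_pos (hq0 x) hI0, rfl⟩, ?_⟩
  · rw [withDensity_apply _ MeasurableSet.univ, ← ofReal_integral_eq_lintegral_ofReal
      hqIi.integrableOn (Filter.Eventually.of_forall fun x => (div_pos (hq0 x) hI0).le)]
    rw [integral_div]
    simp [← hI, hI0.ne']
  · intro A hA
    have h1 : (volume.withDensity (fun x => ENNReal.ofReal (q x / I))).real A
        = (∫ x in A, q x) / I := by
      rw [measureReal_def, withDensity_apply _ hA, ← ofReal_integral_eq_lintegral_ofReal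
        hqIi.integrableOn (Filter.Eventually.of_forall fun x => (div_pos (hq0 x) hI0).le),
        integral_div, ENNReal.toReal_ofReal]
      exact div_nonneg (integral_nonneg fun x => (hq0 x).le) hI0.le
    rw [h1, ← hfA]
    have h2 := hfqA A
    have h3 : ∫ x in A, q x ≤ I :=
      setIntegral_le_integral hqi (Filter.Eventually.of_forall fun x => (hq0 x).le)
    have h4 : ∫ x in A, q x = (∫ x in A, q x) / I * I := by field_simp
    have h5 : (∫ x in A, q x) / I ≤ 1 := by rw [div_le_one hI0]; exact h3
    have h6 : 0 ≤ (∫ x in A, q x) / I :=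
      div_nonneg (integral_nonneg fun x => (hq0 x).le) hI0.le
    rw [abs_le] at h2
    nlinarith

/-- A point whose ball is within a strictly smaller thickening of a closed convex set
belongs to it. -/
lemma mem_of_closedBall_near {d : ℕ} {C : Set (Euc d)} (hC : IsClosed C) (hc : Convex ℝ C)
    {z : Euc d} {r : ℝ} (hr : 0 < r)
    (h : ∀ y ∈ closedBall z r, ∃ b ∈ C, dist y b < r) : z ∈ C := by
  by_contra hz
  obtain ⟨f, s, hfz, hfC⟩ := geometric_hahn_banach_point_closed hc hC hz
  obtain ⟨a, rfl⟩ := (InnerProductSpace.toDual ℝ (Euc d)).surjective f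
  simp only [InnerProductSpace.toDual_apply_apply] at hfz hfC
  have ha : a ≠ 0 := by
    rintro rfl
    obtain ⟨b, hb, -⟩ := h z (by simp [hr.le])
    have := hfC b hb
    simp at this hfz
    linarith
  have hna : 0 < ‖a‖ := norm_pos_iff.mpr ha
  obtain ⟨b, hb, hbd⟩ := h (z - (r / ‖a‖) • a) (by
    rw [mem_closedBall, dist_eq_norm]
    simp [norm_smul, abs_of_pos hr, hna.ne'])
  have h1 := hfC b hb
  have h2 : inner ℝ a (b - (z - (r / ‖a‖) • a)) ≤ ‖a‖ * r := by
    refine (real_inner_le_norm _ _).trans ?_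
    rw [dist_comm, dist_eq_norm] at hbd
    gcongr
  rw [inner_sub_right, inner_sub_right, inner_smul_right, real_inner_self_eq_norm_sq] at h2
  have h3 : r / ‖a‖ * ‖a‖ ^ 2 = ‖a‖ * r := by field_simp
  linarith

def EqAC (d k n : ℕ) : Prop :=
  ∀ ν : Measure (Euc d), IsProbabilityMeasure ν → ν ≪ volume →
    ∃ C : Fin n → Set (Euc d), IsEquipartition ν k C

lemma eqAC_of_has {d k n : ℕ} (H : HasEquipartition d k n) : EqAC d k n := by
  intro ν hνp hν
  choose μ hμ hμν using fun m : ℕ => approx_nice ν hν (ε₀ := 1 / ((m : ℝ) + 1)) (by positivity)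
  choose C hC using fun m => H (μ m) (hμ m)
  set 𝒰 : Ultrafilter ℕ := Filter.hyperfilter ℕ
  have h𝒰 : (𝒰 : Filter ℕ) ≤ Filter.atTop := by
    rw [← Nat.cofinite_eq_atTop]; exact Filter.hyperfilter_le_cofinite
  set D : Fin n → Set (Euc d) := fun i =>
    {x | ∀ ε > 0, ∀ᶠ m in (𝒰 : Filter ℕ), ∃ y ∈ C m i, dist x y < ε} with hD
  have hDcl : ∀ i, IsClosed (D i) := by
    intro i
    rw [← closure_subset_iff_isClosed]
    intro x hx ε hε
    obtain ⟨x', hx', hxx'⟩ := Metric.mem_closure_iff.mp hx (ε / 2) (by positivity)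
    filter_upwards [hx' (ε / 2) (by positivity)] with m ⟨y, hy, hxy⟩
    exact ⟨y, hy, by linarith [dist_triangle x x' y]⟩
  have hDcv : ∀ i, Convex ℝ (D i) := by
    intro i x hx y hy a b ha hb hab ε hε
    filter_upwards [hx ε hε, hy ε hε] with m ⟨x', hx', hxx'⟩ ⟨y', hy', hyy'⟩
    refine ⟨a • x' + b • y', (hC m).1.2.1 i hx' hy' ha hb hab, ?_⟩
    rw [dist_eq_norm] at hxx' hyy' ⊢
    have : a • x + b • y - (a • x' + b • y') = a • (x - x') + b • (y - y') := by module
    rw [this]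
    refine (norm_add_le _ _).trans_lt ?_
    rw [norm_smul, norm_smul, Real.norm_of_nonneg ha, Real.norm_of_nonneg hb]
    have : a * ‖x - x'‖ ≤ a * ε := by gcongr
    have : b * ‖y - y'‖ ≤ b * ε := by gcongr
    rcases ha.eq_or_lt with rfl | ha
    · have : b = 1 := by linarith
      subst this; linarith
    · have : a * ‖x - x'‖ < a * ε := by gcongr
      nlinarith
  have hcov : (⋃ i, D i) = univ := by
    rw [eq_univ_iff_forall]
    intro x
    have h1 : ∀ m, ∃ i, x ∈ C m i := fun m => by
      have := (hC m).1.2.2.2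
      exact mem_iUnion.mp (this ▸ mem_univ x)
    have : ∃ i, ∀ᶠ m in (𝒰 : Filter ℕ), x ∈ C m i := by
      by_contra hcon
      push Not at hcon
      have h2 : ∀ i, ∀ᶠ m in (𝒰 : Filter ℕ), x ∉ C m i := fun i =>
        (Ultrafilter.em 𝒰 _).resolve_left (by simpa using hcon i)
      obtain ⟨m, hm⟩ := (Filter.eventually_all.mpr h2).exists
      obtain ⟨i, hi⟩ := h1 m
      exact hm i hi
    obtain ⟨i, hi⟩ := this
    refine mem_iUnion.mpr ⟨i, fun ε hε => ?_⟩
    filter_upwards [hi] with m hm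
    exact ⟨x, hm, by simpa using hε⟩
  have hunif : ∀ i, ∀ K, IsCompact K → K ⊆ D i → ∀ ε > 0,
      ∀ᶠ m in (𝒰 : Filter ℕ), ∀ x ∈ K, ∃ y ∈ C m i, dist x y < ε := by
    intro i K hK hKD ε hε
    obtain ⟨t, htK, htf, htc⟩ := finite_cover_balls_of_compact hK (half_pos hε)
    have : ∀ᶠ m in (𝒰 : Filter ℕ), ∀ x ∈ t, ∃ y ∈ C m i, dist x y < ε / 2 :=
      (Filter.eventually_all_finite htf).mpr fun x hx => hKD (htK hx) _ (half_pos hε)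
    filter_upwards [this] with m hm x hx
    obtain ⟨x', hx', hxx'⟩ := mem_iUnion₂.mp (htc hx)
    obtain ⟨y, hy, hxy⟩ := hm x' hx'
    rw [mem_ball] at hxx'
    exact ⟨y, hy, by linarith [dist_triangle x x' y]⟩
  have hinterior : ∀ i, ∀ K, IsCompact K → K ⊆ interior (D i) →
      ∀ᶠ m in (𝒰 : Filter ℕ), K ⊆ C m i := by
    intro i K hK hKD
    obtain ⟨r, hr, hrK⟩ := hK.exists_cthickening_subset_open isOpen_interior hKD
    filter_upwards [hunif i _ hK.cthickening (hrK.trans interior_subset) r hr] with m hm z hz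
    refine mem_of_closedBall_near ((hC m).1.1 i) ((hC m).1.2.1 i) hr fun y hy => hm y ?_
    exact closedBall_subset_cthickening hz r hy
  have hpt : ∀ i, ∀ x ∈ interior (D i), ∀ᶠ m in (𝒰 : Filter ℕ), x ∈ interior (C m i) := by
    intro i x hx
    obtain ⟨r, hr, hrx⟩ := Metric.nhds_basis_closedBall.mem_iff.mp
      (isOpen_interior.mem_nhds hx)
    filter_upwards [hinterior i _ (isCompact_closedBall x r) hrx] with m hm
    exact mem_interior_iff_mem_nhds.mpr (Filter.mem_of_superset (closedBall_mem_nhds x hr) hm)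
  have hmeas : ∀ i, ν.real (D i) ≤ (n : ℝ)⁻¹ := by
    intro i
    have h0 : ν (D i) ≤ ν (interior (D i)) := by
      have : D i ⊆ interior (D i) ∪ frontier (D i) := by
        rw [← closure_eq_interior_union_frontier]; exact subset_closure
      refine (measure_mono this).trans ((measure_union_le _ _).trans ?_)
      rw [hν ((hDcv i).addHaar_frontier volume), add_zero]
    have h1 : ν (interior (D i)) ≤ (n : ℝ≥0∞)⁻¹ := by
      rw [isOpen_interior.measure_eq_iSup_isCompact]
      refine iSup_le fun K => iSup_le fun hKD => iSup_le fun hK => ?_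
      have h2 : ν.real K ≤ (n : ℝ)⁻¹ := by
        refine le_of_forall_pos_le_add fun ε hε => ?_
        have h3 : ∀ᶠ m : ℕ in (𝒰 : Filter ℕ), 1 / ((m : ℝ) + 1) < ε :=
          h𝒰 ((tendsto_one_div_add_atTop_nhds_zero_nat (𝕜 := ℝ)).eventually (gt_mem_nhds hε))
        obtain ⟨m, hm1, hm2⟩ := (h3.and (hinterior i K hK hKD)).exists
        have h4 : (μ m).real (C m i) = (n : ℝ)⁻¹ := by
          rw [measureReal_def, (hC m).2.1 i]; simp
        have h5 := hμν m (C m i) ((hC m).1.1 i).measurableSet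
        have h6 : ν.real K ≤ ν.real (C m i) := measureReal_mono hm2
        linarith
      rw [measureReal_def] at h2
      have hn : (n : ℝ≥0∞) ≠ 0 := by
        have := i.pos
        exact_mod_cast this.ne'
      rw [← ENNReal.toReal_le_toReal (measure_ne_top _ _) (ENNReal.inv_ne_top.mpr hn)]
      simpa using h2
    have h7 := h0.trans h1
    have hn : (n : ℝ≥0∞) ≠ 0 := by
      have := i.pos
      exact_mod_cast this.ne'
    rw [← ENNReal.toReal_le_toReal (measure_ne_top _ _) (ENNReal.inv_ne_top.mpr hn)] at h7
    simpa [measureReal_def] using h7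
  have hsum : 1 ≤ ∑ i, ν.real (D i) := by
    have h1 : ν.real (⋃ i, D i) ≤ ∑ i, ν.real (D i) := measureReal_iUnion_fintype_le _
    rw [hcov] at h1
    simpa using h1
  have heq : ∀ i, ν.real (D i) = (n : ℝ)⁻¹ := by
    intro i
    have hn : (n : ℝ) ≠ 0 := by
      have := i.pos
      exact_mod_cast this.ne'
    have h1 : ∑ i : Fin n, ν.real (D i) = ∑ i : Fin n, (n : ℝ)⁻¹ := by
      refine le_antisymm (Finset.sum_le_sum fun i _ => hmeas i) ?_
      simpa [hn] using hsum
    exact (Finset.sum_eq_sum_iff_of_le fun i _ => hmeas i).mp h1 i (Finset.mem_univ i)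
  refine ⟨D, ⟨hDcl, hDcv, ?_, hcov⟩, ?_, ?_⟩
  · intro i j hij
    rw [eq_empty_iff_forall_notMem]
    rintro x ⟨hxi, hxj⟩
    obtain ⟨m, hm1, hm2⟩ := ((hpt i x hxi).and (hpt j x hxj)).exists
    have := (hC m).1.2.2.1 i j hij
    rw [eq_empty_iff_forall_notMem] at this
    exact this x ⟨hm1, hm2⟩
  · intro i
    have hn : (n : ℝ≥0∞) ≠ 0 := by
      have := i.pos
      exact_mod_cast this.ne'
    rw [← ENNReal.toReal_eq_toReal_iff' (measure_ne_top _ _) (ENNReal.inv_ne_top.mpr hn)]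
    simpa [measureReal_def] using heq i
  · intro v c hv
    have h1 : ∀ i, ∀ᶠ m in (𝒰 : Filter ℕ), Avoids (Hyperplane v c) (C m i) →
        Avoids (Hyperplane v c) (D i) := by
      intro i
      by_cases hi : Avoids (Hyperplane v c) (D i)
      · exact Filter.Eventually.of_forall fun m _ => hi
      · obtain ⟨x, hxH, hxD⟩ := nonempty_iff_ne_empty.mpr hi
        filter_upwards [hpt i x hxD] with m hm hav
        exact absurd (show x ∈ Hyperplane v c ∩ interior (C m i) from ⟨hxH, hm⟩)
          (by rw [show Hyperplane v c ∩ interior (C m i) = ∅ from hav]; exact notMem_empty x)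
    obtain ⟨m, hm⟩ := (Filter.eventually_all.mpr h1).exists
    exact ((hC m).2.2 v c hv).trans (ncard_le_ncard (fun i hi => hm i hi) (toFinite _))

lemma NiceMeasure.ac {d : ℕ} {μ : Measure (Euc d)} (h : NiceMeasure d μ) : μ ≪ volume := by
  obtain ⟨-, f, -, -, rfl⟩ := h
  exact withDensity_absolutelyContinuous _ _

lemma HasEquipartition.mono {d k k' n : ℕ} (h : HasEquipartition d k n) (hk : k' ≤ k) :
    HasEquipartition d k' n := by
  intro μ hμ
  obtain ⟨C, h1, h2, h3⟩ := h μ hμ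
  exact ⟨C, h1, h2, fun v c hv => hk.trans (h3 v c hv)⟩

open Classical in
lemma ncard_eq_sum {ι : Type*} [Fintype ι] (P : ι → Prop) :
    {i | P i}.ncard = ∑ i, if P i then 1 else 0 := by
  rw [Set.ncard_eq_toFinset_card', Finset.sum_boole]
  simp

lemma arith_step {k₁ k₂ n₁ n₂ s : ℕ} (h1 : k₁ ≤ s) (h2 : s ≤ n₁) (h3 : k₂ ≤ n₂) :
    k₁ * n₂ + k₂ * n₁ - k₁ * k₂ ≤ s * n₂ + (n₁ - s) * k₂ := by
  obtain ⟨a, rfl⟩ := Nat.exists_eq_add_of_le h1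
  obtain ⟨b, rfl⟩ := Nat.exists_eq_add_of_le h2
  obtain ⟨c, rfl⟩ := Nat.exists_eq_add_of_le h3
  rw [Nat.sub_le_iff_le_add, Nat.add_sub_cancel_left]
  nlinarith [Nat.zero_le (a * c)]

lemma prod_step {d k₁ k₂ n₁ n₂ : ℕ} (H₁ : HasEquipartition d k₁ n₁)
    (H₂ : HasEquipartition d k₂ n₂) :
    HasEquipartition d (k₁ * n₂ + k₂ * n₁ - k₁ * k₂) (n₁ * n₂) := by
  classical
  intro μ hμ
  have hμp := hμ.1
  obtain ⟨C, ⟨hCc, hCv, hCd, hCu⟩, hCm, hCh⟩ := H₁ μ hμ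
  have hn1 : ∀ i : Fin n₁, (n₁ : ℝ≥0∞) ≠ 0 := fun i => by
    have := i.pos
    exact_mod_cast this.ne'
  have hCm0 : ∀ i, μ (C i) ≠ 0 := fun i => by rw [hCm i]; simp
  have hex : ∀ i, ∃ D : Fin n₂ → Set (Euc d),
      IsEquipartition (ProbabilityTheory.cond μ (C i)) k₂ D := fun i =>
    eqAC_of_has H₂ _ (ProbabilityTheory.cond_isProbabilityMeasure (hCm0 i))
      ((ProbabilityTheory.cond_absolutelyContinuous).trans hμ.ac)
  choose D hD using hex
  set e : Fin n₁ × Fin n₂ ≃ Fin (n₁ * n₂) := finProdFinEquiv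
  refine ⟨fun p => C (e.symm p).1 ∩ D (e.symm p).1 (e.symm p).2, ⟨?_, ?_, ?_, ?_⟩, ?_, ?_⟩
  · exact fun p => (hCc _).inter ((hD _).1.1 _)
  · exact fun p => (hCv _).inter ((hD _).1.2.1 _)
  · intro p q hpq
    rw [interior_inter, interior_inter]
    have hpq' : e.symm p ≠ e.symm q := fun h => hpq (e.symm.injective h)
    generalize e.symm p = a at *
    generalize e.symm q = b at *
    obtain ⟨a1, a2⟩ := a
    obtain ⟨b1, b2⟩ := b
    rw [eq_empty_iff_forall_notMem]
    rintro x ⟨⟨h1, h2⟩, ⟨h3, h4⟩⟩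
    by_cases h : a1 = b1
    · subst h
      have h5 : a2 ≠ b2 := fun h => hpq' (by rw [h])
      have := (hD a1).1.2.2.1 a2 b2 h5
      rw [eq_empty_iff_forall_notMem] at this
      exact this x ⟨h2, h4⟩
    · have := hCd a1 b1 h
      rw [eq_empty_iff_forall_notMem] at this
      exact this x ⟨h1, h3⟩
  · rw [eq_univ_iff_forall]
    intro x
    obtain ⟨i, hi⟩ := mem_iUnion.mp (hCu ▸ mem_univ x)
    obtain ⟨j, hj⟩ := mem_iUnion.mp ((hD i).1.2.2.2 ▸ mem_univ x)
    exact mem_iUnion.mpr ⟨e (i, j), by simpa using ⟨hi, hj⟩⟩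
  · intro p
    have h1 := (hD (e.symm p).1).2.1 (e.symm p).2
    rw [ProbabilityTheory.cond_apply (hCc _).measurableSet, hCm, inv_inv] at h1
    have h0 := hn1 (e.symm p).1
    have htop : (n₁ : ℝ≥0∞) ≠ ⊤ := ENNReal.natCast_ne_top n₁
    rw [Nat.cast_mul, ENNReal.mul_inv (Or.inl h0) (Or.inl htop), ← h1, ← mul_assoc,
      ENNReal.inv_mul_cancel h0 htop, one_mul]
  · intro v c hv
    rw [ncard_eq_sum, ← e.sum_comp, Fintype.sum_prod_type]
    simp only [Equiv.symm_apply_apply]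
    have hS := hCh v c hv
    set S := {i | Avoids (Hyperplane v c) (C i)} with hSdef
    have hsub : ∀ {A B : Set (Euc d)}, A ⊆ B → Avoids (Hyperplane v c) B →
        Avoids (Hyperplane v c) A := by
      intro A B hAB hB
      exact subset_eq_empty (inter_subset_inter_right _ (interior_mono hAB)) hB
    have hk2 : ∀ i : Fin n₁, k₂ ≤ n₂ := fun i => by
      refine ((hD i).2.2 v c hv).trans ((ncard_le_ncard (subset_univ _) (toFinite _)).trans ?_)
      simp [ncard_univ]
    have hrow : ∀ i, (if i ∈ S then n₂ else k₂) ≤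
        ∑ j, if Avoids (Hyperplane v c) (C i ∩ D i j) then 1 else 0 := by
      intro i
      split_ifs with hi
      · have : ∀ j, Avoids (Hyperplane v c) (C i ∩ D i j) := fun j => hsub inter_subset_left hi
        simp [this]
      · refine ((hD i).2.2 v c hv).trans ?_
        rw [ncard_eq_sum]
        refine Finset.sum_le_sum fun j _ => ?_
        split_ifs with h1 h2
        · rfl
        · exact absurd (hsub inter_subset_right h1) h2
        · simp
        · simp
    refine le_trans ?_ (Finset.sum_le_sum fun i _ => hrow i)
    have hS1 : S.ncard ≤ n₁ := by
      refine (ncard_le_ncard (subset_univ _) (toFinite _)).trans ?_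
      simp [ncard_univ]
    have hcard : ∑ i : Fin n₁, (if i ∈ S then n₂ else k₂) = S.ncard * n₂ + (n₁ - S.ncard) * k₂ := by
      rw [Finset.sum_ite, Finset.sum_const, Finset.sum_const]
      have h1 : (Finset.univ.filter (fun i => i ∈ S)).card = S.ncard := by
        rw [Set.ncard_eq_toFinset_card']
        congr 1
        ext; simp
      have h2 := Finset.card_filter_add_card_filter_not (s := (Finset.univ : Finset (Fin n₁)))
        (fun i => i ∈ S)
      rw [h1, Finset.card_univ, Fintype.card_fin] at h2
      have h3 : (Finset.univ.filter (fun i => i ∉ S)).card = n₁ - S.ncard := by omega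
      rw [h1, h3]
      simp
    rw [hcard]
    rcases Nat.eq_zero_or_pos n₁ with h0 | h0
    · subst h0
      have : k₁ = 0 := by omega
      simp [this]
    · exact arith_step hS hS1 (hk2 ⟨0, h0⟩)

lemma centerpoint {d : ℕ} (μ : Measure (Euc d)) [IsProbabilityMeasure μ] :
    ∃ p : Euc d, ∀ v : Euc d, 1 / ((d : ℝ) + 1) ≤ μ.real {x | 0 ≤ inner ℝ v (x - p)} := by
  classical
  let ι := {K : Set (Euc d) // IsCompact K ∧ Convex ℝ K ∧ (d : ℝ) / (d + 1) < μ.real K}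
  have hhelly : (⋂ i : ι, i.1).Nonempty := by
    refine Convex.helly_theorem_compact' (𝕜 := ℝ) (fun i : ι => i.2.2.1) (fun i => i.2.1) ?_
    intro I hI
    rw [finrank_euclideanSpace_fin] at hI
    by_contra hne
    rw [not_nonempty_iff_eq_empty] at hne
    have h1 : (⋃ i ∈ I, (i.1)ᶜ) = univ := by
      rw [← compl_empty, ← hne]; simp [compl_iInter]
    have h2 : (1 : ℝ) ≤ ∑ i ∈ I, μ.real (i.1)ᶜ := by
      have := measureReal_biUnion_finset_le (μ := μ) I (fun i : ι => (i.1)ᶜ)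
      rw [h1] at this
      simpa using this
    have h3 : ∀ i ∈ I, μ.real (i.1)ᶜ < 1 / ((d : ℝ) + 1) := by
      intro i _
      rw [probReal_compl_eq_one_sub i.2.1.measurableSet]
      have h4 := i.2.2.2
      have h5 : (d : ℝ) / (d + 1) + 1 / ((d : ℝ) + 1) = 1 := by field_simp
      linarith
    rcases I.eq_empty_or_nonempty with rfl | hIn
    · simp at h2; linarith
    · have h4 := Finset.sum_lt_sum_of_nonempty hIn h3
      rw [Finset.sum_const, nsmul_eq_mul] at h4
      have h5 : (I.card : ℝ) ≤ d + 1 := by exact_mod_cast hI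
      have h6 : (I.card : ℝ) * (1 / ((d : ℝ) + 1)) ≤ 1 := by
        rw [mul_one_div, div_le_one (by positivity)]; exact h5
      linarith
  obtain ⟨p, hp⟩ := hhelly
  refine ⟨p, fun v => ?_⟩
  by_contra hlt
  push Not at hlt
  have hmeas : MeasurableSet {x : Euc d | 0 ≤ inner ℝ v (x - p)} :=
    (isClosed_le continuous_const (by fun_prop)).measurableSet
  set K : ℕ → Set (Euc d) := fun m =>
    closedBall 0 (m : ℝ) ∩ {x | inner ℝ v (x - p) ≤ -(1 / ((m : ℝ) + 1))} with hK
  have hKu : (⋃ m, K m) = {x : Euc d | 0 ≤ inner ℝ v (x - p)}ᶜ := by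
    ext x
    simp only [hK, mem_iUnion, mem_inter_iff, mem_closedBall, dist_zero_right, mem_ofPred_eq,
      mem_compl_iff, not_le]
    constructor
    · rintro ⟨m, -, hm⟩
      have : 0 < 1 / ((m : ℝ) + 1) := by positivity
      linarith
    · intro hx
      obtain ⟨m1, hm1⟩ := exists_nat_ge ‖x‖
      obtain ⟨m2, hm2⟩ := exists_nat_one_div_lt (neg_pos.mpr hx)
      refine ⟨max m1 m2, hm1.trans (by exact_mod_cast le_max_left _ _), ?_⟩
      have : 1 / (((max m1 m2 : ℕ) : ℝ) + 1) ≤ 1 / ((m2 : ℝ) + 1) := by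
        apply one_div_le_one_div_of_le (by positivity)
        gcongr
        exact le_max_right _ _
      linarith
  have hKm : Monotone K := by
    intro a b hab x hx
    refine ⟨closedBall_subset_closedBall (by exact_mod_cast hab) hx.1, ?_⟩
    have : 1 / ((b : ℝ) + 1) ≤ 1 / ((a : ℝ) + 1) := by
      apply one_div_le_one_div_of_le (by positivity)
      gcongr
    have := hx.2
    simp only [mem_ofPred_eq] at *
    linarith
  have hT := tendsto_measure_iUnion_atTop (μ := μ) hKm
  rw [hKu] at hT
  have hT' : Filter.Tendsto (fun m => μ.real (K m)) Filter.atTop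
      (nhds (μ.real {x : Euc d | 0 ≤ inner ℝ v (x - p)}ᶜ)) :=
    (ENNReal.tendsto_toReal (measure_ne_top _ _)).comp hT
  rw [probReal_compl_eq_one_sub hmeas] at hT'
  have h5 : (d : ℝ) / (d + 1) + 1 / ((d : ℝ) + 1) = 1 := by field_simp
  obtain ⟨m, hm⟩ := (hT'.eventually (lt_mem_nhds (show (d : ℝ) / (d + 1) < _ by linarith))).exists
  have hcl : IsClosed {x : Euc d | inner ℝ v (x - p) ≤ -(1 / ((m : ℝ) + 1))} :=
    isClosed_le (by fun_prop) continuous_const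
  have hcv : Convex ℝ {x : Euc d | inner ℝ v (x - p) ≤ -(1 / ((m : ℝ) + 1))} := by
    have : {x : Euc d | inner ℝ v (x - p) ≤ -(1 / ((m : ℝ) + 1))} =
        {x | innerSL ℝ v x ≤ -(1 / ((m : ℝ) + 1)) + inner ℝ v p} := by
      ext x
      simp only [mem_ofPred_eq, inner_sub_right, innerSL_apply_apply]
      constructor <;> intro h <;> linarith
    rw [this]
    exact convex_halfSpace_le (innerSL ℝ v).isLinear _
  have hpm := mem_iInter.mp hp ⟨K m, (isCompact_closedBall _ _).inter_right hcl,
    (convex_closedBall _ _).inter hcv, hm⟩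
  have := hpm.2
  simp only [mem_ofPred_eq, sub_self, inner_zero_right] at this
  have : 0 < 1 / ((m : ℝ) + 1) := by positivity
  linarith

section
variable {E : Type*} [NormedAddCommGroup E] [NormedSpace ℝ E]

lemma isOpenMap_functional {l : E →L[ℝ] ℝ} (hl : l ≠ 0) : IsOpenMap l := by
  refine l.isOpenMap_of_ne_zero hl

lemma null_level [FiniteDimensional ℝ E] [MeasurableSpace E] [BorelSpace E] (μ : Measure E) [μ.IsAddHaarMeasure]
    {l : E →L[ℝ] ℝ} (hl : l ≠ 0) (c : ℝ) : μ {x | l x = c} = 0 := by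
  have hcl : IsClosed {x | l x = c} := isClosed_eq l.continuous continuous_const
  have hinterior : interior {x | l x = c} = ∅ := by
    have := (isOpenMap_functional hl).preimage_interior_eq_interior_preimage l.continuous {c}
    rw [interior_singleton, preimage_empty] at this
    exact this.symm
  have hcv : Convex ℝ {x | l x = c} := convex_hyperplane l.isLinear c
  have := hcv.addHaar_frontier μ
  rwa [hcl.frontier_eq, hinterior, sdiff_empty] at this

end

lemma null_hyper {d : ℕ} {μ : Measure (Euc d)} (hμ : μ ≪ volume) {v : Euc d} (hv : v ≠ 0)
    (p : Euc d) : μ {x | inner ℝ v (x - p) = 0} = 0 := by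
  apply hμ
  have hl : innerSL ℝ v ≠ 0 := by
    intro h
    have := congrArg (fun f => f v) h
    simp at this
    exact hv this
  have := null_level (volume : Measure (Euc d)) hl (inner ℝ v p)
  convert this using 2
  ext x
  simp [inner_sub_right, sub_eq_zero]

lemma exists_halving {d : ℕ} (μ : Measure (Euc (d + 1))) [IsProbabilityMeasure μ]
    (hμ : μ ≪ volume) (p : Euc (d + 1))
    (hp : ∀ v, 1 / ((d : ℝ) + 2) ≤ μ.real {x | 0 ≤ inner ℝ v (x - p)}) :
    ∃ u : Euc (d + 1), u ≠ 0 ∧ μ.real {x | 0 < inner ℝ u (x - p)} = 1 / 2 ∧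
      μ.real {x | inner ℝ u (x - p) < 0} = 1 / 2 := by
  set G : Euc (d + 1) → ℝ := fun u => μ.real {x | 0 < inner ℝ u (x - p)} with hG
  have hle : ∀ u ≠ 0, μ.real {x | 0 ≤ inner ℝ u (x - p)} = G u := by
    intro u hu
    refine le_antisymm ?_ (measureReal_mono fun x (hx : 0 < inner ℝ u (x - p)) =>
      show 0 ≤ inner ℝ u (x - p) from le_of_lt hx)
    have h1 : {x : Euc (d + 1) | 0 ≤ inner ℝ u (x - p)} ⊆
        {x | 0 < inner ℝ u (x - p)} ∪ {x | inner ℝ u (x - p) = 0} := fun x hx => by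
      rcases (show (0 : ℝ) ≤ inner ℝ u (x - p) from hx).lt_or_eq with h | h
      · exact Or.inl h
      · exact Or.inr h.symm
    refine (measureReal_mono h1).trans ((measureReal_union_le _ _).trans ?_)
    rw [measureReal_def μ {x | inner ℝ u (x - p) = 0}, null_hyper hμ hu]
    simp [hG]
  have hneg : ∀ u, {x : Euc (d + 1) | inner ℝ u (x - p) < 0} = {x | 0 < inner ℝ (-u) (x - p)} := by
    intro u; ext x; simp [inner_neg_left]
  have hGn : ∀ u ≠ 0, G (-u) = 1 - G u := by
    intro u hu
    have hm : MeasurableSet {x : Euc (d + 1) | 0 ≤ inner ℝ u (x - p)} :=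
      (isClosed_le continuous_const (by fun_prop)).measurableSet
    rw [← hle u hu, ← probReal_compl_eq_one_sub hm]
    simp only [hG]
    rw [← hneg]
    congr 1
    ext x; simp
  suffices h : ∃ u ≠ 0, G u = 1 / 2 by
    obtain ⟨u, hu, hGu⟩ := h
    refine ⟨u, hu, hGu, ?_⟩
    rw [hneg]
    change G (-u) = _
    rw [hGn u hu, hGu]; norm_num
  obtain ⟨e, he⟩ := exists_ne (0 : Euc (d + 1))
  rcases Nat.eq_zero_or_pos d with h0 | h0
  · refine ⟨e, he, ?_⟩
    subst h0
    have h1 := hp e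
    have h2 := hp (-e)
    rw [hle e he] at h1
    rw [hle (-e) (neg_ne_zero.mpr he), hGn e he] at h2
    norm_num at h1 h2
    linarith
  · have hrank : 1 < Module.rank ℝ (Euc (d + 1)) := by
      rw [← Module.finrank_eq_rank, finrank_euclideanSpace_fin]
      exact_mod_cast Nat.lt_add_of_pos_left h0
    have hconn := (isConnected_compl_singleton_of_one_lt_rank hrank (0 : Euc (d + 1))).isPreconnected
    have hcont : ContinuousOn G {0}ᶜ := by
      intro u hu
      apply ContinuousAt.continuousWithinAt
      have hind : ∀ w, G w = ∫ x, indicator {x : Euc (d + 1) | 0 < inner ℝ w (x - p)} (fun _ => (1 : ℝ)) x ∂μ := by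
        intro w
        have hm : MeasurableSet {x : Euc (d + 1) | 0 < inner ℝ w (x - p)} :=
          (isOpen_lt continuous_const (by fun_prop)).measurableSet
        rw [integral_indicator hm]; simp [hG]
      rw [show G = _ from funext hind]
      refine continuousAt_of_dominated (bound := fun _ => 1) ?_ ?_ (integrable_const _) ?_
      · refine Filter.Eventually.of_forall fun w => ?_
        have hm : MeasurableSet {x : Euc (d + 1) | 0 < inner ℝ w (x - p)} :=
          (isOpen_lt continuous_const (by fun_prop)).measurableSet
        exact (stronglyMeasurable_const.indicator hm).aestronglyMeasurable
      · refine Filter.Eventually.of_forall fun w => Filter.Eventually.of_forall fun x => ?_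
        refine (norm_indicator_le_norm_self _ _).trans (by simp)
      · have hae : ∀ᵐ x ∂μ, inner ℝ u (x - p) ≠ 0 := by
          rw [ae_iff]; simpa using null_hyper hμ hu p
        filter_upwards [hae] with x hx
        have hc : Continuous fun w : Euc (d + 1) => inner ℝ w (x - p) := by fun_prop
        rcases lt_or_gt_of_ne hx with h | h
        · refine (continuousAt_const (y := (0 : ℝ))).congr ?_
          filter_upwards [hc.continuousAt.eventually (gt_mem_nhds h)] with w hw
          rw [indicator_of_notMem]
          exact not_lt.mpr (le_of_lt hw)
        · refine (continuousAt_const (y := (1 : ℝ))).congr ?_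
          filter_upwards [hc.continuousAt.eventually (lt_mem_nhds h)] with w hw
          rw [indicator_of_mem]
          exact hw
    have hIVT : ∀ a b : Euc (d + 1), a ≠ 0 → b ≠ 0 → G a ≤ 1 / 2 → 1 / 2 ≤ G b →
        ∃ u ≠ 0, G u = 1 / 2 := by
      intro a b ha hb h1 h2
      obtain ⟨u, hu, hGu⟩ := hconn.intermediate_value ha hb hcont ⟨h1, h2⟩
      exact ⟨u, hu, hGu⟩
    have hne := hGn e he
    rcases le_total (G e) (1 / 2) with h | h
    · exact hIVT e (-e) he (neg_ne_zero.mpr he) h (by linarith)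
    · exact hIVT (-e) e (neg_ne_zero.mpr he) he (by linarith) h

/-- Central projection of the half-space `t > 0` of `ℝ × ℝ^d` to `ℝ^d`. -/
def centralProj {d : ℕ} (z : ℝ × Euc d) : Euc d := z.1⁻¹ • z.2

lemma measurable_centralProj {d : ℕ} : Measurable (centralProj (d := d)) := by
  unfold centralProj
  fun_prop

lemma null_centralProj {d : ℕ} {N : Set (Euc d)} (hN : MeasurableSet N) (h0 : volume N = 0) :
    (volume : Measure (ℝ × Euc d)) ({z | 0 < z.1} ∩ centralProj ⁻¹' N) = 0 := by
  have hU : MeasurableSet {z : ℝ × Euc d | 0 < z.1} :=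
    (isOpen_lt continuous_const continuous_fst).measurableSet
  rw [Measure.volume_eq_prod, Measure.measure_prod_null (hU.inter (measurable_centralProj hN))]
  refine Filter.Eventually.of_forall fun t => ?_
  by_cases ht : 0 < t
  · refine measure_mono_null (t := (fun y => t⁻¹ • y) ⁻¹' N) (fun y hy => hy.2) ?_
    rw [Measure.addHaar_preimage_smul volume (inv_ne_zero ht.ne'), h0, mul_zero]
  · refine measure_mono_null (t := ∅) (fun y hy => ht hy.1) measure_empty

lemma subset_interior_union_frontier {X : Type*} [TopologicalSpace X] (s : Set X) :
    s ⊆ interior s ∪ frontier s := by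
  rw [← closure_eq_interior_union_frontier]; exact subset_closure

lemma one_side {d : ℕ} {C : Set (Euc d)} (hv : Convex ℝ C)
    (hne : (interior C).Nonempty) (w : Euc d) (c : ℝ) (hav : Avoids (Hyperplane w c) C) :
    (∀ y ∈ C, c ≤ inner ℝ w y) ∨ (∀ y ∈ C, inner ℝ w y ≤ c) := by
  have hcont : Continuous fun y : Euc d => inner ℝ w y := by fun_prop
  have hsub : C ⊆ closure (interior C) := by
    rw [hv.closure_interior_eq_closure_of_nonempty_interior hne]; exact subset_closure
  have hcl1 : IsClosed {y : Euc d | c ≤ inner ℝ w y} := isClosed_le continuous_const hcont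
  have hcl2 : IsClosed {y : Euc d | inner ℝ w y ≤ c} := isClosed_le hcont continuous_const
  by_cases h1 : ∀ y ∈ interior C, c ≤ inner ℝ w y
  · left
    intro y hy
    exact closure_minimal (fun y hy => h1 y hy) hcl1 (hsub hy)
  · by_cases h2 : ∀ y ∈ interior C, inner ℝ w y ≤ c
    · right
      intro y hy
      exact closure_minimal (fun y hy => h2 y hy) hcl2 (hsub hy)
    · exfalso
      push Not at h1 h2
      obtain ⟨a, ha, hac⟩ := h1
      obtain ⟨b, hb, hbc⟩ := h2
      obtain ⟨x, hx, hxc⟩ := hv.interior.isPreconnected.intermediate_value ha hb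
        hcont.continuousOn ⟨hac.le, hbc.le⟩
      have : x ∈ Hyperplane w c ∩ interior C := ⟨hxc, hx⟩
      rw [show Hyperplane w c ∩ interior C = ∅ from hav] at this
      exact this

instance haarF {d : ℕ} : (volume : Measure (ℝ × Euc d)).IsAddHaarMeasure := by
  rw [Measure.volume_eq_prod]; infer_instance

lemma cone_half {d k n : ℕ} (H : HasEquipartition d k n) (hkn : k ≤ n)
    (ρ : Measure (ℝ × Euc d)) [IsProbabilityMeasure ρ] (hρ : ρ ≪ volume)
    (hhalf : ρ {z | 0 < z.1} = 2⁻¹) :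
    ∃ D : Fin n → Set (ℝ × Euc d), (∀ i, IsClosed (D i)) ∧ (∀ i, Convex ℝ (D i)) ∧
      (∀ i j, i ≠ j → interior (D i) ∩ interior (D j) = ∅) ∧
      (∀ i, D i ⊆ {z | 0 ≤ z.1}) ∧ ({z | 0 ≤ z.1} ⊆ ⋃ i, D i) ∧
      (∀ i, ρ (D i) = 2⁻¹ * (n : ℝ≥0∞)⁻¹) ∧
      ∀ l : (ℝ × Euc d) →L[ℝ] ℝ,
        k ≤ {i | (∀ z ∈ D i, 0 ≤ l z) ∨ (∀ z ∈ D i, l z ≤ 0)}.ncard := by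
  set U : Set (ℝ × Euc d) := {z | 0 < z.1} with hUdef
  have hUo : IsOpen U := isOpen_lt continuous_const continuous_fst
  have hU0 : ρ U ≠ 0 := by rw [hhalf]; simp
  set ν : Measure (Euc d) := Measure.map centralProj (ProbabilityTheory.cond ρ U) with hν
  have hcp := ProbabilityTheory.cond_isProbabilityMeasure hU0
  have hνp : IsProbabilityMeasure ν :=
    Measure.isProbabilityMeasure_map measurable_centralProj.aemeasurable
  have hνm : ∀ N, MeasurableSet N → ν N = 2 * ρ (U ∩ centralProj ⁻¹' N) := by
    intro N hN
    rw [hν, Measure.map_apply measurable_centralProj hN,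
      ProbabilityTheory.cond_apply hUo.measurableSet, hhalf, inv_inv]
  have hνac : ν ≪ volume := by
    refine Measure.AbsolutelyContinuous.mk fun N hN h0 => ?_
    rw [hνm N hN, hρ (null_centralProj hN h0), mul_zero]
  obtain ⟨C, ⟨hCc, hCv, hCd, hCu⟩, hCm, hCh⟩ := eqAC_of_has H ν hνp hνac
  have hCint : ∀ i, (interior (C i)).Nonempty := by
    intro i
    by_contra hne
    rw [not_nonempty_iff_eq_empty] at hne
    have h1 := subset_interior_union_frontier (C i)
    rw [hne, empty_union] at h1
    have h2 : ν (C i) = 0 := measure_mono_null h1 (hνac ((hCv i).addHaar_frontier volume))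
    rw [hCm i] at h2
    simp at h2
  set S : Fin n → Set (ℝ × Euc d) := fun i => U ∩ centralProj ⁻¹' (C i) with hS
  have hSv : ∀ i, Convex ℝ (S i) := by
    intro i z hz z' hz' a b ha hb hab
    have h1 : 0 < z.1 := hz.1
    have h2 : 0 < z'.1 := hz'.1
    have h3 : 0 < a * z.1 + b * z'.1 := by
      rcases ha.eq_or_lt with rfl | ha
      · have : b = 1 := by linarith
        subst this; linarith
      · have := mul_pos ha h1
        have := mul_nonneg hb h2.le
        linarith
    refine ⟨by simpa [hUdef] using h3, ?_⟩
    have h4 := hCv i hz.2 hz'.2 (a := a * z.1 / (a * z.1 + b * z'.1))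
      (b := b * z'.1 / (a * z.1 + b * z'.1)) (by positivity) (by positivity) (by field_simp)
    change centralProj (a • z + b • z') ∈ C i
    convert h4 using 1
    simp only [centralProj, Prod.fst_add, Prod.smul_fst, Prod.snd_add, Prod.smul_snd, smul_eq_mul,
      smul_smul, smul_add]
    congr 2 <;> field_simp
  have hSU : (⋃ i, S i) = U := by
    simp only [hS]
    rw [← inter_iUnion, ← preimage_iUnion, hCu, preimage_univ, inter_univ]
  have hUcl : closure U = {z | 0 ≤ z.1} := by
    have h := isOpenMap_fst.preimage_closure_eq_closure_preimage
      (continuous_fst (X := ℝ) (Y := Euc d)) (Ioi (0 : ℝ))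
    rw [closure_Ioi] at h
    exact h.symm
  have hclS : ∀ i, closure (S i) ⊆ S i ∪ frontier (S i) := by
    intro i
    rw [closure_eq_interior_union_frontier]
    exact union_subset_union_left _ interior_subset
  have hfr : ∀ i, (volume : Measure (ℝ × Euc d)) (frontier (S i)) = 0 := fun i =>
    (hSv i).addHaar_frontier volume
  refine ⟨fun i => closure (S i), fun i => isClosed_closure, fun i => (hSv i).closure, ?_, ?_, ?_,
    ?_, ?_⟩
  · intro i j hij
    have hCij : volume (C i ∩ C j) = 0 := by
      have h1 : C i ∩ C j ⊆ frontier (C i) ∪ frontier (C j) := by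
        rintro x ⟨hi, hj⟩
        rcases subset_interior_union_frontier _ hi with h | h
        · rcases subset_interior_union_frontier _ hj with h' | h'
          · exact absurd (show x ∈ interior (C i) ∩ interior (C j) from ⟨h, h'⟩)
              (by rw [hCd i j hij]; exact notMem_empty x)
          · exact Or.inr h'
        · exact Or.inl h
      exact measure_mono_null h1 (measure_union_null ((hCv i).addHaar_frontier volume)
        ((hCv j).addHaar_frontier volume))
    have hopen : IsOpen (interior (closure (S i)) ∩ interior (closure (S j))) :=
      isOpen_interior.inter isOpen_interior
    rw [← hopen.measure_eq_zero_iff (volume : Measure (ℝ × Euc d))]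
    have hsub : interior (closure (S i)) ∩ interior (closure (S j)) ⊆
        (U ∩ centralProj ⁻¹' (C i ∩ C j)) ∪ (frontier (S i) ∪ frontier (S j)) := by
      rintro x ⟨hi, hj⟩
      rcases hclS i (interior_subset hi) with h | h
      · rcases hclS j (interior_subset hj) with h' | h'
        · exact Or.inl ⟨h.1, h.2, h'.2⟩
        · exact Or.inr (Or.inr h')
      · exact Or.inr (Or.inl h)
    exact measure_mono_null hsub (measure_union_null
      (null_centralProj ((hCc i).inter (hCc j)).measurableSet hCij)
      (measure_union_null (hfr i) (hfr j)))
  · intro i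
    rw [← hUcl]
    exact closure_mono inter_subset_left
  · rw [← hUcl, ← hSU, closure_iUnion_of_finite]
  · intro i
    have h1 : ρ (closure (S i)) = ρ (S i) := by
      refine le_antisymm ?_ (measure_mono subset_closure)
      refine (measure_mono (hclS i)).trans ((measure_union_le _ _).trans ?_)
      rw [hρ (hfr i), add_zero]
    have h2 := hνm (C i) (hCc i).measurableSet
    rw [hCm i] at h2
    rw [h1, h2, ← mul_assoc, ENNReal.inv_mul_cancel (by simp) (by simp), one_mul]
  · intro l
    obtain ⟨w, hw⟩ := (InnerProductSpace.toDual ℝ (Euc d)).surjective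
      (l.comp (ContinuousLinearMap.inr ℝ ℝ (Euc d)))
    set s := l (1, 0) with hs
    have hl : ∀ z : ℝ × Euc d, 0 < z.1 → l z = z.1 * (s + inner ℝ w (centralProj z)) := by
      intro z hz
      have h1 : z = z.1 • ((1 : ℝ), (0 : Euc d)) + z.1 • ((0 : ℝ), centralProj z) := by
        ext1
        · simp
        · simp [centralProj, smul_smul, hz.ne']
      have h2 : l (0, centralProj z) = inner ℝ w (centralProj z) := by
        have := congrArg (fun f => f (centralProj z)) hw
        simpa using this.symm
      conv_lhs => rw [h1]
      rw [map_add, map_smul, map_smul, h2, smul_eq_mul, smul_eq_mul]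
      ring
    have hcl1 : IsClosed {z | 0 ≤ l z} := isClosed_le continuous_const l.continuous
    have hcl2 : IsClosed {z | l z ≤ 0} := isClosed_le l.continuous continuous_const
    have key : ∀ i, ((∀ y ∈ C i, -s ≤ inner ℝ w y) ∨ (∀ y ∈ C i, inner ℝ w y ≤ -s)) →
        ((∀ z ∈ closure (S i), 0 ≤ l z) ∨ (∀ z ∈ closure (S i), l z ≤ 0)) := by
      rintro i (h | h)
      · left
        intro z hz
        refine closure_minimal (fun z hz => ?_) hcl1 hz
        have h1 := h _ hz.2
        have h2 : 0 < z.1 := hz.1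
        change 0 ≤ l z
        rw [hl z h2]
        exact mul_nonneg h2.le (by linarith)
      · right
        intro z hz
        refine closure_minimal (fun z hz => ?_) hcl2 hz
        have h1 := h _ hz.2
        have h2 : 0 < z.1 := hz.1
        change l z ≤ 0
        rw [hl z h2]
        exact mul_nonpos_of_nonneg_of_nonpos h2.le (by linarith)
    by_cases hw0 : w = 0
    · have : {i | (∀ z ∈ closure (S i), 0 ≤ l z) ∨ (∀ z ∈ closure (S i), l z ≤ 0)} = univ := by
        rw [eq_univ_iff_forall]
        intro i
        refine key i ?_
        subst hw0
        simp only [inner_zero_left]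
        rcases le_total s 0 with h | h
        · right; intro _ _; linarith
        · left; intro _ _; linarith
      rw [this, ncard_univ]
      simpa using hkn
    · refine (hCh w (-s) hw0).trans (ncard_le_ncard (fun i hi => key i ?_) (toFinite _))
      exact one_side (hCv i) (hCint i) w (-s) hi

lemma exists_coords {d : ℕ} {u : Euc (d + 1)} (hu : u ≠ 0) :
    ∃ e : Euc (d + 1) ≃L[ℝ] (ℝ × Euc d), ∀ x, (e x).1 = inner ℝ u x := by
  have hf : Fact (Module.finrank ℝ (Euc (d + 1)) = d + 1) := ⟨finrank_euclideanSpace_fin⟩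
  let B := OrthonormalBasis.fromOrthogonalSpanSingleton (𝕜 := ℝ) d hu
  let T : Euc (d + 1) →ₗ[ℝ] (ℝ × Euc d) :=
    (innerSL ℝ u).toLinearMap.prod
      (B.repr.toLinearEquiv.toLinearMap ∘ₗ (Submodule.orthogonalProjectionOnto (Submodule.span ℝ {u})ᗮ).toLinearMap)
  have hinj : Function.Injective T := by
    rw [injective_iff_map_eq_zero]
    intro x hx
    have h1 : inner ℝ u x = 0 := congrArg Prod.fst hx
    have h2 : B.repr (Submodule.orthogonalProjectionOnto (Submodule.span ℝ {u})ᗮ x) = 0 :=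
      congrArg Prod.snd hx
    rw [map_eq_zero_iff _ B.repr.injective] at h2
    have h3 : x ∈ (Submodule.span ℝ {u})ᗮ := Submodule.mem_orthogonal_singleton_iff_inner_right.mpr h1
    have h4 := Submodule.orthogonalProjectionOnto_mem_subspace_eq_self (⟨x, h3⟩ : (Submodule.span ℝ {u})ᗮ)
    rw [h2] at h4
    exact (congrArg Subtype.val h4).symm
  have hrank : Module.finrank ℝ (Euc (d + 1)) = Module.finrank ℝ (ℝ × Euc d) := by
    simp [Module.finrank_prod, add_comm]
  let e := LinearEquiv.ofInjectiveOfFinrankEq T hinj hrank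
  exact ⟨e.toContinuousLinearEquiv, fun x => rfl⟩

lemma cone_pull {d k n : ℕ} (H : HasEquipartition d k n) (hkn : k ≤ n)
    (μ : Measure (Euc (d + 1))) [IsProbabilityMeasure μ] (hμ : μ ≪ volume)
    (p : Euc (d + 1)) {u : Euc (d + 1)} (hu : u ≠ 0)
    (hhalf : μ {x | 0 < inner ℝ u (x - p)} = 2⁻¹) :
    ∃ D : Fin n → Set (Euc (d + 1)), (∀ i, IsClosed (D i)) ∧ (∀ i, Convex ℝ (D i)) ∧
      (∀ i j, i ≠ j → interior (D i) ∩ interior (D j) = ∅) ∧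
      (∀ i, ∀ x ∈ D i, 0 ≤ inner ℝ u (x - p)) ∧ (∀ x, 0 ≤ inner ℝ u (x - p) → ∃ i, x ∈ D i) ∧
      (∀ i, μ (D i) = 2⁻¹ * (n : ℝ≥0∞)⁻¹) ∧
      ∀ v : Euc (d + 1), k ≤ {i | (∀ x ∈ D i, 0 ≤ inner ℝ v (x - p)) ∨
        (∀ x ∈ D i, inner ℝ v (x - p) ≤ 0)}.ncard := by
  obtain ⟨e, he⟩ := exists_coords hu
  let φ : Euc (d + 1) ≃ₜ (ℝ × Euc d) := (Homeomorph.subRight p).trans e.toHomeomorph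
  have hφ : ∀ x, φ x = e (x - p) := fun x => rfl
  have hφm : Measurable φ := φ.continuous.measurable
  set ρ := Measure.map φ μ with hρdef
  have hρp : IsProbabilityMeasure ρ := Measure.isProbabilityMeasure_map hφm.aemeasurable
  have hvol : Measure.map φ volume ≪ volume := by
    have h1 : Measure.map φ volume = Measure.map e volume := by
      have : (φ : Euc (d + 1) → ℝ × Euc d) = e ∘ (fun x => x - p) := rfl
      rw [this, ← Measure.map_map e.continuous.measurable (by fun_prop)]
      congr 1
      exact (measurePreserving_sub_right volume p).map_eq
    rw [h1]
    have := e.isAddHaarMeasure_map (volume : Measure (Euc (d + 1)))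
    exact Measure.absolutelyContinuous_isAddHaarMeasure _ _
  have hρ : ρ ≪ volume := (hμ.map hφm).trans hvol
  have hhalf' : ρ {z | 0 < z.1} = 2⁻¹ := by
    rw [hρdef, Measure.map_apply hφm (isOpen_lt continuous_const continuous_fst).measurableSet,
      ← hhalf]
    congr 1
    ext x
    change 0 < (e (x - p)).1 ↔ _
    rw [he]; rfl
  obtain ⟨D, h1, h2, h3, h4, h5, h6, h7⟩ := cone_half H hkn ρ hρ hhalf'
  refine ⟨fun i => φ ⁻¹' D i, fun i => (h1 i).preimage φ.continuous, ?_, ?_, ?_, ?_, ?_, ?_⟩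
  · intro i x hx y hy a b ha hb hab
    change φ _ ∈ D i
    have : φ (a • x + b • y) = a • φ x + b • φ y := by
      simp only [hφ, ← map_smul, ← map_add]
      congr 1
      have : b = 1 - a := by linarith
      subst this
      module
    rw [this]
    exact h2 i hx hy ha hb hab
  · intro i j hij
    rw [← φ.preimage_interior, ← φ.preimage_interior, ← preimage_inter, h3 i j hij, preimage_empty]
  · intro i x hx
    rw [← he]
    exact h4 i hx
  · intro x hx
    rw [← he] at hx
    obtain ⟨i, hi⟩ := mem_iUnion.mp (h5 hx)
    exact ⟨i, hi⟩
  · intro i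
    rw [← h6 i, hρdef, Measure.map_apply hφm (h1 i).measurableSet]
  · intro v
    refine (h7 ((innerSL ℝ v).comp (e.symm : (ℝ × Euc d) →L[ℝ] Euc (d + 1)))).trans
      (ncard_le_ncard ?_ (toFinite _))
    rintro i (h | h)
    · left
      intro x hx
      simpa [hφ] using h _ hx
    · right
      intro x hx
      simpa [hφ] using h _ hx

lemma iterate_one {d m : ℕ} (H : HasEquipartition d 1 (m + 1)) (j : ℕ) :
    ∃ k, k + m ^ (j + 1) = (m + 1) ^ (j + 1) ∧ HasEquipartition d k ((m + 1) ^ (j + 1)) := by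
  induction j with
  | zero => exact ⟨1, by ring, by simpa using H⟩
  | succ j ih =>
    obtain ⟨k, hk, hH⟩ := ih
    refine ⟨k * (m + 1) + m ^ (j + 1), ?_, ?_⟩
    · rw [pow_succ (m + 1), ← hk]; ring
    · rw [pow_succ (m + 1) (j + 1)]
      refine (prod_step hH H).mono ?_
      omega

lemma exists_small {d n₀ : ℕ} (h0 : 0 < n₀) (H : HasEquipartition d 1 n₀) (c : ℕ) :
    ∃ k n, k ≤ n ∧ (n - k) * c < n ∧ HasEquipartition d k n := by
  obtain ⟨m, rfl⟩ : ∃ m, n₀ = m + 1 := ⟨n₀ - 1, by omega⟩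
  have hlt : (m : ℝ) / (m + 1) < 1 := by
    rw [div_lt_one (by positivity)]; linarith
  obtain ⟨j, hj⟩ := exists_pow_lt_of_lt_one (show (0 : ℝ) < 1 / (c + 1) by positivity) hlt
  obtain ⟨k, hk, hH⟩ := iterate_one H j
  refine ⟨k, (m + 1) ^ (j + 1), by omega, ?_, hH⟩
  have h1 : (m + 1) ^ (j + 1) - k = m ^ (j + 1) := by omega
  rw [h1]
  have h2 : ((m : ℝ) / (m + 1)) ^ (j + 1) < 1 / (c + 1) :=
    (pow_le_pow_of_le_one (by positivity) hlt.le (Nat.le_succ j)).trans_lt hj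
  rw [div_pow, div_lt_div_iff₀ (by positivity) (by positivity), one_mul] at h2
  have h3 : m ^ (j + 1) * (c + 1) < (m + 1) ^ (j + 1) := by exact_mod_cast h2
  exact lt_of_le_of_lt (Nat.mul_le_mul_left _ (Nat.le_succ c)) h3

/-- The union of the parts outside a set `A` of at least `k` indices has small measure. -/
lemma small_parts_union {d k n : ℕ} (μ : Measure (Euc d)) [IsProbabilityMeasure μ]
    {D : Fin n → Set (Euc d)} (hD : ∀ i, μ (D i) = 2⁻¹ * (n : ℝ≥0∞)⁻¹) (A : Set (Fin n))
    (hA : k ≤ A.ncard) : μ.real (⋃ i ∈ Aᶜ, D i) ≤ ((n : ℝ) - k) * (2⁻¹ * (n : ℝ)⁻¹) := by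
  classical
  have h1 : (⋃ i ∈ Aᶜ, D i) = ⋃ i ∈ (Finset.univ.filter fun i => i ∉ A), D i := by
    ext x; simp
  rw [h1]
  refine (measureReal_biUnion_finset_le _ _).trans ?_
  have h2 : ∀ i, μ.real (D i) = 2⁻¹ * (n : ℝ)⁻¹ := fun i => by
    rw [measureReal_def, hD i]; simp
  simp only [h2, Finset.sum_const, nsmul_eq_mul]
  gcongr
  have h3 : (Finset.univ.filter (fun i => i ∈ A)).card = A.ncard := by
    rw [Set.ncard_eq_toFinset_card']
    congr 1
    ext; simp
  have h4 := Finset.card_filter_add_card_filter_not (s := (Finset.univ : Finset (Fin n)))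
    (fun i => i ∈ A)
  rw [h3, Finset.card_univ, Fintype.card_fin] at h4
  have h5 : (A.ncard : ℝ) + ((Finset.univ.filter (fun i => i ∉ A)).card : ℝ) = n := by
    exact_mod_cast h4
  have h6 : (k : ℝ) ≤ A.ncard := by exact_mod_cast hA
  linarith

lemma dim_step {d k n : ℕ} (hn : 0 < n) (hkn : k ≤ n) (hfrac : (n - k) * (d + 2) < n)
    (H : HasEquipartition d k n) : HasEquipartition (d + 1) 1 (n + n) := by
  intro μ hμ
  have hμp := hμ.1
  have hac := hμ.ac
  obtain ⟨p, hp⟩ := centerpoint μ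
  have hp : ∀ v, 1 / ((d : ℝ) + 2) ≤ μ.real {x | 0 ≤ inner ℝ v (x - p)} := by
    intro v
    refine le_trans (le_of_eq ?_) (hp v)
    push_cast; ring
  obtain ⟨u, hu, hu1, hu2⟩ := exists_halving μ hac p hp
  have conv : ∀ A : Set (Euc (d + 1)), μ.real A = 1 / 2 → μ A = 2⁻¹ := by
    intro A hA
    rw [← ENNReal.toReal_eq_toReal_iff' (measure_ne_top _ _) (by simp)]
    rw [measureReal_def] at hA
    rw [hA]; simp
  have hu2' : μ {x | 0 < inner ℝ (-u) (x - p)} = 2⁻¹ := by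
    rw [← conv _ hu2]
    congr 1
    ext x; simp [inner_neg_left]
  obtain ⟨D, hDc, hDv, hDd, hDs, hDu, hDm, hDh⟩ := cone_pull H hkn μ hac p hu (conv _ hu1)
  obtain ⟨D', hDc', hDv', hDd', hDs', hDu', hDm', hDh'⟩ :=
    cone_pull H hkn μ hac p (neg_ne_zero.mpr hu) hu2'
  have hdisj : ∀ i j, interior (D i) ∩ interior (D' j) = ∅ := by
    intro i j
    have hopen : IsOpen (interior (D i) ∩ interior (D' j)) := isOpen_interior.inter isOpen_interior
    rw [← hopen.measure_eq_zero_iff (volume : Measure (Euc (d + 1)))]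
    refine measure_mono_null ?_ (null_hyper Measure.AbsolutelyContinuous.rfl hu p)
    rintro x ⟨h1, h2⟩
    have h3 := hDs i x (interior_subset h1)
    have h4 := hDs' j x (interior_subset h2)
    rw [inner_neg_left] at h4
    change inner ℝ u (x - p) = 0
    linarith
  set e : Fin n ⊕ Fin n ≃ Fin (n + n) := finSumFinEquiv
  set C : Fin n ⊕ Fin n → Set (Euc (d + 1)) := Sum.elim D D' with hC
  have hside : ∀ v ≠ 0, ∃ i, ∀ x ∈ C i, 0 ≤ inner ℝ v (x - p) := by
    intro v hv
    by_contra hcon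
    push Not at hcon
    set A := {i | (∀ x ∈ D i, 0 ≤ inner ℝ v (x - p)) ∨ (∀ x ∈ D i, inner ℝ v (x - p) ≤ 0)}
      with hA
    set A' := {i | (∀ x ∈ D' i, 0 ≤ inner ℝ v (x - p)) ∨ (∀ x ∈ D' i, inner ℝ v (x - p) ≤ 0)}
      with hA'
    have hneg : ∀ i ∈ A, ∀ x ∈ D i, inner ℝ v (x - p) ≤ 0 := by
      rintro i (h | h)
      · obtain ⟨x, hx, hlt⟩ := hcon (Sum.inl i)
        exact absurd (h x hx) (not_le.mpr hlt)
      · exact h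
    have hneg' : ∀ i ∈ A', ∀ x ∈ D' i, inner ℝ v (x - p) ≤ 0 := by
      rintro i (h | h)
      · obtain ⟨x, hx, hlt⟩ := hcon (Sum.inr i)
        exact absurd (h x hx) (not_le.mpr hlt)
      · exact h
    have hsub : {x | 0 ≤ inner ℝ v (x - p)} ⊆
        {x | inner ℝ v (x - p) = 0} ∪ ((⋃ i ∈ Aᶜ, D i) ∪ ⋃ i ∈ A'ᶜ, D' i) := by
      intro x hx
      have hx : 0 ≤ inner ℝ v (x - p) := hx
      rcases le_total 0 (inner ℝ u (x - p)) with h | h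
      · obtain ⟨i, hi⟩ := hDu x h
        by_cases hiA : i ∈ A
        · exact Or.inl (le_antisymm (hneg i hiA x hi) hx)
        · exact Or.inr (Or.inl (mem_iUnion₂.mpr ⟨i, hiA, hi⟩))
      · obtain ⟨i, hi⟩ := hDu' x (by rw [inner_neg_left]; linarith)
        by_cases hiA : i ∈ A'
        · exact Or.inl (le_antisymm (hneg' i hiA x hi) hx)
        · exact Or.inr (Or.inr (mem_iUnion₂.mpr ⟨i, hiA, hi⟩))
    have h1 := (hp v).trans (measureReal_mono (μ := μ) hsub)
    have h2 := measureReal_union_le (μ := μ) {x | inner ℝ v (x - p) = 0}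
      ((⋃ i ∈ Aᶜ, D i) ∪ ⋃ i ∈ A'ᶜ, D' i)
    have h3 := measureReal_union_le (μ := μ) (⋃ i ∈ Aᶜ, D i) (⋃ i ∈ A'ᶜ, D' i)
    have h4 : μ.real {x | inner ℝ v (x - p) = 0} = 0 := by
      rw [measureReal_def, null_hyper hac hv p]; rfl
    have h5 := small_parts_union μ hDm A (hDh v)
    have h6 := small_parts_union μ hDm' A' (hDh' v)
    have hn' : (0 : ℝ) < n := by exact_mod_cast hn
    have h7 : ((n : ℝ) - k) * (d + 2) < n := by
      have : (((n - k : ℕ) : ℝ)) * (d + 2) < n := by exact_mod_cast hfrac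
      rwa [Nat.cast_sub hkn] at this
    have h8 : 1 / ((d : ℝ) + 2) ≤ ((n : ℝ) - k) / n := by
      have : ((n : ℝ) - k) / n = ((n : ℝ) - k) * (2⁻¹ * (n : ℝ)⁻¹) +
        ((n : ℝ) - k) * (2⁻¹ * (n : ℝ)⁻¹) := by ring
      linarith
    rw [div_le_div_iff₀ (by positivity) hn', one_mul] at h8
    linarith
  have hCd : ∀ i j, i ≠ j → interior (C i) ∩ interior (C j) = ∅ := by
    rintro (i | i) (j | j) hij
    · exact hDd i j (fun h => hij (by rw [h]))
    · exact hdisj i j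
    · rw [inter_comm]; exact hdisj j i
    · exact hDd' i j (fun h => hij (by rw [h]))
  refine ⟨fun q => C (e.symm q), ⟨?_, ?_, ?_, ?_⟩, ?_, ?_⟩
  · intro q
    change IsClosed (C (e.symm q))
    rcases e.symm q with i | i
    · exact hDc i
    · exact hDc' i
  · intro q
    change Convex ℝ (C (e.symm q))
    rcases e.symm q with i | i
    · exact hDv i
    · exact hDv' i
  · exact fun q r hqr => hCd _ _ fun h => hqr (e.symm.injective h)
  · rw [eq_univ_iff_forall]
    intro x
    rcases le_total 0 (inner ℝ u (x - p)) with h | h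
    · obtain ⟨i, hi⟩ := hDu x h
      exact mem_iUnion.mpr ⟨e (Sum.inl i), by simpa [hC] using hi⟩
    · obtain ⟨i, hi⟩ := hDu' x (by rw [inner_neg_left]; linarith)
      exact mem_iUnion.mpr ⟨e (Sum.inr i), by simpa [hC] using hi⟩
  · intro q
    have h1 : μ (C (e.symm q)) = 2⁻¹ * (n : ℝ≥0∞)⁻¹ := by
      rcases e.symm q with i | i
      · exact hDm i
      · exact hDm' i
    rw [h1, Nat.cast_add, ← two_mul, ENNReal.mul_inv (by simp) (by simp)]
  · intro v c hv
    have havoid : ∃ i, Avoids (Hyperplane v c) (C i) := by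
      rcases le_or_gt c (inner ℝ v p) with h | h
      · obtain ⟨i, hi⟩ := hside v hv
        refine ⟨i, ?_⟩
        have hl : innerSL ℝ v ≠ 0 := by
          intro h
          have := congrArg (fun f => f v) h
          simp at this
          exact hv this
        have hsub : C i ⊆ innerSL ℝ v ⁻¹' (Ici (inner ℝ v p)) := by
          intro x hx
          have := hi x hx
          rw [inner_sub_right] at this
          change inner ℝ v p ≤ inner ℝ v x
          linarith
        have hinterior := interior_mono hsub
        rw [← (isOpenMap_functional hl).preimage_interior_eq_interior_preimage
          (innerSL ℝ v).continuous, interior_Ici] at hinterior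
        rw [Avoids, eq_empty_iff_forall_notMem]
        rintro x ⟨hx1, hx2⟩
        have h1 : inner ℝ v p < inner ℝ v x := hinterior hx2
        have h2 : inner ℝ v x = c := hx1
        linarith
      · obtain ⟨i, hi⟩ := hside (-v) (neg_ne_zero.mpr hv)
        refine ⟨i, ?_⟩
        rw [Avoids, eq_empty_iff_forall_notMem]
        rintro x ⟨hx1, hx2⟩
        have h1 := hi x (interior_subset hx2)
        have h2 : inner ℝ v x = c := hx1
        rw [inner_neg_left, inner_sub_right] at h1
        linarith
    obtain ⟨i, hi⟩ := havoid
    rw [Nat.one_le_iff_ne_zero, ← Nat.pos_iff_ne_zero, ncard_pos (toFinite _)]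
    exact ⟨e i, by simpa using hi⟩

lemma exists_one (d : ℕ) : ∃ n, 0 < n ∧ (0 < d → 2 ≤ n) ∧ HasEquipartition d 1 n := by
  induction d with
  | zero =>
    refine ⟨1, one_pos, fun h => absurd h (lt_irrefl 0), fun μ hμ => ?_⟩
    have := hμ.1
    refine ⟨fun _ => univ, ⟨fun _ => isClosed_univ, fun _ => convex_univ, ?_, ?_⟩, ?_, ?_⟩
    · intro i j hij
      exact absurd (Subsingleton.elim i j) hij
    · exact eq_univ_iff_forall.mpr fun x => mem_iUnion.mpr ⟨0, mem_univ x⟩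
    · simp
    · intro v c hv
      exact absurd (Subsingleton.elim v 0) hv
  | succ d ih =>
    obtain ⟨n₀, h0, -, H⟩ := ih
    obtain ⟨k, n, hkn, hfrac, hH⟩ := exists_small h0 H (d + 2)
    have hn : 0 < n := lt_of_le_of_lt (Nat.zero_le _) hfrac
    exact ⟨n + n, by omega, fun _ => by omega, dim_step hn hkn hfrac hH⟩

lemma exists_equipartition {d : ℕ} (hd : 1 ≤ d) (k : ℕ) :
    ∃ n, 0 < n ∧ HasEquipartition d k n := by
  obtain ⟨m, hm0, hm2, hm⟩ := exists_one d
  have hm2 := hm2 hd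
  have key : ∀ j, ∃ n, 0 < n ∧ HasEquipartition d (j + 1) n := by
    intro j
    induction j with
    | zero => exact ⟨m, hm0, hm⟩
    | succ j ih =>
      obtain ⟨n, hn, hj⟩ := ih
      refine ⟨n * m, Nat.mul_pos hn hm0, (prod_step hj hm).mono ?_⟩
      have h1 : (j + 1) * 2 ≤ (j + 1) * m := Nat.mul_le_mul_left _ hm2
      omega
  obtain ⟨n, hn, h⟩ := key k
  exact ⟨n, hn, h.mono (Nat.le_succ k)⟩

/-- Multiplicative relation:
N_d(k₁·N_d(k₂) + k₂·N_d(k₁) − k₁·k₂) ≤ N_d(k₁)·N_d(k₂). -/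
theorem Nd_submultiplicative (d k₁ k₂ : ℕ) (hd : 1 ≤ d) (hk₁ : 1 ≤ k₁) (hk₂ : 1 ≤ k₂) :
    Nd d (k₁ * Nd d k₂ + k₂ * Nd d k₁ - k₁ * k₂) ≤ Nd d k₁ * Nd d k₂ := by
  obtain ⟨h1, h2⟩ : 0 < Nd d k₁ ∧ HasEquipartition d k₁ (Nd d k₁) :=
    Nat.sInf_mem (exists_equipartition hd k₁)
  obtain ⟨h3, h4⟩ : 0 < Nd d k₂ ∧ HasEquipartition d k₂ (Nd d k₂) :=
    Nat.sInf_mem (exists_equipartition hd k₂)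
  exact Nat.sInf_le ⟨Nat.mul_pos h1 h3, prod_step h2 h4⟩
end
end

section
/- For every fixed d ≥ 1, the limit as k → ∞ of N_d(k)/k equals 1. Equivalently: N_d(k) ≥ k for every k ≥ 1, and for every ε > 0 there exists K such that for every k ≥ K there exists an integer n ≤ (1+ε)·k such that every nice measure on ℝ^d admits a k-equipartition into n parts. -/
open MeasureTheory Set Metric
open scoped ENNReal
noncomputable section

/-- The lower closed half-space. -/
def HS {d : ℕ} (v : Euc d) (c : ℝ) : Set (Euc d) := {x | inner (𝕜 := ℝ) v x ≤ c}

/-- The upper closed half-space. -/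
def HS' {d : ℕ} (v : Euc d) (c : ℝ) : Set (Euc d) := {x | c ≤ inner (𝕜 := ℝ) v x}

/-- One of the two closed half-spaces, chosen by a Boolean. -/
def side {d : ℕ} (b : Bool) (v : Euc d) (c : ℝ) : Set (Euc d) := if b then HS v c else HS' v c

lemma HS_closed {d : ℕ} (v : Euc d) (c : ℝ) : IsClosed (HS v c) :=
  isClosed_le (by fun_prop) (by fun_prop)

lemma HS'_closed {d : ℕ} (v : Euc d) (c : ℝ) : IsClosed (HS' v c) :=
  isClosed_le (by fun_prop) (by fun_prop)

lemma HS_convex {d : ℕ} (v : Euc d) (c : ℝ) : Convex ℝ (HS v c) :=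
  convex_halfSpace_le (innerₛₗ ℝ v).isLinear c

lemma HS'_convex {d : ℕ} (v : Euc d) (c : ℝ) : Convex ℝ (HS' v c) :=
  convex_halfSpace_ge (innerₛₗ ℝ v).isLinear c

lemma HS_neg {d : ℕ} (v : Euc d) (c : ℝ) : HS (-v) (-c) = HS' v c := by
  ext x; simp [HS, HS']

lemma HS'_neg {d : ℕ} (v : Euc d) (c : ℝ) : HS' (-v) (-c) = HS v c := by
  ext x; simp [HS, HS']

lemma side_neg {d : ℕ} (b : Bool) (v : Euc d) (c : ℝ) : side b (-v) (-c) = side (!b) v c := by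
  cases b <;> simp [side, HS_neg, HS'_neg]

lemma side_closed {d : ℕ} (b : Bool) (v : Euc d) (c : ℝ) : IsClosed (side b v c) := by
  cases b <;> simp [side, HS_closed, HS'_closed]

lemma HS_union {d : ℕ} (v : Euc d) (c : ℝ) : HS v c ∪ HS' v c = univ := by
  ext x; simp [HS, HS', le_total]

/-- Interior of the lower half-space is strict. -/
lemma interior_HS {d : ℕ} {v : Euc d} (hv : v ≠ 0) {c : ℝ} {x : Euc d}
    (hx : x ∈ interior (HS v c)) : inner (𝕜 := ℝ) v x < c := by
  rw [mem_interior_iff_mem_nhds] at hx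
  have hcont : Filter.Tendsto (fun t : ℝ => x + t • v) (nhdsWithin 0 (Ioi 0)) (nhds x) := by
    have : Continuous (fun t : ℝ => x + t • v) := by fun_prop
    have h2 := this.tendsto 0
    simp only [zero_smul, add_zero] at h2
    exact h2.mono_left nhdsWithin_le_nhds
  have h1 := hcont.eventually hx
  obtain ⟨t, ht, ht0⟩ := (h1.and self_mem_nhdsWithin).exists
  have ht : inner (𝕜 := ℝ) v (x + t • v) ≤ c := ht
  have ht0 : (0 : ℝ) < t := ht0
  rw [inner_add_right, inner_smul_right] at ht
  have : 0 < inner (𝕜 := ℝ) v v := real_inner_self_pos.2 hv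
  nlinarith [mul_pos ht0 this]

lemma interior_HS' {d : ℕ} {v : Euc d} (hv : v ≠ 0) {c : ℝ} {x : Euc d}
    (hx : x ∈ interior (HS' v c)) : c < inner (𝕜 := ℝ) v x := by
  rw [← HS_neg] at hx
  have := interior_HS (neg_ne_zero.2 hv) hx
  simpa using this

/-- Centerpoint theorem, from Helly's theorem. -/
lemma centerpoint_s8 {d : ℕ} (ν : Measure (Euc d)) [IsFiniteMeasure ν] :
    ∃ p : Euc d, ∀ v c, inner (𝕜 := ℝ) v p ≤ c →
      ν.real univ ≤ (d + 1) * ν.real (HS v c) := by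
  let ι := {K : Set (Euc d) // Convex ℝ K ∧ IsCompact K ∧
    d * ν.real univ < (d + 1) * ν.real K}
  have hne : (⋂ i : ι, i.1).Nonempty := by
    apply Convex.helly_theorem_compact' (𝕜 := ℝ) (F := fun i : ι => i.1)
      (fun i => i.2.1) (fun i => i.2.2.1)
    intro I hI
    rw [finrank_euclideanSpace_fin] at hI
    by_contra hemp
    rw [Set.not_nonempty_iff_eq_empty] at hemp
    rcases I.eq_empty_or_nonempty with rfl | hIne
    · simp at hemp
    have hcov : (univ : Set (Euc d)) = ⋃ i ∈ I, (i.1)ᶜ := by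
      have h := congrArg compl hemp
      rw [compl_iInter₂, compl_empty] at h
      exact h.symm
    have h1 : ν.real univ ≤ ∑ i ∈ I, ν.real (i.1)ᶜ := by
      conv_lhs => rw [hcov]
      exact measureReal_biUnion_finset_le _ _
    have h2 : ∀ i ∈ I, (d + 1) * ν.real (i.1)ᶜ < ν.real univ := by
      intro i _
      rw [measureReal_compl i.2.2.1.measurableSet]
      have := i.2.2.2
      linarith
    have h3 := Finset.sum_lt_sum_of_nonempty hIne h2
    rw [← Finset.mul_sum, Finset.sum_const, nsmul_eq_mul] at h3
    have h4 : ((I.card : ℕ) : ℝ) ≤ d + 1 := by exact_mod_cast hI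
    have h5 : (0 : ℝ) ≤ ν.real univ := measureReal_nonneg
    have h6 : (0 : ℝ) ≤ (d : ℝ) + 1 := by positivity
    nlinarith [mul_le_mul_of_nonneg_left h1 h6, mul_le_mul_of_nonneg_right h4 h5]
  obtain ⟨p, hp⟩ := hne
  refine ⟨p, fun v c hpc => ?_⟩
  by_contra hlt
  push Not at hlt
  let K : ℕ → Set (Euc d) := fun m => HS' v (c + 1 / ((m : ℝ) + 1)) ∩ closedBall 0 m
  have hmono : Monotone K := by
    intro a b hab x hx
    refine ⟨?_, closedBall_subset_closedBall (by exact_mod_cast hab) hx.2⟩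
    have h1 : c + 1 / ((a : ℝ) + 1) ≤ inner (𝕜 := ℝ) v x := hx.1
    have h2 : 1 / ((b : ℝ) + 1) ≤ 1 / ((a : ℝ) + 1) := by
      gcongr
    show c + 1 / ((b : ℝ) + 1) ≤ inner (𝕜 := ℝ) v x
    linarith
  have hU : (⋃ m, K m) = (HS v c)ᶜ := by
    ext x
    simp only [mem_iUnion, mem_compl_iff, HS, mem_ofPred_eq, not_le]
    constructor
    · rintro ⟨m, hm⟩
      have h1 : c + 1 / ((m : ℝ) + 1) ≤ inner (𝕜 := ℝ) v x := hm.1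
      have : 0 < 1 / ((m : ℝ) + 1) := by positivity
      linarith
    · intro hx
      obtain ⟨m1, hm1⟩ := exists_nat_one_div_lt (sub_pos.2 hx)
      obtain ⟨m2, hm2⟩ := exists_nat_ge ‖x‖
      have a1 : x ∈ HS' v (c + 1 / ((m1 : ℝ) + 1)) := by
        show c + 1 / ((m1 : ℝ) + 1) ≤ inner (𝕜 := ℝ) v x
        linarith
      refine ⟨max m1 m2, ?_, ?_⟩
      · have h2 : 1 / (((max m1 m2 : ℕ) : ℝ) + 1) ≤ 1 / ((m1 : ℝ) + 1) := by
          gcongr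
          exact le_max_left _ _
        show c + 1 / (((max m1 m2 : ℕ) : ℝ) + 1) ≤ inner (𝕜 := ℝ) v x
        linarith
      · rw [mem_closedBall_zero_iff]
        refine hm2.trans ?_
        exact_mod_cast le_max_right _ _
  have htend : Filter.Tendsto (fun m => ν.real (K m)) Filter.atTop
      (nhds (ν.real (HS v c)ᶜ)) := by
    rw [← hU]
    exact (ENNReal.tendsto_toReal (measure_ne_top _ _)).comp
      (tendsto_measure_iUnion_atTop hmono)
  rw [measureReal_compl (HS_closed v c).measurableSet] at htend
  have hlim : d / (d + 1) * ν.real univ < ν.real univ - ν.real (HS v c) := by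
    have : (0 : ℝ) < (d : ℝ) + 1 := by positivity
    rw [div_mul_eq_mul_div, div_lt_iff₀ this]
    linarith
  obtain ⟨m, hm⟩ := (htend.eventually (lt_mem_nhds hlim)).exists
  have hm' : d * ν.real univ < (d + 1) * ν.real (K m) := by
    have : (0 : ℝ) < (d : ℝ) + 1 := by positivity
    rw [div_mul_eq_mul_div, div_lt_iff₀ this] at hm
    linarith
  have hpK : p ∈ K m := mem_iInter.1 hp ⟨K m, (HS'_convex _ _).inter (convex_closedBall _ _),
    (isCompact_closedBall _ _).inter_left (HS'_closed _ _), hm'⟩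
  have : p ∈ (HS v c)ᶜ := hU ▸ mem_iUnion.2 ⟨m, hpK⟩
  exact this hpc

lemma hyperplane_through {d : ℕ} (hd : 1 ≤ d) (p : Fin d → Euc d) :
    ∃ v : Euc d, ∃ c : ℝ, v ≠ 0 ∧ ∀ i, inner (𝕜 := ℝ) v (p i) = c := by
  let f : (Euc d × ℝ) →ₗ[ℝ] (Fin d → ℝ) :=
    LinearMap.pi fun i => (innerₛₗ ℝ (p i)).comp (LinearMap.fst ℝ _ _) - LinearMap.snd ℝ _ _
  have hk : LinearMap.ker f ≠ ⊥ := by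
    apply LinearMap.ker_ne_bot_of_finrank_lt
    simp
  obtain ⟨⟨v, c⟩, hx, hne⟩ := Submodule.exists_mem_ne_zero_of_ne_bot hk
  have hi : ∀ i, inner (𝕜 := ℝ) v (p i) = c := by
    intro i
    have := congrFun (LinearMap.mem_ker.1 hx) i
    simp [f] at this
    rw [real_inner_comm]
    linarith
  refine ⟨v, c, ?_, hi⟩
  rintro rfl
  apply hne
  have := hi ⟨0, hd⟩
  simp at this
  simp [← this]

lemma step_sides {d : ℕ} (hd : 1 ≤ d) (μ : Measure (Euc d)) [IsFiniteMeasure μ]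
    (X : Fin (d + 1) → Set (Euc d)) (I : Fin (d + 1) → Bool) :
    ∃ v : Euc d, ∃ c : ℝ, v ≠ 0 ∧
      ∀ i, μ.real (X i) ≤ (d + 1) * μ.real (X i ∩ side (I i) v c) := by
  choose p hp using fun i : Fin d => centerpoint_s8 (μ.restrict (X i.succ))
  obtain ⟨v, c, hv, hpv⟩ := hyperplane_through hd p
  have hs : ∀ b (i : Fin d), μ.real (X i.succ) ≤ (d + 1) * μ.real (X i.succ ∩ side b v c) := by
    intro b i
    cases b
    · have := hp i (-v) (-c) (by simp [hpv])
      rw [HS_neg, measureReal_restrict_apply (HS'_closed _ _).measurableSet,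
        measureReal_restrict_apply MeasurableSet.univ, univ_inter, inter_comm] at this
      simpa [side] using this
    · have := hp i v c (by simp [hpv])
      rw [measureReal_restrict_apply (HS_closed _ _).measurableSet,
        measureReal_restrict_apply MeasurableSet.univ, univ_inter, inter_comm] at this
      simpa [side] using this
  have h0 : ∃ b, μ.real (X 0) ≤ (d + 1) * μ.real (X 0 ∩ side b v c) := by
    by_contra hcon
    push Not at hcon
    have h1 := hcon true
    have h2 := hcon false
    simp only [side] at h1 h2
    simp at h1 h2
    have h3 : μ.real (X 0) ≤ μ.real (X 0 ∩ HS v c) + μ.real (X 0 ∩ HS' v c) := by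
      have : X 0 = (X 0 ∩ HS v c) ∪ (X 0 ∩ HS' v c) := by
        rw [← inter_union_distrib_left, HS_union, inter_univ]
      conv_lhs => rw [this]
      exact measureReal_union_le _ _
    have h4 : (1 : ℝ) ≤ d := by exact_mod_cast hd
    nlinarith [measureReal_nonneg (μ := μ) (s := X 0)]
  obtain ⟨b, hb⟩ := h0
  by_cases hbI : I 0 = b
  · refine ⟨v, c, hv, fun i => ?_⟩
    refine Fin.cases ?_ (fun i => hs _ i) i
    rw [hbI]; exact hb
  · refine ⟨-v, -c, neg_ne_zero.2 hv, fun i => ?_⟩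
    rw [side_neg]
    refine Fin.cases ?_ (fun i => hs _ i) i
    have : (!(I 0)) = b := by cases b <;> cases h : I 0 <;> simp_all
    rw [this]; exact hb

open Classical in
/-- Indicator of the hyperplane hitting the interior of a set. -/
def ind {d : ℕ} (v : Euc d) (c : ℝ) (C : Set (Euc d)) : ℝ :=
  if Avoids (Hyperplane v c) C then 0 else 1

lemma ind_nonneg {d : ℕ} (v : Euc d) (c : ℝ) (C : Set (Euc d)) : 0 ≤ ind v c C := by
  unfold ind; split_ifs <;> simp

lemma ind_le_one {d : ℕ} (v : Euc d) (c : ℝ) (C : Set (Euc d)) : ind v c C ≤ 1 := by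
  unfold ind; split_ifs <;> simp

lemma ind_mono {d : ℕ} (v : Euc d) (c : ℝ) {C D : Set (Euc d)} (h : C ⊆ D) :
    ind v c C ≤ ind v c D := by
  by_cases hD : Avoids (Hyperplane v c) D
  · have hC : Avoids (Hyperplane v c) C := by
      unfold Avoids at *
      exact subset_eq_empty (inter_subset_inter_right _ (interior_mono h)) hD
    simp [ind, hD, hC]
  · have : ind v c D = 1 := by simp [ind, hD]
    rw [this]; exact ind_le_one _ _ _

/-- Binary space partition trees. -/
inductive BTree (d : ℕ) : Type where
  | leaf : BTree d
  | node (v : {v : Euc d // v ≠ 0}) (c : ℝ) (l r : BTree d) : BTree d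

/-- Number of leaves. -/
def BTree.leaves {d : ℕ} : BTree d → ℕ
  | .leaf => 1
  | .node _ _ l r => l.leaves + r.leaves

/-- Total mass of the leaf cells hit by a hyperplane. -/
def BTree.hm {d : ℕ} (μ : Measure (Euc d)) (v : Euc d) (c : ℝ) : BTree d → Set (Euc d) → ℝ
  | .leaf, P => ind v c P * μ.real P
  | .node w e l r, P => l.hm μ v c (P ∩ HS w.1 e) + r.hm μ v c (P ∩ HS' w.1 e)

lemma BTree.hm_mono {d : ℕ} (μ : Measure (Euc d)) [IsFiniteMeasure μ] (v : Euc d) (c : ℝ)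
    (T : BTree d) : ∀ {P Q : Set (Euc d)}, P ⊆ Q → T.hm μ v c P ≤ T.hm μ v c Q := by
  induction T with
  | leaf =>
    intro P Q h
    exact mul_le_mul (ind_mono v c h) (measureReal_mono h) measureReal_nonneg (ind_nonneg _ _ _)
  | node w e l r ihl ihr =>
    intro P Q h
    exact add_le_add (ihl (inter_subset_inter_left _ h)) (ihr (inter_subset_inter_left _ h))

lemma interior_HS_disj {d : ℕ} {v : Euc d} (hv : v ≠ 0) (c : ℝ) :
    interior (HS v c) ∩ interior (HS' v c) = ∅ := by
  ext x
  simp only [mem_inter_iff, mem_empty_iff_false, iff_false, not_and]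
  intro h1 h2
  exact lt_asymm (interior_HS hv h1) (interior_HS' hv h2)

lemma interior_disj_mono {d : ℕ} {A B A' B' : Set (Euc d)} (hA : A ⊆ A') (hB : B ⊆ B')
    (h : interior A' ∩ interior B' = ∅) : interior A ∩ interior B = ∅ :=
  subset_eq_empty (inter_subset_inter (interior_mono hA) (interior_mono hB)) h

lemma null_inter {d : ℕ} {μ : Measure (Euc d)} (hμ : μ ≪ volume) {A B : Set (Euc d)}
    (hA : Convex ℝ A) (hB : Convex ℝ B)
    (h : interior A ∩ interior B = ∅) : μ (A ∩ B) = 0 := by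
  apply hμ
  refine measure_mono_null (t := frontier A ∪ frontier B) ?_
    (measure_union_null (hA.addHaar_frontier _) (hB.addHaar_frontier _))
  rintro x ⟨xA, xB⟩
  by_cases h1 : x ∈ interior A
  · right
    refine ⟨subset_closure xB, fun h2 => ?_⟩
    have : x ∈ interior A ∩ interior B := ⟨h1, h2⟩
    rw [h] at this; exact this
  · left; exact ⟨subset_closure xA, h1⟩

lemma real_union {d : ℕ} {μ : Measure (Euc d)} [IsFiniteMeasure μ] (hμ : μ ≪ volume)
    {A B : Set (Euc d)} (hA : Convex ℝ A) (hB : Convex ℝ B) (hBc : IsClosed B)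
    (h : interior A ∩ interior B = ∅) : μ.real (A ∪ B) = μ.real A + μ.real B := by
  have h1 : AEDisjoint μ A B := null_inter hμ hA hB h
  have := measure_union₀ hBc.measurableSet.nullMeasurableSet h1
  unfold Measure.real
  rw [this, ENNReal.toReal_add (measure_ne_top _ _) (measure_ne_top _ _)]

lemma real_split {d : ℕ} {μ : Measure (Euc d)} [IsFiniteMeasure μ] (hμ : μ ≪ volume)
    {P : Set (Euc d)} (hP : Convex ℝ P) (hPc : IsClosed P) {v : Euc d} (hv : v ≠ 0) (c : ℝ) :
    μ.real P = μ.real (P ∩ HS v c) + μ.real (P ∩ HS' v c) := by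
  rw [← real_union hμ (hP.inter (HS_convex _ _)) (hP.inter (HS'_convex _ _))
    (hPc.inter (HS'_closed _ _)), ← inter_union_distrib_left, HS_union, inter_univ]
  exact interior_disj_mono inter_subset_right inter_subset_right (interior_HS_disj hv c)

lemma BTree.hm_le {d : ℕ} {μ : Measure (Euc d)} [IsFiniteMeasure μ] (hμ : μ ≪ volume)
    (v : Euc d) (c : ℝ) (T : BTree d) : ∀ {P : Set (Euc d)}, Convex ℝ P → IsClosed P →
      T.hm μ v c P ≤ ind v c P * μ.real P := by
  induction T with
  | leaf => intro P _ _; exact le_rfl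
  | node w e l r ihl ihr =>
    intro P hP hPc
    have h1 := ihl (hP.inter (HS_convex w.1 e)) (hPc.inter (HS_closed w.1 e))
    have h2 := ihr (hP.inter (HS'_convex w.1 e)) (hPc.inter (HS'_closed w.1 e))
    have h3 := mul_le_mul_of_nonneg_right (ind_mono v c (inter_subset_left : P ∩ HS w.1 e ⊆ P))
      (measureReal_nonneg (μ := μ) (s := P ∩ HS w.1 e))
    have h4 := mul_le_mul_of_nonneg_right (ind_mono v c (inter_subset_left : P ∩ HS' w.1 e ⊆ P))
      (measureReal_nonneg (μ := μ) (s := P ∩ HS' w.1 e))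
    rw [real_split hμ hP hPc w.2 e, mul_add]
    simp only [BTree.hm]
    linarith

/-- A hyperplane with a choice of sides for each of `d+1` cells. -/
abbrev HP (d : ℕ) := (Fin (d + 1) → Bool) × {v : Euc d // v ≠ 0} × ℝ

/-- The `i`-th cell. -/
def cell {d : ℕ} : List (HP d) → Fin (d + 1) → Set (Euc d) → Set (Euc d)
  | [], _, P => P
  | h :: t, i, P => cell t i P ∩ side (h.1 i) h.2.1.1 h.2.2

/-- The full arrangement tree. -/
def arr {d : ℕ} : List (HP d) → BTree d
  | [] => .leaf
  | h :: t => .node h.2.1 h.2.2 (arr t) (arr t)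

lemma arr_leaves {d : ℕ} (l : List (HP d)) : (arr l).leaves = 2 ^ l.length := by
  induction l with
  | nil => rfl
  | cons h t ih => simp [arr, BTree.leaves, ih]; ring

lemma cell_inter {d : ℕ} (l : List (HP d)) (i : Fin (d + 1)) (P s : Set (Euc d)) :
    cell l i (P ∩ s) = cell l i P ∩ s := by
  induction l with
  | nil => rfl
  | cons h t ih => simp only [cell, ih]; rw [inter_right_comm]

lemma cell_subset {d : ℕ} (l : List (HP d)) (i : Fin (d + 1)) (P : Set (Euc d)) :
    ∀ h ∈ l, cell l i P ⊆ side (h.1 i) h.2.1.1 h.2.2 := by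
  induction l with
  | nil => simp
  | cons h t ih =>
    intro h' hh'
    rcases List.mem_cons.1 hh' with rfl | hm
    · exact inter_subset_right
    · exact inter_subset_left.trans (ih h' hm)

lemma arr_hm {d : ℕ} {μ : Measure (Euc d)} [IsFiniteMeasure μ] (hμ : μ ≪ volume)
    (v : Euc d) (c : ℝ) (i : Fin (d + 1)) (l : List (HP d)) :
    ∀ {P : Set (Euc d)}, Convex ℝ P → IsClosed P → Avoids (Hyperplane v c) (cell l i P) →
      (arr l).hm μ v c P + μ.real (cell l i P) ≤ μ.real P := by
  induction l with
  | nil =>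
    intro P hP hPc hav
    have : ind v c P = 0 := by simp only [cell] at hav; simp [ind, hav]
    simp [arr, BTree.hm, this, cell]
  | cons h t ih =>
    intro P hP hPc hav
    have a1 := hP.inter (HS_convex h.2.1.1 h.2.2)
    have a2 := hPc.inter (HS_closed h.2.1.1 h.2.2)
    have b1 := hP.inter (HS'_convex h.2.1.1 h.2.2)
    have b2 := hPc.inter (HS'_closed h.2.1.1 h.2.2)
    have hs := real_split hμ hP hPc h.2.1.2 h.2.2
    have hl : ∀ {Q : Set (Euc d)}, Convex ℝ Q → IsClosed Q → (arr t).hm μ v c Q ≤ μ.real Q := by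
      intro Q h1 h2
      refine (BTree.hm_le hμ v c (arr t) h1 h2).trans ?_
      exact mul_le_of_le_one_left measureReal_nonneg (ind_le_one _ _ _)
    simp only [cell, arr, BTree.hm] at hav ⊢
    cases hb : h.1 i
    · simp only [hb, side] at hav ⊢
      simp only [Bool.false_eq_true, if_false] at hav ⊢
      rw [← cell_inter] at hav ⊢
      have := ih b1 b2 hav
      have := hl a1 a2
      linarith
    · simp only [hb, side] at hav ⊢
      simp only [if_true] at hav ⊢
      rw [← cell_inter] at hav ⊢
      have := ih a1 a2 hav
      have := hl b1 b2
      linarith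

lemma exists_list {d : ℕ} (hd : 1 ≤ d) (μ : Measure (Euc d)) [IsFiniteMeasure μ]
    (P : Set (Euc d)) (S : List (Fin (d + 1) → Bool)) :
    ∃ l : List (HP d), l.map Prod.fst = S ∧
      ∀ i, μ.real P ≤ (d + 1) ^ S.length * μ.real (cell l i P) := by
  induction S with
  | nil => exact ⟨[], rfl, fun i => by simp [cell]⟩
  | cons I S ih =>
    obtain ⟨l, hl, hm⟩ := ih
    obtain ⟨v, c, hv, h⟩ := step_sides hd μ (fun i => cell l i P) I
    refine ⟨(I, ⟨v, hv⟩, c) :: l, by simp [hl], fun i => ?_⟩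
    refine (hm i).trans ?_
    rw [List.length_cons, pow_succ, mul_assoc]
    exact mul_le_mul_of_nonneg_left (h i) (by positivity)

lemma cell_avoid {d : ℕ} (l : List (HP d)) (hl : ∀ I, ∃ h ∈ l, h.1 = I) (P : Set (Euc d))
    (v : Euc d) (hv : v ≠ 0) (c : ℝ) : ∃ i, Avoids (Hyperplane v c) (cell l i P) := by
  classical
  by_contra hcon
  push Not at hcon
  have hx : ∀ i, ∃ x, x ∈ Hyperplane v c ∩ interior (cell l i P) := fun i =>
    nonempty_iff_ne_empty.2 (hcon i)
  choose x hx using hx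
  have hdep : ¬ AffineIndependent ℝ x := by
    intro hai
    have htop : affineSpan ℝ (range x) = ⊤ := by
      rw [hai.affineSpan_eq_top_iff_card_eq_finrank_add_one]
      simp
    have hvs : vectorSpan ℝ (range x) = ⊤ := by
      rw [← direction_affineSpan, htop, AffineSubspace.direction_top]
    have hle : vectorSpan ℝ (range x) ≤ LinearMap.ker (innerₛₗ ℝ v) := by
      rw [vectorSpan_def, Submodule.span_le]
      rintro y ⟨a, ⟨i, rfl⟩, b, ⟨j, rfl⟩, rfl⟩
      have h1 : inner (𝕜 := ℝ) v (x i) = c := (hx i).1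
      have h2 : inner (𝕜 := ℝ) v (x j) = c := (hx j).1
      simp [inner_sub_right, h1, h2]
    have : v ∈ LinearMap.ker (innerₛₗ ℝ v) := hle (hvs ▸ Submodule.mem_top)
    simp at this
    exact hv this
  obtain ⟨I, z, hz1, hz2⟩ := Convex.radon_partition hdep
  obtain ⟨h, hh, hI⟩ := hl (fun i => decide (i ∈ I))
  have e1 : convexHull ℝ (x '' I) ⊆ {y | inner (𝕜 := ℝ) h.2.1.1 y < h.2.2} := by
    apply convexHull_min
    · rintro _ ⟨i, hi, rfl⟩
      have := interior_mono (cell_subset l i P h hh) (hx i).2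
      simp only [hI, hi, decide_true, side, if_true] at this
      exact interior_HS h.2.1.2 this
    · exact convex_halfSpace_lt (innerₛₗ ℝ h.2.1.1).isLinear _
  have e2 : convexHull ℝ (x '' Iᶜ) ⊆ {y | h.2.2 < inner (𝕜 := ℝ) h.2.1.1 y} := by
    apply convexHull_min
    · rintro _ ⟨i, hi, rfl⟩
      have := interior_mono (cell_subset l i P h hh) (hx i).2
      have hi : i ∉ I := hi
      simp only [hI, hi, decide_false, side, Bool.false_eq_true, if_false] at this
      exact interior_HS' h.2.1.2 this
    · exact convex_halfSpace_gt (innerₛₗ ℝ h.2.1.1).isLinear _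
  have f1 : inner (𝕜 := ℝ) h.2.1.1 z < h.2.2 := e1 hz1
  have f2 : h.2.2 < inner (𝕜 := ℝ) h.2.1.1 z := e2 hz2
  exact lt_asymm f1 f2

/-- Weak Yao-Yao theorem: one step. -/
lemma one_step {d : ℕ} (hd : 1 ≤ d) : ∃ B : ℕ, ∃ ρ : ℝ, 0 ≤ ρ ∧ ρ < 1 ∧
    ∀ (μ : Measure (Euc d)) [IsFiniteMeasure μ], μ ≪ volume → ∀ P : Set (Euc d),
      Convex ℝ P → IsClosed P → ∃ T : BTree d, T.leaves ≤ B ∧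
        ∀ v c, v ≠ 0 → T.hm μ v c P ≤ ρ * (ind v c P * μ.real P) := by
  let S : List (Fin (d + 1) → Bool) := (Finset.univ : Finset (Fin (d + 1) → Bool)).toList
  have hpos : (1 : ℝ) ≤ ((d : ℝ) + 1) ^ S.length := one_le_pow₀ (by simp)
  refine ⟨2 ^ S.length, 1 - 1 / ((d : ℝ) + 1) ^ S.length, ?_, ?_, ?_⟩
  · rw [sub_nonneg, div_le_one (by linarith)]; exact hpos
  · have : 0 < 1 / ((d : ℝ) + 1) ^ S.length := by positivity
    linarith
  intro μ _ hμ P hP hPc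
  obtain ⟨l, hl, hm⟩ := exists_list hd μ P S
  refine ⟨arr l, ?_, ?_⟩
  · rw [arr_leaves, ← hl, List.length_map]
  · intro v c hv
    obtain ⟨i, hi⟩ := cell_avoid l (fun I => by
      have : I ∈ l.map Prod.fst := by rw [hl]; simp [S]
      simpa using this) P v hv c
    by_cases hav : Avoids (Hyperplane v c) P
    · have h1 := BTree.hm_le hμ v c (arr l) hP hPc
      have : ind v c P = 0 := by simp [ind, hav]
      rw [this] at h1 ⊢
      simpa using h1
    · have h1 := arr_hm hμ v c i l hP hPc hi
      have h2 : ind v c P = 1 := by simp [ind, hav]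
      have h3 : μ.real P / ((d : ℝ) + 1) ^ S.length ≤ μ.real (cell l i P) := by
        rw [div_le_iff₀ (by linarith)]
        linarith [hm i]
      rw [h2, one_mul, sub_mul, one_mul, one_div_mul_eq_div]
      linarith

lemma graft {d : ℕ} {B : ℕ} {ρ : ℝ} {μ : Measure (Euc d)}
    (h : ∀ P : Set (Euc d),
      Convex ℝ P → IsClosed P → ∃ T : BTree d, T.leaves ≤ B ∧
        ∀ v c, v ≠ 0 → T.hm μ v c P ≤ ρ * (ind v c P * μ.real P)) (T : BTree d) :
    ∀ P : Set (Euc d), Convex ℝ P → IsClosed P → ∃ T' : BTree d,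
      T'.leaves ≤ T.leaves * B ∧
        ∀ v c, v ≠ 0 → T'.hm μ v c P ≤ ρ * T.hm μ v c P := by
  induction T with
  | leaf => simpa [BTree.leaves, BTree.hm] using h
  | node w e l r ihl ihr =>
    intro P hP hPc
    obtain ⟨T1, h1, h1'⟩ := ihl _ (hP.inter (HS_convex w.1 e)) (hPc.inter (HS_closed w.1 e))
    obtain ⟨T2, h2, h2'⟩ := ihr _ (hP.inter (HS'_convex w.1 e)) (hPc.inter (HS'_closed w.1 e))
    refine ⟨.node w e T1 T2, ?_, ?_⟩
    · simp only [BTree.leaves, add_mul]; omega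
    · intro v c hv
      simp only [BTree.hm, mul_add]
      exact add_le_add (h1' v c hv) (h2' v c hv)

lemma good_tree {d : ℕ} (hd : 1 ≤ d) (η : ℝ) (hη : 0 < η) : ∃ B : ℕ,
    ∀ (μ : Measure (Euc d)) [IsProbabilityMeasure μ], μ ≪ volume →
      ∃ T : BTree d, T.leaves ≤ B ∧ ∀ v c, v ≠ 0 → T.hm μ v c univ ≤ η := by
  obtain ⟨B, ρ, hρ0, hρ1, h⟩ := one_step hd
  obtain ⟨j, hj⟩ := exists_pow_lt_of_lt_one hη hρ1
  refine ⟨B ^ j, ?_⟩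
  intro μ _ hμ
  have key : ∀ j : ℕ, ∃ T : BTree d, T.leaves ≤ B ^ j ∧
      ∀ v c, v ≠ 0 → T.hm μ v c univ ≤ ρ ^ j := by
    intro j
    induction j with
    | zero =>
      refine ⟨.leaf, by simp [BTree.leaves], fun v c _ => ?_⟩
      simp [BTree.hm, ind_le_one]
    | succ j ih =>
      obtain ⟨T, hT, hT'⟩ := ih
      obtain ⟨T', h1, h2⟩ := graft (h μ hμ) T univ convex_univ isClosed_univ
      refine ⟨T', h1.trans ?_, fun v c hv => (h2 v c hv).trans ?_⟩
      · rw [pow_succ]; exact Nat.mul_le_mul_right _ hT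
      · rw [pow_succ, mul_comm]; exact mul_le_mul_of_nonneg_right (hT' v c hv) hρ0
  obtain ⟨T, h1, h2⟩ := key j
  exact ⟨T, h1, fun v c hv => (h2 v c hv).trans hj.le⟩

lemma cut {d : ℕ} {μ : Measure (Euc d)} [IsFiniteMeasure μ] (hμ : μ ≪ volume)
    {P : Set (Euc d)} (hP : Convex ℝ P) (hPc : IsClosed P) {v : Euc d} (hv : v ≠ 0)
    {m : ℝ} (hm0 : 0 ≤ m) (hm1 : m ≤ μ.real P) :
    ∃ A B : Set (Euc d), Convex ℝ A ∧ IsClosed A ∧ A ⊆ P ∧ Convex ℝ B ∧ IsClosed B ∧ B ⊆ P ∧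
      interior A ∩ interior B = ∅ ∧ μ.real A = m ∧ μ.real B = μ.real P - m ∧
      (∀ c, m < μ.real (P ∩ HS v c) → A ⊆ HS v c) ∧
      (∀ c, μ.real (P ∩ HS v c) < m → B ⊆ HS' v c) := by
  rcases hm0.eq_or_lt with rfl | hm0
  · refine ⟨∅, P, convex_empty, isClosed_empty, empty_subset _, hP, hPc, subset_rfl, by simp,
      by simp, by simp, fun _ _ => empty_subset _, fun c hc => ?_⟩
    exact absurd hc (not_lt.2 measureReal_nonneg)
  rcases hm1.eq_or_lt with rfl | hm1
  · refine ⟨P, ∅, hP, hPc, subset_rfl, convex_empty, isClosed_empty, empty_subset _, by simp,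
      rfl, by simp, fun c hc => ?_, fun _ _ => empty_subset _⟩
    exact absurd hc (not_lt.2 (measureReal_mono inter_subset_left))
  have hmeas : Measurable (fun x : Euc d => inner (𝕜 := ℝ) v x) :=
    Continuous.measurable (by fun_prop)
  let ν : Measure ℝ := (μ.restrict P).map (fun x => inner (𝕜 := ℝ) v x)
  have hIic : ∀ t, ν.real (Iic t) = μ.real (P ∩ HS v t) := by
    intro t
    rw [map_measureReal_apply hmeas measurableSet_Iic,
      measureReal_restrict_apply (hmeas measurableSet_Iic), inter_comm]
    rfl
  have hIci : ∀ t, ν.real (Ici t) = μ.real (P ∩ HS' v t) := by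
    intro t
    rw [map_measureReal_apply hmeas measurableSet_Ici,
      measureReal_restrict_apply (hmeas measurableSet_Ici), inter_comm]
    rfl
  have huniv : ν.real univ = μ.real P := by
    rw [map_measureReal_apply hmeas MeasurableSet.univ, preimage_univ,
      measureReal_restrict_apply MeasurableSet.univ, univ_inter]
  have hsing : NullSingletonClass ν := by
    constructor
    intro t
    rw [Measure.map_apply hmeas (measurableSet_singleton t)]
    have h0 : μ (HS v t ∩ HS' v t) = 0 :=
      null_inter hμ (HS_convex _ _) (HS'_convex _ _) (interior_HS_disj hv t)
    refine measure_mono_null ?_ (Measure.absolutelyContinuous_of_le Measure.restrict_le_self h0)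
    intro x hx
    have hx : inner (𝕜 := ℝ) v x = t := hx
    exact ⟨hx.le, hx.ge⟩
  have hcont : Continuous (fun t => μ.real (P ∩ HS v t)) := by
    have h1 := intervalIntegral.continuous_primitive (μ := ν) (f := fun _ => (1 : ℝ))
      (fun a b => (integrable_const _).intervalIntegrable) 0
    have h2 : ∀ t, μ.real (P ∩ HS v t) = μ.real (P ∩ HS v 0) + ∫ x in (0 : ℝ)..t, (1 : ℝ) ∂ν := by
      intro t
      rw [← intervalIntegral.integral_Iic_sub_Iic (integrable_const _).integrableOn
        (integrable_const _).integrableOn, ← hIic, ← hIic]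
      simp
    rw [show (fun t => μ.real (P ∩ HS v t)) = _ from funext h2]
    exact continuous_const.add h1
  have hbot : ∃ t, μ.real (P ∩ HS v t) < m := by
    have h1 : Filter.Tendsto (fun t => ν.real (Ici t)) Filter.atBot (nhds (ν.real univ)) :=
      (ENNReal.tendsto_toReal (measure_ne_top _ _)).comp (tendsto_measure_Ici_atBot ν)
    rw [huniv] at h1
    obtain ⟨t, ht⟩ := (h1.eventually (lt_mem_nhds (sub_lt_self _ hm0))).exists
    rw [hIci] at ht
    have := real_split hμ hP hPc hv t
    exact ⟨t, by linarith⟩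
  have htop : ∃ t, m < μ.real (P ∩ HS v t) := by
    have h1 : Filter.Tendsto (fun t => ν.real (Iic t)) Filter.atTop (nhds (ν.real univ)) :=
      (ENNReal.tendsto_toReal (measure_ne_top _ _)).comp (tendsto_measure_Iic_atTop ν)
    rw [huniv] at h1
    obtain ⟨t, ht⟩ := (h1.eventually (lt_mem_nhds hm1)).exists
    rw [hIic] at ht
    exact ⟨t, ht⟩
  obtain ⟨t1, ht1⟩ := hbot
  obtain ⟨t2, ht2⟩ := htop
  obtain ⟨t, ht⟩ := mem_range_of_exists_le_of_exists_ge hcont ⟨t1, ht1.le⟩ ⟨t2, ht2.le⟩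
  have hmono : ∀ {a b : ℝ}, a ≤ b → μ.real (P ∩ HS v a) ≤ μ.real (P ∩ HS v b) := by
    intro a b hab
    exact measureReal_mono (inter_subset_inter_right _ fun x (hx : _ ≤ _) => le_trans hx hab)
  have ht : μ.real (P ∩ HS v t) = m := ht
  refine ⟨P ∩ HS v t, P ∩ HS' v t, hP.inter (HS_convex _ _), hPc.inter (HS_closed _ _),
    inter_subset_left, hP.inter (HS'_convex _ _), hPc.inter (HS'_closed _ _),
    inter_subset_left, ?_, ht, ?_, ?_, ?_⟩
  · exact interior_disj_mono inter_subset_right inter_subset_right (interior_HS_disj hv t)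
  · have := real_split hμ hP hPc hv t
    linarith
  · intro c hc x hx
    have h1 : t ≤ c := by
      by_contra hlt
      push Not at hlt
      have := hmono hlt.le
      linarith
    have h2 : inner (𝕜 := ℝ) v x ≤ t := hx.2
    exact h2.trans h1
  · intro c hc x hx
    have h1 : c ≤ t := by
      by_contra hlt
      push Not at hlt
      have := hmono hlt.le
      linarith
    have h2 : t ≤ inner (𝕜 := ℝ) v x := hx.2
    exact h1.trans h2

/-- A list of essentially disjoint closed convex parts of `P`, each of mass `1/n`. -/
def GoodList {d : ℕ} (μ : Measure (Euc d)) (n : ℕ) (P : Set (Euc d)) (L : List (Set (Euc d))) :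
    Prop :=
  (∀ C ∈ L, Convex ℝ C ∧ IsClosed C ∧ C ⊆ P ∧ n * μ.real C = 1) ∧
    L.Pairwise (fun A B => interior A ∩ interior B = ∅)

lemma GoodList.append {d : ℕ} {μ : Measure (Euc d)} {n : ℕ} {P A B : Set (Euc d)}
    {L1 L2 : List (Set (Euc d))} (h1 : GoodList μ n A L1) (h2 : GoodList μ n B L2)
    (hA : A ⊆ P) (hB : B ⊆ P) (h : interior A ∩ interior B = ∅) :
    GoodList μ n P (L1 ++ L2) := by
  constructor
  · intro C hC
    rcases List.mem_append.1 hC with hC | hC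
    · obtain ⟨a, b, c, e⟩ := h1.1 C hC
      exact ⟨a, b, c.trans hA, e⟩
    · obtain ⟨a, b, c, e⟩ := h2.1 C hC
      exact ⟨a, b, c.trans hB, e⟩
  · rw [List.pairwise_append]
    exact ⟨h1.2, h2.2, fun a ha b hb =>
      interior_disj_mono (h1.1 a ha).2.2.1 (h2.1 b hb).2.2.1 h⟩

lemma GoodList.single {d : ℕ} {μ : Measure (Euc d)} {n : ℕ} {P : Set (Euc d)}
    (hP : Convex ℝ P) (hPc : IsClosed P) (h : n * μ.real P = 1) : GoodList μ n P [P] := by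
  constructor
  · simpa using ⟨hP, hPc, h⟩
  · simp

lemma leaf_parts {d : ℕ} (hd : 1 ≤ d) {μ : Measure (Euc d)} [IsFiniteMeasure μ]
    (hμ : μ ≪ volume) {n : ℕ} (hn : 0 < n) (a : ℕ) : ∀ {P : Set (Euc d)}, Convex ℝ P →
      IsClosed P → n * μ.real P = a → ∃ L, L.length = a ∧ GoodList μ n P L := by
  have hn' : (0 : ℝ) < n := by exact_mod_cast hn
  obtain ⟨v, hv⟩ : ∃ v : Euc d, v ≠ 0 :=
    ⟨EuclideanSpace.single ⟨0, hd⟩ 1, by simp⟩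
  induction a with
  | zero => intro P _ _ _; exact ⟨[], rfl, by simp [GoodList]⟩
  | succ a ih =>
    intro P hP hPc hmass
    push_cast at hmass
    have hle : 1 / (n : ℝ) ≤ μ.real P := by
      rw [div_le_iff₀ hn', mul_comm, hmass]
      have : (0 : ℝ) ≤ a := by positivity
      linarith
    obtain ⟨A, B, hA, hAc, hAP, hB, hBc, hBP, hAB, mA, mB, -, -⟩ :=
      cut hμ hP hPc hv (by positivity) hle
    obtain ⟨L, hL, hg⟩ := ih hB hBc (by rw [mB, mul_sub, hmass]; field_simp; ring)
    refine ⟨[A] ++ L, by simp [hL], ?_⟩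
    exact (GoodList.single hA hAc (by rw [mA]; field_simp)).append hg hAP hBP hAB

lemma equalize {d : ℕ} (hd : 1 ≤ d) {μ : Measure (Euc d)} [IsFiniteMeasure μ]
    (hμ : μ ≪ volume) {n : ℕ} (hn : 0 < n) (T : BTree d) : ∀ {P : Set (Euc d)} (a : ℕ),
      Convex ℝ P → IsClosed P → n * μ.real P = a → ∃ L, L.length = a ∧ GoodList μ n P L ∧
        ∀ v c, (L.map (ind v c)).sum ≤ ((T.leaves : ℝ) - 1) + n * T.hm μ v c P := by
  have hn' : (0 : ℝ) < n := by exact_mod_cast hn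
  induction T with
  | leaf =>
    intro P a hP hPc hmass
    obtain ⟨L, hL, hg⟩ := leaf_parts hd hμ hn a hP hPc hmass
    refine ⟨L, hL, hg, fun v c => ?_⟩
    have h1 : (L.map (ind v c)).sum ≤ (L.map (ind v c)).length • ind v c P := by
      apply List.sum_le_card_nsmul
      intro x hx
      obtain ⟨C, hC, rfl⟩ := List.mem_map.1 hx
      exact ind_mono v c (hg.1 C hC).2.2.1
    rw [List.length_map, hL, nsmul_eq_mul, ← hmass] at h1
    simp only [BTree.leaves, BTree.hm]
    push_cast
    linarith
  | node w e l r ihl ihr =>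
    intro P a hP hPc hmass
    have a1 := hP.inter (HS_convex w.1 e)
    have a2 := hPc.inter (HS_closed w.1 e)
    have b1 := hP.inter (HS'_convex w.1 e)
    have b2 := hPc.inter (HS'_closed w.1 e)
    have hs := real_split hμ hP hPc w.2 e
    have hfl := Nat.floor_le (a := (n : ℝ) * μ.real (P ∩ HS w.1 e))
      (mul_nonneg hn'.le measureReal_nonneg)
    have hfl2 := Nat.lt_floor_add_one ((n : ℝ) * μ.real (P ∩ HS w.1 e))
    have hnn : (0 : ℝ) ≤ n * μ.real (P ∩ HS' w.1 e) := mul_nonneg hn'.le measureReal_nonneg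
    have hsn : (n : ℝ) * μ.real (P ∩ HS w.1 e) + n * μ.real (P ∩ HS' w.1 e) = a := by
      rw [← hmass, hs]; ring
    generalize hk : ⌊(n : ℝ) * μ.real (P ∩ HS w.1 e)⌋₊ = k at hfl hfl2
    rcases hfl.eq_or_lt with heq | hlt
    · have hka : k ≤ a := by
        have : (k : ℝ) ≤ a := by linarith
        exact_mod_cast this
      obtain ⟨L1, l1, g1, s1⟩ := ihl k a1 a2 heq.symm
      obtain ⟨L2, l2, g2, s2⟩ := ihr (a - k) b1 b2 (by rw [Nat.cast_sub hka]; linarith)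
      refine ⟨L1 ++ L2, by simp [l1, l2, hka], ?_, fun v c => ?_⟩
      · exact g1.append g2 inter_subset_left inter_subset_left
          (interior_disj_mono inter_subset_right inter_subset_right (interior_HS_disj w.2 e))
      · rw [List.map_append, List.sum_append]
        simp only [BTree.leaves, BTree.hm]
        push_cast
        have := s1 v c
        have := s2 v c
        linarith
    · have hka : k + 1 ≤ a := by
        have : (k : ℝ) < a := by linarith
        exact_mod_cast this
      have hka' : (k : ℝ) + 1 ≤ a := by exact_mod_cast hka
      have hq : (k : ℝ) / n < μ.real (P ∩ HS w.1 e) := by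
        rw [div_lt_iff₀ hn']; linarith
      have hP' : μ.real P = a / n := by
        rw [eq_div_iff hn'.ne']; linarith
      obtain ⟨A, B, hA, hAc, hAP, hB, hBc, hBP, hAB, mA, mB, cA, -⟩ :=
        cut hμ hP hPc w.2 (m := k / n) (by positivity)
          (by rw [hP']; gcongr; linarith)
      have hAHS := cA e hq
      obtain ⟨M, B', hM, hMc, hMP, hB', hBc', hBP', hMB, mM, mB', -, cB'⟩ :=
        cut hμ hB hBc w.2 (m := 1 / n) (by positivity)
          (by rw [mB, hP', ← sub_div]; gcongr; linarith)
      have hBHS := cB' e (by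
        have h1 : interior A ∩ interior (B ∩ HS w.1 e) = ∅ :=
          interior_disj_mono subset_rfl inter_subset_left hAB
        have h2 := real_union hμ hA (hB.inter (HS_convex w.1 e))
          (hBc.inter (HS_closed w.1 e)) h1
        have h3 : μ.real (A ∪ (B ∩ HS w.1 e)) ≤ μ.real (P ∩ HS w.1 e) :=
          measureReal_mono (union_subset (subset_inter hAP hAHS)
            (inter_subset_inter_left _ hBP))
        have h4 : μ.real (P ∩ HS w.1 e) < (k + 1) / n := by
          rw [lt_div_iff₀ hn']; linarith
        rw [add_div] at h4
        linarith)
      obtain ⟨L1, l1, g1, s1⟩ := ihl k hA hAc (by rw [mA]; field_simp)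
      obtain ⟨L2, l2, g2, s2⟩ := ihr (a - (k + 1)) hB' hBc' (by
        rw [Nat.cast_sub hka, mB', mB, hP']; field_simp; push_cast; ring)
      have gM : GoodList μ n M [M] := GoodList.single hM hMc (by rw [mM]; field_simp)
      refine ⟨L1 ++ ([M] ++ L2), by simp [l1, l2]; omega, ?_, fun v c => ?_⟩
      · exact g1.append (gM.append g2 hMP hBP' hMB) hAP hBP hAB
      · rw [List.map_append, List.sum_append, List.map_append, List.sum_append]
        simp only [BTree.leaves, BTree.hm, List.map_cons, List.map_nil, List.sum_cons,
          List.sum_nil]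
        push_cast
        have h1 := s1 v c
        have h2 := s2 v c
        have h3 := ind_le_one v c M
        have h4 := mul_le_mul_of_nonneg_left
          (BTree.hm_mono μ v c l (subset_inter hAP hAHS)) hn'.le
        have h5 := mul_le_mul_of_nonneg_left
          (BTree.hm_mono μ v c r (subset_inter (hBP'.trans hBP) hBHS)) hn'.le
        linarith

lemma nice_ac {d : ℕ} {μ : Measure (Euc d)} (h : NiceMeasure d μ) :
    μ ≪ volume ∧ μ.IsOpenPosMeasure := by
  obtain ⟨_, f, hf, hpos, rfl⟩ := h
  refine ⟨withDensity_absolutelyContinuous _ _, ?_⟩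
  refine Measure.AbsolutelyContinuous.isOpenPosMeasure
    (withDensity_absolutelyContinuous' ?_ ?_ : (volume : Measure (Euc d)) ≪ _)
  · exact (ENNReal.measurable_ofReal.comp hf.measurable).aemeasurable
  · exact Filter.Eventually.of_forall fun x => by simp [hpos x]

lemma finish {d : ℕ} {μ : Measure (Euc d)} (hnice : NiceMeasure d μ) {n k : ℕ} (hn : 0 < n)
    {L : List (Set (Euc d))} (hL : L.length = n) (hg : GoodList μ n univ L)
    (hk : ∀ v c, v ≠ 0 → (k : ℝ) ≤ n - (L.map (ind v c)).sum) :
    ∃ C : Fin n → Set (Euc d), IsEquipartition μ k C := by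
  classical
  subst hL
  obtain ⟨hac, hop⟩ := nice_ac hnice
  have := hnice.1
  have hn' : (0 : ℝ) < L.length := by exact_mod_cast hn
  have hm : ∀ i : Fin L.length, L[i] ∈ L := fun i => List.getElem_mem _
  have hdisj : ∀ i j : Fin L.length, i ≠ j → interior L[i] ∩ interior L[j] = ∅ := by
    intro i j hij
    have hp := List.pairwise_iff_getElem.1 hg.2
    rcases lt_or_gt_of_ne hij with h | h
    · exact hp i j i.2 j.2 h
    · rw [inter_comm]; exact hp j i j.2 i.2 h
  have hmass : ∀ i : Fin L.length, μ L[i] = (L.length : ℝ≥0∞)⁻¹ := by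
    intro i
    have h1 := (hg.1 _ (hm i)).2.2.2
    have h2 : μ.real L[i] = (L.length : ℝ)⁻¹ := by
      apply eq_inv_of_mul_eq_one_left
      rw [mul_comm]; exact h1
    rw [← ofReal_measureReal, h2, ENNReal.ofReal_inv_of_pos hn', ENNReal.ofReal_natCast]
  refine ⟨fun i => L[i], ⟨fun i => (hg.1 _ (hm i)).2.1, fun i => (hg.1 _ (hm i)).1, hdisj, ?_⟩,
    hmass, ?_⟩
  · have hcl : IsClosed (⋃ i : Fin L.length, L[i]) :=
      isClosed_iUnion_of_finite fun i => (hg.1 _ (hm i)).2.1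
    have h1 : μ (⋃ i : Fin L.length, L[i]) = 1 := by
      rw [measure_iUnion₀ (fun i j hij =>
        null_inter hac (hg.1 _ (hm i)).1 (hg.1 _ (hm j)).1 (hdisj i j hij))
        (fun i => (hg.1 _ (hm i)).2.1.measurableSet.nullMeasurableSet)]
      simp only [hmass, tsum_fintype, Finset.sum_const, Finset.card_univ, Fintype.card_fin,
        nsmul_eq_mul]
      exact ENNReal.mul_inv_cancel (by exact_mod_cast hn.ne') (ENNReal.natCast_ne_top _)
    have h2 : μ (⋃ i : Fin L.length, L[i])ᶜ = 0 := (prob_compl_eq_zero_iff hcl.measurableSet).2 h1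
    have h3 := (hcl.isOpen_compl.measure_eq_zero_iff μ).1 h2
    exact compl_empty_iff.1 h3
  · intro v c hv
    have h1 := hk v c hv
    have h2 : (L.map (ind v c)).sum = ∑ i : Fin L.length, ind v c L[i] := by
      rw [← List.sum_ofFn]
      congr 1
      apply List.ext_getElem <;> simp
    have h3 : ({i : Fin L.length | Avoids (Hyperplane v c) L[i]}.ncard : ℝ)
        = ∑ i : Fin L.length, (1 - ind v c L[i]) := by
      rw [Set.ncard_eq_toFinset_card', Finset.card_eq_sum_ones]
      push_cast
      rw [Set.toFinset_ofPred, Finset.sum_filter]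
      refine Finset.sum_congr rfl fun i _ => ?_
      unfold ind
      split_ifs <;> simp
    have h4 : (k : ℝ) ≤ ({i : Fin L.length | Avoids (Hyperplane v c) L[i]}.ncard : ℝ) := by
      rw [h3, Finset.sum_sub_distrib, ← h2]
      simpa using h1
    exact_mod_cast h4

lemma exists_nice (d : ℕ) : ∃ μ, NiceMeasure d μ := by
  let g : Euc d → ℝ := fun x => Real.exp (-1 * ‖x‖ ^ 2)
  have hI := GaussianFourier.integral_rexp_neg_mul_sq_norm (V := Euc d) (b := 1) one_pos
  have hpos : 0 < ∫ x, g x := by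
    show 0 < ∫ x : Euc d, Real.exp (-1 * ‖x‖ ^ 2)
    rw [hI]; positivity
  have hint : Integrable g := by
    by_contra h
    rw [integral_undef h] at hpos
    exact lt_irrefl _ hpos
  have hgc : Continuous g := by fun_prop
  refine ⟨volume.withDensity (fun x => ENNReal.ofReal (g x / ∫ y, g y)), ⟨?_⟩,
    fun x => g x / ∫ y, g y, by fun_prop, fun x => div_pos (Real.exp_pos _) hpos, rfl⟩
  rw [withDensity_apply _ MeasurableSet.univ, Measure.restrict_univ,
    ← ofReal_integral_eq_lintegral_ofReal (hint.div_const _)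
      (Filter.Eventually.of_forall fun x => (div_pos (Real.exp_pos _) hpos).le),
    integral_div, div_self hpos.ne', ENNReal.ofReal_one]

lemma main_part (d : ℕ) (hd : 1 ≤ d) (ε : ℝ) (hε : 0 < ε) : ∃ K : ℕ, ∀ k : ℕ, K ≤ k →
      ∃ n : ℕ, (n : ℝ) ≤ (1 + ε) * k ∧ HasEquipartition d k n := by
  have h1ε : 0 < 1 + ε := by linarith
  obtain ⟨B, hB⟩ := good_tree hd (ε / (2 * (1 + ε))) (by positivity)
  obtain ⟨K, hK⟩ := exists_nat_ge (2 * (1 + B) / ε)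
  refine ⟨K + 1, fun k hk => ⟨⌊(1 + ε) * k⌋₊, Nat.floor_le (by positivity), ?_⟩⟩
  intro μ hnice
  obtain ⟨hac, hop⟩ := nice_ac hnice
  have := hnice.1
  have hk1 : (K : ℝ) + 1 ≤ k := by exact_mod_cast hk
  have hKε : 2 * (1 + B) ≤ K * ε := by rwa [div_le_iff₀ hε] at hK
  have hK0 : (0 : ℝ) ≤ K := by positivity
  have hfl := Nat.floor_le (a := (1 + ε) * (k : ℝ)) (by positivity)
  have hfl2 := Nat.lt_floor_add_one ((1 + ε) * (k : ℝ))
  generalize ⌊(1 + ε) * (k : ℝ)⌋₊ = n at hfl hfl2 ⊢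
  have hn : 0 < n := by
    have : (0 : ℝ) < n := by nlinarith
    exact_mod_cast this
  have hn' : (0 : ℝ) < n := by exact_mod_cast hn
  obtain ⟨T, hT, hT'⟩ := hB μ hac
  obtain ⟨L, hL, hg, hs⟩ := equalize hd hac hn T n convex_univ isClosed_univ (by simp)
  refine finish hnice hn hL hg fun v c hv => ?_
  have h1 := hs v c
  have h2 := mul_le_mul_of_nonneg_left (hT' v c hv) hn'.le
  have h3 : (T.leaves : ℝ) ≤ B := by exact_mod_cast hT
  have h4 : (n : ℝ) * (ε / (2 * (1 + ε))) ≤ (1 + ε) * k * (ε / (2 * (1 + ε))) :=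
    mul_le_mul_of_nonneg_right hfl (by positivity)
  have h5 : (1 + ε) * k * (ε / (2 * (1 + ε))) = k * ε / 2 := by field_simp
  nlinarith

/-- For fixed d ≥ 1, N_d(k)/k → 1 as k → ∞. Equivalently: N_d(k) ≥ k for every k ≥ 1,
and for every ε > 0 there is K such that for every k ≥ K there exists n ≤ (1+ε)·k
such that every nice measure on ℝ^d admits a k-equipartition into n parts. -/
theorem Nd_div_k_tendsto_one (d : ℕ) (hd : 1 ≤ d) :
    (∀ k : ℕ, 1 ≤ k → k ≤ Nd d k) ∧
    (∀ ε : ℝ, 0 < ε → ∃ K : ℕ, ∀ k : ℕ, K ≤ k →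
      ∃ n : ℕ, (n : ℝ) ≤ (1 + ε) * k ∧ HasEquipartition d k n) := by
  refine ⟨fun k hk => ?_, fun ε hε => main_part d hd ε hε⟩
  obtain ⟨μ, hμ⟩ := exists_nice d
  have hv : (EuclideanSpace.single ⟨0, hd⟩ 1 : Euc d) ≠ 0 := by simp
  have hle : ∀ k n : ℕ, HasEquipartition d k n → k ≤ n := by
    intro k n h
    obtain ⟨C, hC⟩ := h μ hμ
    refine (hC.2.2 _ 0 hv).trans ?_
    simpa using Set.ncard_le_card {i | Avoids (Hyperplane (EuclideanSpace.single ⟨0, hd⟩ 1) 0) (C i)}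
  obtain ⟨K, hK⟩ := main_part d hd 1 one_pos
  obtain ⟨n, -, hn⟩ := hK (max K k) (le_max_left _ _)
  have hn' : HasEquipartition d k n := by
    intro ν hν
    obtain ⟨C, hC⟩ := hn ν hν
    exact ⟨C, hC.1, hC.2.1, fun v c hv => (le_max_right _ _).trans (hC.2.2 v c hv)⟩
  have hne : {n | 0 < n ∧ HasEquipartition d k n}.Nonempty :=
    ⟨n, lt_of_lt_of_le hk (hle k n hn'), hn'⟩
  exact hle k _ (Nat.sInf_mem hne).2
end
end

section
/- Let d ≥ 1 and t ∈ [0, π/2]. Let A ⊆ S^d be a nonempty closed set with σ_d(A) = h_d(t), and let B ⊆ S^d be a σ_d-measurable set such that either a·b ≥ 0 for all a ∈ A and b ∈ B, or a·b ≤ 0 for all a ∈ A and b ∈ B. Then σ_d(B) ≤ h_d(π/2 − t). -/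
open MeasureTheory Set Metric
open scoped ENNReal
noncomputable section

abbrev Sph (d : ℕ) := Metric.sphere (0 : EuclideanSpace ℝ (Fin (d + 1))) 1

/-- `σ_d`: the rotation-invariant (uniform) probability measure on the sphere `S^d`,
obtained by normalizing the surface measure induced by Lebesgue measure. -/
def sphMeasure (d : ℕ) : Measure (Sph d) :=
  ((volume : Measure (EuclideanSpace ℝ (Fin (d + 1)))).toSphere Set.univ)⁻¹ •
    (volume : Measure (EuclideanSpace ℝ (Fin (d + 1)))).toSphere

/-- `h_d(t)`: the `σ_d`-measure of a spherical cap of `S^d` with central angle `t`. -/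
def capMeasure (d : ℕ) (t : ℝ) : ℝ≥0∞ :=
  sphMeasure d {x : Sph d |
    Real.cos t ≤ inner (𝕜 := ℝ) (x : EuclideanSpace ℝ (Fin (d + 1))) (EuclideanSpace.single 0 1)}

/-- A nice measure on `S^d`: a probability measure with a continuous strictly positive
density with respect to `σ_d`. -/
def NiceSphMeasure (d : ℕ) (μ : Measure (Sph d)) : Prop :=
  IsProbabilityMeasure μ ∧ ∃ f : Sph d → ℝ, Continuous f ∧ (∀ x, 0 < f x) ∧
    μ = (sphMeasure d).withDensity (fun x => ENNReal.ofReal (f x))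

/-- The set `C_d` of pairs `(α, β)` such that for any two nice measures `μ1, μ2` on `S^d`
there are sets `A, B` with `μ1 A ≥ α`, `μ2 B ≥ β` on which the inner product has constant sign. -/
def CSet (d : ℕ) : Set (ℝ × ℝ) :=
  {p | 0 ≤ p.1 ∧ 0 ≤ p.2 ∧
    ∀ μ1 μ2 : Measure (Sph d), NiceSphMeasure d μ1 → NiceSphMeasure d μ2 →
      ∃ A B : Set (Sph d), ENNReal.ofReal p.1 ≤ μ1 A ∧ ENNReal.ofReal p.2 ≤ μ2 B ∧
        ((∀ a ∈ A, ∀ b ∈ B, 0 ≤ inner (𝕜 := ℝ) (a : EuclideanSpace ℝ (Fin (d + 1)))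
            (b : EuclideanSpace ℝ (Fin (d + 1)))) ∨
         (∀ a ∈ A, ∀ b ∈ B, inner (𝕜 := ℝ) (a : EuclideanSpace ℝ (Fin (d + 1)))
            (b : EuclideanSpace ℝ (Fin (d + 1))) ≤ 0))}
open scoped Pointwise
open Filter Topology TopologicalSpace
abbrev EE (d : ℕ) := EuclideanSpace ℝ (Fin (d + 1))

instance sphM_finite (d : ℕ) : IsFiniteMeasure (sphMeasure d) := by
  unfold sphMeasure
  refine Measure.smul_finite _ ?_
  rw [ENNReal.inv_ne_top]
  simp only [ne_eq, Measure.measure_univ_eq_zero]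
  exact Measure.toSphere_ne_zero _

instance sphM_pos (d : ℕ) : (sphMeasure d).IsOpenPosMeasure := by
  constructor
  intro U hU hne
  unfold sphMeasure
  rw [Measure.smul_apply, smul_eq_mul]
  refine mul_ne_zero ?_ (hU.measure_ne_zero _ hne)
  rw [ENNReal.inv_ne_zero]
  exact measure_ne_top _ _

/-- Restriction of a linear isometry to the sphere. -/
def sphMap {d : ℕ} (L : EE d ≃ₗᵢ[ℝ] EE d) (x : Sph d) : Sph d :=
  ⟨L x, by simp⟩

@[simp] lemma sphMap_coe {d : ℕ} (L : EE d ≃ₗᵢ[ℝ] EE d) (x : Sph d) :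
    ((sphMap L x : Sph d) : EE d) = L x := rfl

lemma sphMap_cont {d : ℕ} (L : EE d ≃ₗᵢ[ℝ] EE d) : Continuous (sphMap L) :=
  Continuous.subtype_mk (L.continuous.comp continuous_subtype_val) _

lemma sphMap_meas {d : ℕ} (L : EE d ≃ₗᵢ[ℝ] EE d) {s : Set (Sph d)} (hs : MeasurableSet s) :
    sphMeasure d (sphMap L ⁻¹' s) = sphMeasure d s := by
  unfold sphMeasure
  rw [Measure.smul_apply, Measure.smul_apply, Measure.toSphere_apply' _ hs,
    Measure.toSphere_apply' _ ((sphMap_cont L).measurable hs)]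
  congr 2
  rw [← (L.measurePreserving).measure_preimage_emb L.toHomeomorph.measurableEmbedding
    (Ioo (0 : ℝ) 1 • (Subtype.val '' s))]
  congr 1
  ext x
  simp only [Set.mem_smul, Set.mem_preimage, Set.mem_image]
  constructor
  · rintro ⟨r, hr, _, ⟨y, hy, rfl⟩, rfl⟩
    exact ⟨r, hr, _, ⟨_, hy, rfl⟩, by simp⟩
  · rintro ⟨r, hr, _, ⟨y, hy, rfl⟩, h⟩
    refine ⟨r, hr, _, ⟨sphMap L.symm y, ?_, rfl⟩, ?_⟩
    · have : sphMap L (sphMap L.symm y) = y := by ext1; simp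
      rwa [this]
    · simp only [sphMap_coe]
      rw [← map_smul, h]
      exact L.symm_apply_apply x

lemma sphMap_mp {d : ℕ} (L : EE d ≃ₗᵢ[ℝ] EE d) :
    MeasurePreserving (sphMap L) (sphMeasure d) (sphMeasure d) := by
  refine ⟨(sphMap_cont L).measurable, ?_⟩
  ext s hs
  rw [Measure.map_apply (sphMap_cont L).measurable hs, sphMap_meas L hs]

/-- Reflection in the hyperplane orthogonal to `u`. -/
def rf {d : ℕ} (u : EE d) : EE d ≃ₗᵢ[ℝ] EE d := (Submodule.span ℝ {u})ᗮ.reflection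

lemma rf_apply {d : ℕ} (u : EE d) (hu : ‖u‖ = 1) (x : EE d) :
    rf u x = x - (2 * inner ℝ x u) • u := by
  unfold rf
  rw [Submodule.reflection_orthogonal_apply, Submodule.reflection_singleton_apply, hu,
    real_inner_comm]
  simp only [mul_smul, two_smul]
  simp

lemma rf_rf {d : ℕ} (u : EE d) (x : EE d) : rf u (rf u x) = x := by
  unfold rf; simp

lemma rf_rf' {d : ℕ} (u : EE d) (x : Sph d) : sphMap (rf u) (sphMap (rf u) x) = x := by
  ext1; simp [rf_rf]

lemma rf_inner {d : ℕ} (u : EE d) (hu : ‖u‖ = 1) (x y : EE d) :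
    inner ℝ (rf u x) y = inner ℝ x y - 2 * inner ℝ x u * inner ℝ u y := by
  rw [rf_apply u hu, inner_sub_left, inner_smul_left]; simp

lemma rf_inner_u {d : ℕ} (u : EE d) (hu : ‖u‖ = 1) (x : EE d) :
    inner ℝ (rf u x) u = - inner ℝ x u := by
  rw [rf_inner u hu, real_inner_self_eq_norm_sq, hu]; ring

lemma rf_inner_symm {d : ℕ} (u : EE d) (x y : EE d) :
    inner ℝ (rf u x) y = inner ℝ x (rf u y) := by
  rw [← (rf u).inner_map_map, rf_rf]

/-- Polarisation of a set. -/
def pol {d : ℕ} (u : EE d) (A : Set (Sph d)) : Set (Sph d) :=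
  ({x | 0 ≤ inner ℝ (x : EE d) u} ∩ (A ∪ sphMap (rf u) ⁻¹' A)) ∪ (A ∩ sphMap (rf u) ⁻¹' A)

lemma pol_closed {d : ℕ} (u : EE d) {A : Set (Sph d)} (hA : IsClosed A) : IsClosed (pol u A) := by
  have h := hA.preimage (sphMap_cont (rf u))
  refine IsClosed.union (IsClosed.inter ?_ (hA.union h)) (hA.inter h)
  exact isClosed_le continuous_const (by fun_prop)

lemma pol_polar {d : ℕ} (u : EE d) (hu : ‖u‖ = 1) {A B : Set (Sph d)}
    (h : ∀ a ∈ A, ∀ b ∈ B, inner ℝ (a : EE d) (b : EE d) ≤ 0) :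
    ∀ a ∈ pol u A, ∀ b ∈ pol (-u) B, inner ℝ (a : EE d) (b : EE d) ≤ 0 := by
  have hr : rf (-u) = rf u := by
    ext1 x; rw [rf_apply _ (by simpa), rf_apply _ hu]; simp
  intro a ha b hb
  simp only [pol, hr, mem_union, mem_inter_iff, mem_ofPred_eq, mem_preimage, inner_neg_right,
    Left.nonneg_neg_iff] at ha hb
  have h1 : a ∈ A → b ∈ B → inner ℝ (a : EE d) (b : EE d) ≤ 0 := fun x y => h _ x _ y
  have h2 : sphMap (rf u) a ∈ A → sphMap (rf u) b ∈ B → inner ℝ (a : EE d) (b : EE d) ≤ 0 := by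
    intro x y
    simpa using h _ x _ y
  have h3 : sphMap (rf u) a ∈ A → b ∈ B →
      inner ℝ (a : EE d) (b : EE d) - 2 * inner ℝ (a : EE d) u * inner ℝ (b : EE d) u ≤ 0 := by
    intro x y
    have := h _ x _ y
    rwa [sphMap_coe, rf_inner u hu, real_inner_comm (b : EE d) u] at this
  have h4 : a ∈ A → sphMap (rf u) b ∈ B →
      inner ℝ (a : EE d) (b : EE d) - 2 * inner ℝ (a : EE d) u * inner ℝ (b : EE d) u ≤ 0 := by
    intro x y
    have := h _ x _ y
    rwa [sphMap_coe, ← rf_inner_symm, rf_inner u hu, real_inner_comm (b : EE d) u] at this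
  have h5 : 0 ≤ inner ℝ (a : EE d) u → inner ℝ (b : EE d) u ≤ 0 →
    inner ℝ (a : EE d) u * inner ℝ (b : EE d) u ≤ 0 := mul_nonpos_of_nonneg_of_nonpos
  rcases ha with ⟨ha, h6⟩ | h6 <;> rcases hb with ⟨hb, h7⟩ | h7
  · have := h5 ha hb
    rcases h6 with h6 | h6 <;> rcases h7 with h7 | h7
    · exact h1 h6 h7
    · linarith [h4 h6 h7]
    · linarith [h3 h6 h7]
    · exact h2 h6 h7
  · tauto
  · tauto
  · tauto

/-- The moved part. -/
def mov {d : ℕ} (u : EE d) (A : Set (Sph d)) : Set (Sph d) :=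
  {x | x ∈ A ∧ inner ℝ (x : EE d) u < 0 ∧ sphMap (rf u) x ∉ A}

lemma mov_meas {d : ℕ} (u : EE d) {A : Set (Sph d)} (hA : IsClosed A) :
    MeasurableSet (mov u A) := by
  refine hA.measurableSet.inter (MeasurableSet.inter ?_ ?_)
  · exact (isOpen_lt (f := fun x : Sph d => inner ℝ (x : EE d) u) (g := fun _ => 0)
      (by fun_prop) continuous_const).measurableSet
  · exact ((sphMap_cont _).measurable hA.measurableSet).compl

lemma pol_eq {d : ℕ} (u : EE d) (hu : ‖u‖ = 1) (A : Set (Sph d)) :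
    pol u A = (A \ mov u A) ∪ sphMap (rf u) ⁻¹' (mov u A) := by
  ext x
  have h0 : inner ℝ (x : EE d) u = 0 → sphMap (rf u) x = x := by
    intro h; ext1; rw [sphMap_coe, rf_apply u hu, h]; simp
  simp only [pol, mov, mem_union, mem_inter_iff, mem_ofPred_eq, mem_preimage, Set.mem_sdiff,
    rf_rf', sphMap_coe, rf_inner_u u hu]
  rcases lt_trichotomy (inner ℝ (x : EE d) u) 0 with h | h | h
  · have h1 : ¬ (0 ≤ inner ℝ (x : EE d) u) := not_le.2 h
    have h2 : ¬ (- inner ℝ (x : EE d) u < 0) := by linarith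
    tauto
  · rw [h0 h, h]; simp
  · have h1 : ¬ (inner ℝ (x : EE d) u < 0) := by linarith
    have h2 : (- inner ℝ (x : EE d) u < 0) := by linarith
    have h3 := h.le
    tauto

lemma pol_measure {d : ℕ} (u : EE d) (hu : ‖u‖ = 1) {A : Set (Sph d)} (hA : IsClosed A)
    (ν : Measure (Sph d)) :
    ν (pol u A) + ν (mov u A) = ν A + ν (sphMap (rf u) ⁻¹' (mov u A)) := by
  have hm := mov_meas u hA
  rw [pol_eq u hu, measure_union ?_ ((sphMap_cont _).measurable hm)]
  · have : ν (A \ mov u A) + ν (mov u A) = ν A := by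
      have := measure_sdiff_add_inter (μ := ν) A hm
      rwa [inter_eq_self_of_subset_right] at this
      exact fun x hx => hx.1
    rw [add_right_comm, this]
  · rw [Set.disjoint_left]
    intro x hx hx2
    have := hx2.2.2
    rw [rf_rf'] at this
    exact this hx.1

lemma pol_sph {d : ℕ} (u : EE d) (hu : ‖u‖ = 1) {A : Set (Sph d)} (hA : IsClosed A) :
    sphMeasure d (pol u A) = sphMeasure d A := by
  have := pol_measure u hu hA (sphMeasure d)
  rw [sphMap_meas _ (mov_meas u hA)] at this
  exact (ENNReal.add_left_inj (measure_ne_top _ _)).1 this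

/-- The weighted measure. -/
def wM (d : ℕ) (e : EE d) : Measure (Sph d) :=
  (sphMeasure d).withDensity (fun x => ENNReal.ofReal (‖e‖ + inner ℝ (x : EE d) e))

lemma w_cont (d : ℕ) (e : EE d) :
    Continuous (fun x : Sph d => ENNReal.ofReal (‖e‖ + inner ℝ (x : EE d) e)) :=
  ENNReal.continuous_ofReal.comp (by fun_prop)

lemma sph_abs {d : ℕ} (e : EE d) (x : Sph d) : |inner ℝ (x : EE d) e| ≤ ‖e‖ := by
  have := abs_real_inner_le_norm (x : EE d) e
  simpa using this

instance wM_finite (d : ℕ) (e : EE d) : IsFiniteMeasure (wM d e) := by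
  refine isFiniteMeasure_withDensity ?_
  refine ((lintegral_mono (g := fun _ => ENNReal.ofReal (2 * ‖e‖)) ?_).trans_lt ?_).ne
  · intro x
    refine ENNReal.ofReal_le_ofReal ?_
    linarith [(abs_le.1 (sph_abs e x)).2]
  · simp only [lintegral_const]
    exact ENNReal.mul_lt_top ENNReal.ofReal_lt_top (measure_lt_top _ _)

lemma pol_wM {d : ℕ} (u e : EE d) (hu : ‖u‖ = 1) (hue : 0 < inner ℝ u e) {A : Set (Sph d)}
    (hA : IsClosed A) (h : wM d e (pol u A) ≤ wM d e A) : sphMeasure d (mov u A) = 0 := by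
  have hm := mov_meas u hA
  by_contra h0
  have h1 := pol_measure u hu hA (wM d e)
  have h2 : wM d e (sphMap (rf u) ⁻¹' (mov u A)) ≤ wM d e (mov u A) := by
    by_contra h3
    rw [not_le] at h3
    have := ENNReal.add_lt_add_of_le_of_lt (measure_ne_top _ _) h h3
    rw [h1] at this
    exact lt_irrefl _ this
  have hm2 : MeasurableSet (sphMap (rf u) ⁻¹' (mov u A)) := (sphMap_cont _).measurable hm
  have h4 : wM d e (sphMap (rf u) ⁻¹' (mov u A)) =
      ∫⁻ x in mov u A, ENNReal.ofReal (‖e‖ + inner ℝ (rf u x) e) ∂ sphMeasure d := by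
    rw [wM, withDensity_apply _ hm2]
    have := (sphMap_mp (rf u)).setLIntegral_comp_preimage hm
      (f := fun x => ENNReal.ofReal (‖e‖ + inner ℝ (rf u x) e)) (by
        refine (ENNReal.continuous_ofReal.comp ?_).measurable
        have := (rf u).continuous
        fun_prop)
    rw [← this]
    simp [rf_rf]
  have h5 : wM d e (mov u A) < wM d e (sphMap (rf u) ⁻¹' (mov u A)) := by
    rw [h4, wM, withDensity_apply _ hm]
    refine setLIntegral_strict_mono hm h0 ?_ ?_ ?_
    · refine (ENNReal.continuous_ofReal.comp ?_).measurable
      have := (rf u).continuous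
      fun_prop
    · rw [← withDensity_apply _ hm]
      exact measure_ne_top (wM d e) _
    · refine Eventually.of_forall ?_
      intro x hx
      have h6 := (abs_le.1 (sph_abs e x)).1
      have h7 : inner ℝ (x : EE d) e < inner ℝ (rf u x) e := by
        rw [rf_inner u hu]
        nlinarith [mul_pos_of_neg_of_neg (neg_lt_zero.2 hue) hx.2.1]
      exact (ENNReal.ofReal_lt_ofReal_iff (by linarith)).2 (by linarith)
  exact absurd h2 (not_le.2 h5)

lemma usc_measure {d : ℕ} (ν : Measure (Sph d)) [IsFiniteMeasure ν] :
    UpperSemicontinuous (fun K : Compacts (Sph d) => ν K) := by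
  intro K y hy
  obtain ⟨U, hKU, hU, hlt⟩ := (K : Set (Sph d)).exists_isOpen_lt_of_lt y hy
  filter_upwards [(Compacts.isOpen_subsets_of_isOpen hU).mem_nhds hKU] with L hL
  exact (measure_mono hL).trans_lt hlt

lemma exists_max {d : ℕ} (e : EE d) {A B : Set (Sph d)} (hA : IsClosed A) (hB : IsClosed B)
    (h : ∀ a ∈ A, ∀ b ∈ B, inner ℝ (a : EE d) (b : EE d) ≤ 0) :
    ∃ A' B' : Set (Sph d), IsClosed A' ∧ sphMeasure d A ≤ sphMeasure d A' ∧
      sphMeasure d B ≤ sphMeasure d B' ∧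
      (∀ a ∈ A', ∀ b ∈ B', inner ℝ (a : EE d) (b : EE d) ≤ 0) ∧
      ∀ u : EE d, ‖u‖ = 1 → 0 < inner ℝ u e → sphMeasure d (mov u A') = 0 := by
  let F : Set (Sph d × Sph d) := {p | inner ℝ (p.1 : EE d) (p.2 : EE d) ≤ 0}
  have hF : IsClosed F := isClosed_le (by fun_prop) continuous_const
  let S : Set (Compacts (Sph d) × Compacts (Sph d)) :=
    {p | sphMeasure d A ≤ sphMeasure d p.1 ∧ sphMeasure d B ≤ sphMeasure d p.2 ∧
      ((p.1 ×ˢ p.2 : Compacts (Sph d × Sph d)) : Set (Sph d × Sph d)) ⊆ F}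
  have hS : IsClosed S := by
    have h1 := (usc_measure (sphMeasure d)).isClosed_preimage (sphMeasure d A)
    have h2 := (usc_measure (sphMeasure d)).isClosed_preimage (sphMeasure d B)
    exact (h1.preimage continuous_fst).inter ((h2.preimage continuous_snd).inter
      ((Compacts.isClosed_subsets_of_isClosed hF).preimage Compacts.continuous_prod))
  have hne : S.Nonempty := by
    refine ⟨(⟨A, hA.isCompact⟩, ⟨B, hB.isCompact⟩), le_rfl, le_rfl, ?_⟩
    rintro ⟨a, b⟩ ⟨ha, hb⟩
    exact h a ha b hb
  have husc : UpperSemicontinuous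
      (fun p : Compacts (Sph d) × Compacts (Sph d) => wM d e p.1) :=
    (usc_measure (wM d e)).comp continuous_fst
  obtain ⟨⟨K, L⟩, hKL, hmax⟩ := (husc.upperSemicontinuousOn S).exists_isMaxOn hne hS.isCompact
  have hp : ∀ a ∈ K, ∀ b ∈ L, inner ℝ (a : EE d) (b : EE d) ≤ 0 :=
    fun a ha b hb => hKL.2.2 (show (a, b) ∈ _ from ⟨ha, hb⟩)
  refine ⟨K, L, K.isCompact.isClosed, hKL.1, hKL.2.1, hp, ?_⟩
  intro u hu hue
  refine pol_wM u e hu hue K.isCompact.isClosed ?_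
  have hK := K.isCompact.isClosed
  have hL := L.isCompact.isClosed
  refine hmax (show ((⟨pol u K, (pol_closed u hK).isCompact⟩,
    ⟨pol (-u) L, (pol_closed (-u) hL).isCompact⟩) : Compacts (Sph d) × Compacts (Sph d)) ∈ S
      from ⟨?_, ?_, ?_⟩)
  · exact hKL.1.trans (pol_sph u hu hK).ge
  · exact hKL.2.1.trans (pol_sph (-u) (by simpa) hL).ge
  · rintro ⟨a, b⟩ ⟨ha, hb⟩
    exact pol_polar u hu hp a ha b hb

/-- Density point. -/
def dens {d : ℕ} (A : Set (Sph d)) (x : Sph d) : Prop :=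
  ∀ᶠ r in 𝓝[>] (0 : ℝ), sphMeasure d (closedBall x r) / 2 < sphMeasure d (A ∩ closedBall x r)

lemma ae_dens {d : ℕ} {A : Set (Sph d)} (hA : MeasurableSet A) :
    ∀ᵐ x ∂(sphMeasure d), x ∈ A → dens A x := by
  have hc : Measurable ((↑) : Sph d → EE d) := measurable_subtype_coe
  have he : MeasurableEmbedding ((↑) : Sph d → EE d) :=
    MeasurableEmbedding.subtype_coe isClosed_sphere.measurableSet
  have hA' : MeasurableSet (((↑) : Sph d → EE d) '' A) := he.measurableSet_image.2 hA
  have := Besicovitch.ae_tendsto_measure_inter_div_of_measurableSet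
    ((sphMeasure d).map ((↑) : Sph d → EE d)) hA'
  have := ae_of_ae_map hc.aemeasurable this
  filter_upwards [this] with x hx hxA
  rw [indicator_of_mem (mem_image_of_mem _ hxA)] at hx
  have h1 : ∀ᶠ r in 𝓝[>] (0 : ℝ), _ :=
    hx.eventually (lt_mem_nhds (show (1 / 2 : ℝ≥0∞) < (1 : EE d → ℝ≥0∞) x from
    ENNReal.half_lt_self one_ne_zero ENNReal.one_ne_top))
  unfold dens
  filter_upwards [h1, self_mem_nhdsWithin] with r hr hr0
  rw [he.map_apply, he.map_apply] at hr
  have e1 : ((↑) : Sph d → EE d) ⁻¹' (((↑) : Sph d → EE d) '' A ∩ closedBall (x : EE d) r) =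
    A ∩ closedBall x r := by
    rw [preimage_inter, preimage_image_eq _ Subtype.val_injective]; rfl
  have e2 : ((↑) : Sph d → EE d) ⁻¹' (closedBall (x : EE d) r) = closedBall x r := rfl
  rw [e1, e2] at hr
  have := ENNReal.mul_lt_of_lt_div hr
  rwa [mul_comm, mul_one_div] at this

lemma dens_le {d : ℕ} (e : EE d) {A : Set (Sph d)} (hA : IsClosed A)
    (h : ∀ u : EE d, ‖u‖ = 1 → 0 < inner ℝ u e → sphMeasure d (mov u A) = 0)
    {x y : Sph d} (hx : dens A x) (hy : dens Aᶜ y) :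
    inner ℝ (y : EE d) e ≤ inner ℝ (x : EE d) e := by
  by_contra hlt
  rw [not_le] at hlt
  have hne : (y : EE d) - x ≠ 0 := by
    intro h0
    rw [sub_eq_zero] at h0
    rw [h0] at hlt
    exact lt_irrefl _ hlt
  have hn : 0 < ‖(y : EE d) - x‖ := norm_pos_iff.2 hne
  set u : EE d := ‖(y : EE d) - x‖⁻¹ • ((y : EE d) - x) with hu_def
  have hu : ‖u‖ = 1 := by
    rw [hu_def, norm_smul, norm_inv, norm_norm, inv_mul_cancel₀ hn.ne']
  have hue : 0 < inner ℝ u e := by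
    rw [hu_def, inner_smul_left, inner_sub_left]
    exact mul_pos (by simpa using hne) (by linarith)
  have hxx : ‖(x : EE d)‖ = 1 := by simp
  have hyy : ‖(y : EE d)‖ = 1 := by simp
  have hsq := norm_sub_sq_real (y : EE d) x
  rw [hxx, hyy] at hsq
  have hxu : 2 * inner ℝ (x : EE d) u = - ‖(y : EE d) - x‖ := by
    rw [hu_def, inner_smul_right, inner_sub_right, real_inner_self_eq_norm_sq, hxx,
      real_inner_comm]
    field_simp
    linarith
  have hRx : sphMap (rf u) x = y := by
    ext1
    rw [sphMap_coe, rf_apply u hu, hxu, hu_def, smul_smul, neg_mul, mul_inv_cancel₀ hn.ne']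
    simp
  have hball : ∀ r, sphMap (rf u) ⁻¹' (closedBall y r) = closedBall x r := by
    intro r
    ext z
    rw [mem_preimage, mem_closedBall, mem_closedBall, ← hRx, Subtype.dist_eq, Subtype.dist_eq,
      sphMap_coe, sphMap_coe, (rf u).dist_map]
  have hneg : ∀ᶠ r in 𝓝[>] (0 : ℝ), closedBall x r ⊆ {z : Sph d | inner ℝ (z : EE d) u < 0} := by
    have ho : IsOpen {z : Sph d | inner ℝ (z : EE d) u < 0} :=
      isOpen_lt (f := fun x : Sph d => inner ℝ (x : EE d) u) (g := fun _ => 0)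
        (by fun_prop) continuous_const
    have hxm : x ∈ {z : Sph d | inner ℝ (z : EE d) u < 0} := by
      show inner ℝ (x : EE d) u < 0
      linarith
    obtain ⟨ε, hε, hb⟩ := Metric.isOpen_iff.1 ho x hxm
    filter_upwards [Ioo_mem_nhdsGT hε] with r hr
    exact (closedBall_subset_ball hr.2).trans hb
  obtain ⟨r, h1, h2, h3⟩ := (hx.and (hy.and hneg)).exists
  have hmA := hA.measurableSet
  have hmB : MeasurableSet (closedBall x r) := isClosed_closedBall.measurableSet
  have hmC : MeasurableSet (closedBall y r) := isClosed_closedBall.measurableSet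
  have hmR := (sphMap_cont (rf u)).measurable hmA
  rw [← sphMap_meas (rf u) hmC, ← sphMap_meas (rf u) (hmA.compl.inter hmC), preimage_inter,
    hball] at h2
  have h4 : sphMeasure d (closedBall x r ∩ sphMap (rf u) ⁻¹' Aᶜ) ≤
      sphMeasure d (closedBall x r \ A) := by
    rw [← measure_inter_add_sdiff (closedBall x r ∩ sphMap (rf u) ⁻¹' Aᶜ) hmA]
    have : sphMeasure d (closedBall x r ∩ sphMap (rf u) ⁻¹' Aᶜ ∩ A) = 0 := by
      refine measure_mono_null ?_ (h u hu hue)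
      rintro z ⟨⟨hz1, hz2⟩, hz3⟩
      exact ⟨hz3, h3 hz1, hz2⟩
    rw [this, zero_add]
    exact measure_mono (fun z hz => ⟨hz.1.1, hz.2⟩)
  rw [inter_comm] at h1 h2
  have h5 := ENNReal.add_lt_add h1 (h2.trans_le h4)
  rw [ENNReal.add_halves, measure_inter_add_sdiff _ hmA] at h5
  exact lt_irrefl _ h5

lemma exists_height {d : ℕ} (hd : 1 ≤ d) (m : ℝ) (h1 : -1 ≤ m) (h2 : m ≤ 1) :
    ∃ z : Sph d, inner ℝ (z : EE d) (EuclideanSpace.single 0 1) = m := by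
  have hne : (Fin.last d : Fin (d + 1)) ≠ 0 := by
    intro h; have := congrArg Fin.val h; simp at this; omega
  let e : EE d := EuclideanSpace.single 0 1
  let f : EE d := EuclideanSpace.single (Fin.last d) 1
  have hee : inner ℝ e e = (1 : ℝ) := by simp [e]
  have hff : inner ℝ f f = (1 : ℝ) := by simp [f]
  have hfe : inner ℝ f e = (0 : ℝ) := by
    simp only [e, f, EuclideanSpace.inner_single_left]
    simp [hne]
  have hef : inner ℝ e f = (0 : ℝ) := by rw [real_inner_comm, hfe]
  refine ⟨⟨m • e + √(1 - m ^ 2) • f, ?_⟩, ?_⟩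
  · rw [mem_sphere_zero_iff_norm, ← sq_eq_sq₀ (norm_nonneg _) zero_le_one,
      ← real_inner_self_eq_norm_sq]
    simp only [inner_add_left, inner_add_right, inner_smul_left, inner_smul_right, hee, hff, hfe,
      hef]
    have := Real.sq_sqrt (show 0 ≤ 1 - m ^ 2 by nlinarith)
    simp
    linarith
  · show inner ℝ (m • e + √(1 - m ^ 2) • f) e = m
    simp only [inner_add_left, inner_smul_left, hee, hfe]
    simp

lemma cap_sub {d : ℕ} (hd : 1 ≤ d) (t : ℝ) {A : Set (Sph d)} (hA : IsClosed A)
    (hAt : capMeasure d t ≤ sphMeasure d A)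
    (h : ∀ u : EE d, ‖u‖ = 1 → 0 < inner ℝ u (EuclideanSpace.single 0 1) →
      sphMeasure d (mov u A) = 0) :
    {x : Sph d | Real.cos t < inner ℝ (x : EE d) (EuclideanSpace.single 0 1)} ⊆ A := by
  intro y0 hy0
  by_contra hy0A
  have hoU : IsOpen {x : Sph d | Real.cos t < inner ℝ (x : EE d) (EuclideanSpace.single 0 1)} :=
    isOpen_lt continuous_const (by fun_prop)
  have hpos := (hoU.inter hA.isOpen_compl).measure_ne_zero (sphMeasure d) ⟨y0, hy0, hy0A⟩
  obtain ⟨y, ⟨hyU, hyA⟩, hyd⟩ : ∃ y, y ∈ {x : Sph d | Real.cos t <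
      inner ℝ (x : EE d) (EuclideanSpace.single 0 1)} ∩ Aᶜ ∧ dens Aᶜ y := by
    by_contra hcon
    push Not at hcon
    refine hpos (measure_mono_null ?_ (ae_iff.1 (ae_dens hA.measurableSet.compl)))
    intro z hz hz2
    exact hcon z hz (hz2 hz.2)
  set m := inner ℝ (y : EE d) (EuclideanSpace.single 0 1) with hm
  have hyU' : Real.cos t < m := hyU
  have h1 : sphMeasure d A ≤
      sphMeasure d {x : Sph d | m ≤ inner ℝ (x : EE d) (EuclideanSpace.single 0 1)} := by
    refine measure_mono_ae ?_
    filter_upwards [ae_dens hA.measurableSet] with x hx hxA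
    exact dens_le _ hA h (hx hxA) hyd
  have hm1 : m ≤ 1 := by
    have := (abs_le.1 (sph_abs (EuclideanSpace.single 0 1) y)).2
    simpa using this
  obtain ⟨z, hz⟩ := exists_height hd ((Real.cos t + m) / 2)
    (by linarith [Real.neg_one_le_cos t]) (by linarith)
  have ho : IsOpen {x : Sph d | Real.cos t < inner ℝ (x : EE d) (EuclideanSpace.single 0 1) ∧
      inner ℝ (x : EE d) (EuclideanSpace.single 0 1) < m} :=
    hoU.inter (isOpen_lt (f := fun x : Sph d => inner ℝ (x : EE d) (EuclideanSpace.single 0 1))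
      (by fun_prop) continuous_const)
  have h2 := ho.measure_ne_zero (sphMeasure d) ⟨z, by rw [hz]; linarith, by rw [hz]; linarith⟩
  have h3 : sphMeasure d {x : Sph d | m ≤ inner ℝ (x : EE d) (EuclideanSpace.single 0 1)} +
      sphMeasure d {x : Sph d | Real.cos t < inner ℝ (x : EE d) (EuclideanSpace.single 0 1) ∧
      inner ℝ (x : EE d) (EuclideanSpace.single 0 1) < m} ≤ capMeasure d t := by
    rw [← measure_union ?_ ho.measurableSet]
    · refine measure_mono ?_
      rintro x (hx | hx)
      · exact hyU'.le.trans hx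
      · exact hx.1.le
    · rw [Set.disjoint_left]
      intro x hx hx2
      exact not_le.2 hx2.2 hx
  have h4 := h3.trans (hAt.trans h1)
  exact absurd h4 (not_le.2 (ENNReal.lt_add_right (measure_ne_top _ _) h2))

lemma polar_cap {d : ℕ} {t : ℝ} (ht0 : 0 < t) (ht : t ≤ Real.pi / 2) (e : EE d) (he : ‖e‖ = 1)
    (b : Sph d)
    (h : ∀ a : Sph d, Real.cos t < inner ℝ (a : EE d) e → inner ℝ (a : EE d) (b : EE d) ≤ 0) :
    inner ℝ (b : EE d) e ≤ - Real.sin t := by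
  have hpi := Real.pi_pos
  set β := inner ℝ (b : EE d) e with hβ
  set p : EE d := b - β • e with hp
  have hee : inner ℝ e e = (1 : ℝ) := by rw [real_inner_self_eq_norm_sq, he]; norm_num
  have hbb : inner ℝ (b : EE d) (b : EE d) = (1 : ℝ) := by
    rw [real_inner_self_eq_norm_sq]; simp
  have heb : inner ℝ e (b : EE d) = β := by rw [real_inner_comm]
  have hpe : inner ℝ p e = (0 : ℝ) := by
    rw [hp, inner_sub_left, inner_smul_left, hee]; simp [hβ]
  have hep : inner ℝ e p = (0 : ℝ) := by rw [real_inner_comm, hpe]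
  have hpb : inner ℝ p (b : EE d) = 1 - β ^ 2 := by
    rw [hp, inner_sub_left, inner_smul_left, hbb, heb]; simp; ring
  have hpp : ‖p‖ ^ 2 = 1 - β ^ 2 := by
    rw [← real_inner_self_eq_norm_sq]
    nth_rw 2 [hp]
    rw [inner_sub_right, inner_smul_right, hpb, hpe]; ring
  have hS : 0 < Real.sin t := Real.sin_pos_of_pos_of_lt_pi ht0 (by linarith)
  have hC : 0 ≤ Real.cos t := Real.cos_nonneg_of_mem_Icc ⟨by linarith, ht⟩
  have hSC := Real.sin_sq_add_cos_sq t
  by_contra hcon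
  rw [not_le] at hcon
  by_cases hp0 : p = 0
  · have hbe : β ≤ 0 := by
      have := h ⟨e, by simp [he]⟩ (by
        show Real.cos t < inner ℝ e e
        rw [hee]
        nlinarith)
      rwa [← heb]
    rw [hp0] at hpp
    simp at hpp
    nlinarith [Real.sin_le_one t]
  · have hn : 0 < ‖p‖ := norm_pos_iff.2 hp0
    have key : ∀ s ∈ Ioo 0 t, β * Real.cos s + Real.sin s * ‖p‖ ≤ 0 := by
      intro s hs
      have hsc := Real.sin_sq_add_cos_sq s
      have := h ⟨Real.cos s • e + (Real.sin s * ‖p‖⁻¹) • p, ?_⟩ ?_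
      · simp only [inner_add_left, inner_smul_left, heb, hpb, ← hpp] at this
        simp only [conj_trivial] at this
        have e1 : Real.sin s * ‖p‖⁻¹ * ‖p‖ ^ 2 = Real.sin s * ‖p‖ := by field_simp
        rw [e1] at this
        linarith
      · rw [mem_sphere_zero_iff_norm, ← sq_eq_sq₀ (norm_nonneg _) zero_le_one,
          ← real_inner_self_eq_norm_sq]
        simp only [inner_add_left, inner_add_right, inner_smul_left, inner_smul_right, hee, hpe,
          hep, real_inner_self_eq_norm_sq p]
        simp only [conj_trivial]
        have e1 : ‖p‖⁻¹ * ‖p‖ = 1 := inv_mul_cancel₀ hn.ne'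
        linear_combination hsc + Real.sin s ^ 2 * (‖p‖⁻¹ * ‖p‖ + 1) * e1
      · show Real.cos t < inner ℝ (Real.cos s • e + (Real.sin s * ‖p‖⁻¹) • p) e
        simp only [inner_add_left, inner_smul_left, hee, hpe]
        simp only [conj_trivial, mul_one, mul_zero, add_zero]
        exact Real.cos_lt_cos_of_nonneg_of_le_pi hs.1.le (by linarith) hs.2
    have hlim : β * Real.cos t + Real.sin t * ‖p‖ ≤ 0 := by
      have hcont : Continuous (fun s => β * Real.cos s + Real.sin s * ‖p‖) := by fun_prop
      refine le_of_tendsto ((hcont.tendsto t).mono_left (nhdsWithin_le_nhds (s := Iio t))) ?_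
      filter_upwards [Ioo_mem_nhdsLT ht0] with s hs using key s hs
    rcases le_or_gt 0 β with hb | hb
    · nlinarith [mul_nonneg hb hC, mul_pos hS hn]
    · have h1 : Real.cos t < ‖p‖ := by
        refine lt_of_pow_lt_pow_left₀ 2 hn.le ?_
        nlinarith
      nlinarith [mul_pos hS (sub_pos.2 h1), mul_nonneg hC (sub_pos.2 hcon).le]

lemma cap_aux (d : ℕ) (hd : 1 ≤ d) (t : ℝ) (ht : t ∈ Set.Icc 0 (Real.pi / 2))
    (A B : Set (Sph d)) (hA : IsClosed A) (hAne : A.Nonempty)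
    (hAt : sphMeasure d A = capMeasure d t)
    (h : ∀ a ∈ A, ∀ b ∈ B, inner ℝ (a : EE d) (b : EE d) ≤ 0) :
    sphMeasure d B ≤ capMeasure d (Real.pi / 2 - t) := by
  have hmc : ∀ c : ℝ, MeasurableSet {x : Sph d | c ≤ inner ℝ (x : EE d)
      (EuclideanSpace.single 0 1)} := fun c =>
    (isClosed_le continuous_const (by fun_prop)).measurableSet
  unfold capMeasure
  rw [Real.cos_pi_div_two_sub]
  have he : ‖(EuclideanSpace.single 0 1 : EE d)‖ = 1 := by simp
  rcases ht.1.eq_or_lt with h0 | h0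
  · obtain ⟨a, ha⟩ := hAne
    rw [← h0, Real.sin_zero]
    let L : EE d ≃ₗᵢ[ℝ] EE d := rf ((a : EE d) - (-(EuclideanSpace.single 0 1)))
    have hL : L a = -(EuclideanSpace.single 0 1) := Submodule.reflection_sub (by simp)
    rw [← sphMap_meas L (hmc 0)]
    refine measure_mono ?_
    intro b hb
    show 0 ≤ inner ℝ (L b) (EuclideanSpace.single 0 1 : EE d)
    have h1 := h a ha b hb
    rw [← L.inner_map_map, hL, inner_neg_left, real_inner_comm] at h1
    linarith
  · have hcl : ∀ a ∈ A, ∀ b ∈ closure B, inner ℝ (a : EE d) (b : EE d) ≤ 0 := by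
      intro a ha b hb
      have hc : IsClosed {b : Sph d | inner ℝ (a : EE d) (b : EE d) ≤ 0} :=
        isClosed_le (by fun_prop) continuous_const
      exact closure_minimal (fun b hb => h a ha b hb) hc hb
    obtain ⟨A', B', hA', h1, h2, h3, h4⟩ :=
      exists_max (EuclideanSpace.single 0 1) hA isClosed_closure hcl
    have h5 := cap_sub hd t hA' (hAt ▸ h1) h4
    refine (measure_mono subset_closure).trans (h2.trans ?_)
    rw [← sphMap_meas (LinearIsometryEquiv.neg ℝ) (hmc (Real.sin t))]
    refine measure_mono ?_
    intro b hb
    have := polar_cap h0 ht.2 (EuclideanSpace.single 0 1) he b (fun a ha => h3 a (h5 ha) b hb)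
    show Real.sin t ≤ inner ℝ (-(b : EE d)) (EuclideanSpace.single 0 1 : EE d)
    rw [inner_neg_left]
    linarith


/-- Cap bound (via the isoperimetric inequality of Figiel–Lindenstrauss–Milman):
if A ⊆ S^d is closed and nonempty with σ_d(A) = h_d(t), t ∈ [0, π/2], and B is a
measurable set such that the inner product has constant sign between A and B,
then σ_d(B) ≤ h_d(π/2 − t). -/
theorem cap_upper_bound (d : ℕ) (hd : 1 ≤ d) (t : ℝ) (ht : t ∈ Set.Icc 0 (Real.pi / 2))
    (A B : Set (Sph d)) (hA : IsClosed A) (hAne : A.Nonempty)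
    (hAt : sphMeasure d A = capMeasure d t) (hB : MeasurableSet B)
    (hsign : (∀ a ∈ A, ∀ b ∈ B, 0 ≤ inner (𝕜 := ℝ) (a : EuclideanSpace ℝ (Fin (d + 1)))
        (b : EuclideanSpace ℝ (Fin (d + 1)))) ∨
      (∀ a ∈ A, ∀ b ∈ B, inner (𝕜 := ℝ) (a : EuclideanSpace ℝ (Fin (d + 1)))
        (b : EuclideanSpace ℝ (Fin (d + 1))) ≤ 0)) :
    sphMeasure d B ≤ capMeasure d (Real.pi / 2 - t) := by
  rcases hsign with h | h
  · rw [← sphMap_meas (LinearIsometryEquiv.neg ℝ) hB]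
    refine cap_aux d hd t ht A _ hA hAne hAt ?_
    intro a ha b hb
    have := h a ha _ hb
    rw [sphMap_coe, LinearIsometryEquiv.coe_neg, inner_neg_right] at this
    linarith
  · exact cap_aux d hd t ht A B hA hAne hAt h
end
end

section
/- Let d ≥ 1 and k ≥ 1 be integers and suppose n is a positive integer such that every nice measure on ℝ^d admits a k-equipartition into n parts. Then (1/(2n), k/(2n)) ∈ C_d; that is, for any two nice measures μ1, μ2 on S^d there exist sets A, B ⊆ S^d with μ1(A) ≥ 1/(2n) and μ2(B) ≥ k/(2n) such that either a·b ≥ 0 for all a ∈ A, b ∈ B, or a·b ≤ 0 for all a ∈ A, b ∈ B. -/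
open MeasureTheory Set Metric
open scoped ENNReal
noncomputable section

/-- Insert a zeroth coordinate. -/
def consE (d : ℕ) (p : ℝ × Euc d) : Euc (d + 1) := WithLp.toLp 2 (Fin.cons p.1 p.2.ofLp)

/-- Drop the zeroth coordinate. -/
def tailE (d : ℕ) (y : Euc (d + 1)) : Euc d := WithLp.toLp 2 (fun i => y i.succ)

/-- Central projection. -/
def projE (d : ℕ) (y : Euc (d + 1)) : Euc d := (y 0)⁻¹ • tailE d y

/-- Radial projection to the sphere. -/
def radial (d : ℕ) (y : Euc (d + 1)) : Sph d :=
  if h : y ≠ 0 then ⟨‖y‖⁻¹ • y, by simp [norm_smul, h]⟩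
  else ⟨EuclideanSpace.single 0 1, by simp⟩

theorem consE_mp (d : ℕ) : MeasurePreserving (consE d)
    ((volume : Measure ℝ).prod (volume : Measure (Euc d))) volume := by
  have h1 : MeasurePreserving (Prod.map id (@WithLp.ofLp 2 (Fin d → ℝ)))
      ((volume : Measure ℝ).prod (volume : Measure (Euc d)))
      ((volume : Measure ℝ).prod volume) :=
    (MeasurePreserving.id _).prod (PiLp.volume_preserving_ofLp (Fin d))
  have h2 := (volume_preserving_piFinSuccAbove (fun _ : Fin (d+1) => ℝ) 0).symm
  have h3 := PiLp.volume_preserving_toLp (Fin (d+1))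
  have := h3.comp (h2.comp h1)
  convert! this using 1
  ext p i
  refine Fin.cases ?_ (fun j => ?_) i <;> simp [consE, MeasurableEquiv.piFinSuccAbove]

theorem measurable_tailE (d : ℕ) : Measurable (tailE d) := by
  unfold tailE; fun_prop

theorem measurable_projE (d : ℕ) : Measurable (projE d) := by
  have := measurable_tailE d
  unfold projE
  fun_prop

theorem continuous_consE (d : ℕ) : Continuous (consE d) := by
  unfold consE
  refine (PiLp.continuous_toLp 2 _).comp ?_
  refine continuous_pi fun i => ?_
  refine Fin.cases ?_ (fun j => ?_) i
  · simp; fun_prop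
  · simp; fun_prop

theorem measurable_radial (d : ℕ) : Measurable (radial d) := by
  have hs : MeasurableSet (sphere (0 : Euc (d+1)) 1) := isClosed_sphere.measurableSet
  rw [← (MeasurableEmbedding.subtype_coe hs).measurable_comp_iff]
  have : (Subtype.val ∘ radial d) = fun y : Euc (d+1) =>
      if y ≠ 0 then ‖y‖⁻¹ • y else EuclideanSpace.single 0 1 := by
    ext1 y
    by_cases h : y = 0 <;> simp [radial, h]
  rw [this]
  exact Measurable.ite (measurableSet_singleton _).compl (by fun_prop) (by fun_prop)

theorem radial_smul (d : ℕ) {t : ℝ} (ht : 0 < t) (y : Euc (d+1)) (hy : y ≠ 0) :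
    radial d (t • y) = radial d y := by
  have : t • y ≠ 0 := by simp [ht.ne', hy]
  unfold radial
  rw [dif_pos this, dif_pos hy]
  ext1
  simp only [norm_smul, Real.norm_eq_abs, abs_of_pos ht, smul_smul]
  congr 1
  field_simp

theorem radial_neg (d : ℕ) (y : Euc (d+1)) (hy : y ≠ 0) :
    radial d (-y) = -radial d y := by
  unfold radial
  rw [dif_pos hy, dif_pos (neg_ne_zero.2 hy)]
  ext1
  simp

theorem toSphere_eq_map (d : ℕ) :
    (volume : Measure (Euc (d+1))).toSphere =
      ((d + 1 : ℕ) : ℝ≥0∞) • (volume.restrict (ball (0 : Euc (d+1)) 1)).map (radial d) := by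
  ext s hs
  rw [Measure.toSphere_apply' _ hs, Measure.smul_apply, Measure.map_apply (measurable_radial d) hs,
    Measure.restrict_apply (measurable_radial d hs)]
  simp only [finrank_euclideanSpace, Fintype.card_fin, smul_eq_mul]
  congr 1
  rw [← measure_sdiff_null (s := radial d ⁻¹' s ∩ ball 0 1) (measure_singleton (0 : Euc (d+1)))]
  congr 1
  ext y
  simp only [mem_smul, mem_sdiff, mem_inter_iff, mem_preimage, mem_singleton_iff, mem_ball_zero_iff]
  constructor
  · rintro ⟨t, ht, _, ⟨z, hz, rfl⟩, rfl⟩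
    have hz1 : ‖(z : Euc (d+1))‖ = 1 := by simp
    have hz0 : (z : Euc (d+1)) ≠ 0 := by
      intro h; rw [h] at hz1; simp at hz1
    refine ⟨⟨?_, ?_⟩, by simp [ht.1.ne', hz0]⟩
    · rw [radial_smul d ht.1 _ hz0]
      convert hz
      unfold radial
      rw [dif_pos hz0]
      ext1
      simp
    · rw [norm_smul, hz1, Real.norm_eq_abs, abs_of_pos ht.1]; simpa using ht.2
  · rintro ⟨⟨h1, h2⟩, h3⟩
    refine ⟨‖y‖, ⟨by simpa using h3, h2⟩, _, ⟨_, h1, rfl⟩, ?_⟩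
    unfold radial
    rw [dif_pos h3]
    simp [smul_smul, h3]

theorem lintegral_scale (d : ℕ) {t : ℝ} (ht : t ≠ 0) (F : Euc d → ℝ≥0∞) :
    ∫⁻ x, F x = ENNReal.ofReal (|t| ^ d) * ∫⁻ x, F (t • x) := by
  have h := Measure.map_addHaar_smul (volume : Measure (Euc d)) ht
  have h2 : ∫⁻ x, F (t • x) = ∫⁻ x, F x ∂(Measure.map (t • ·) (volume : Measure (Euc d))) := by
    exact ((Homeomorph.smulOfNeZero t ht).measurableEmbedding.lintegral_map F).symm
  rw [h2, h, lintegral_smul_measure]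
  simp only [finrank_euclideanSpace, Fintype.card_fin, smul_eq_mul]
  rw [← mul_assoc, ← ENNReal.ofReal_mul (by positivity), abs_inv, abs_pow, mul_inv_cancel₀,
    ENNReal.ofReal_one, one_mul]
  positivity

theorem lintegral_pos (d : ℕ) {r : ℝ} (hr : 0 < r) :
    ∫⁻ t, (Ioo 0 r).indicator (fun t : ℝ => ENNReal.ofReal (|t| ^ d)) t =
      ENNReal.ofReal (r ^ (d+1) / (d+1)) := by
  rw [lintegral_indicator measurableSet_Ioo, restrict_Ioo_eq_restrict_Ioc,
    setLIntegral_congr_fun (g := fun t : ℝ => ENNReal.ofReal (t^d)) measurableSet_Ioc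
      (fun t ht => by simp only [abs_of_pos ht.1]),
    ← ofReal_integral_eq_lintegral_ofReal, ← intervalIntegral.integral_of_le hr.le]
  · simp
  · exact (intervalIntegral.intervalIntegrable_pow _).1
  · filter_upwards [ae_restrict_mem measurableSet_Ioc] with y hy
    exact pow_nonneg hy.1.le _

theorem lintegral_neg' (d : ℕ) {r : ℝ} (hr : 0 < r) :
    ∫⁻ t, (Ioo (-r) 0).indicator (fun t : ℝ => ENNReal.ofReal (|t| ^ d)) t =
      ENNReal.ofReal (r ^ (d+1) / (d+1)) := by
  rw [← lintegral_pos d hr, ← (Measure.measurePreserving_neg (volume : Measure ℝ)).lintegral_comp_emb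
    (MeasurableEquiv.neg ℝ).measurableEmbedding]
  congr 1
  ext t
  simp only [indicator, mem_Ioo, abs_neg]
  congr 1
  simp only [eq_iff_iff]
  constructor <;> rintro ⟨a, b⟩ <;> constructor <;> linarith

theorem consE_ne (d : ℕ) (x : Euc d) : consE d (1, x) ≠ 0 := by
  intro h
  have := congrArg (fun y : Euc (d+1) => y 0) h
  simp [consE] at this

theorem consE_smul (d : ℕ) (t s : ℝ) (x : Euc d) : consE d (t * s, t • x) = t • consE d (s, x) := by
  ext i
  refine Fin.cases ?_ (fun j => ?_) i <;> simp [consE]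

theorem lintegral_toSphere (d : ℕ) (g : Sph d → ℝ≥0∞) (hg : Measurable g) :
    ∫⁻ y, g y ∂(volume : Measure (Euc (d+1))).toSphere =
      ∫⁻ x : Euc d, ENNReal.ofReal ((‖consE d (1, x)‖⁻¹) ^ (d+1)) *
        (g (radial d (consE d (1, x))) + g (-radial d (consE d (1, x)))) := by
  have hm := measurable_radial d
  have hc := (continuous_consE d).measurable
  let G : Euc (d+1) → ℝ≥0∞ := (ball (0 : Euc (d+1)) 1).indicator (fun y => g (radial d y))
  have hG : Measurable G := (hg.comp hm).indicator measurableSet_ball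
  have key : ∀ x : Euc d, ∫⁻ t : ℝ, ENNReal.ofReal (|t| ^ d) * G (consE d (t, t • x)) =
      ENNReal.ofReal ((‖consE d (1, x)‖⁻¹) ^ (d+1) / (d+1)) *
        (g (radial d (consE d (1, x))) + g (-radial d (consE d (1, x)))) := by
    intro x
    have h0 := consE_ne d x
    set u := consE d (1, x) with hu
    have hw : 0 < ‖u‖ := norm_pos_iff.2 h0
    have hr : 0 < ‖u‖⁻¹ := inv_pos.2 hw
    set r := ‖u‖⁻¹ with hrdef
    have hae : (fun t : ℝ => ENNReal.ofReal (|t| ^ d) * G (consE d (t, t • x))) =ᵐ[volume]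
        fun t => (Ioo 0 r).indicator (fun t : ℝ => ENNReal.ofReal (|t| ^ d)) t * g (radial d u) +
          (Ioo (-r) 0).indicator (fun t : ℝ => ENNReal.ofReal (|t| ^ d)) t * g (-radial d u) := by
      filter_upwards [compl_mem_ae_iff.2 (measure_singleton (0:ℝ))] with t ht
      have ht0 : t ≠ 0 := ht
      have e1 : consE d (t, t • x) = t • u := by
        have := consE_smul d t 1 x
        rwa [mul_one] at this
      rw [e1]
      have hb : t • u ∈ ball (0 : Euc (d+1)) 1 ↔ |t| < r := by
        rw [mem_ball_zero_iff, norm_smul, Real.norm_eq_abs, hrdef, ← one_div, lt_div_iff₀ hw]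
      rcases lt_or_gt_of_ne ht0 with h | h
      · have n1 : t ∉ Ioo 0 r := fun hh => by linarith [hh.1]
        have n2 : radial d (t • u) = - radial d u := by
          rw [← radial_neg d u h0, ← radial_smul d (neg_pos.2 h) (-u) (neg_ne_zero.2 h0)]
          simp
        rw [indicator_of_notMem n1, zero_mul, zero_add]
        by_cases hh : |t| < r
        · have n3 : t ∈ Ioo (-r) 0 := ⟨by linarith [(abs_lt.1 hh).1], h⟩
          simp only [G, indicator_of_mem (hb.2 hh), indicator_of_mem n3, n2]
        · have n3 : t ∉ Ioo (-r) 0 := fun q => hh (abs_lt.2 ⟨q.1, by linarith⟩)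
          simp only [G, indicator_of_notMem (fun q => hh (hb.1 q)), indicator_of_notMem n3]
          simp
      · have n1 : t ∉ Ioo (-r) 0 := fun hh => by linarith [hh.2]
        have n2 : radial d (t • u) = radial d u := radial_smul d h u h0
        rw [indicator_of_notMem n1, zero_mul, add_zero]
        by_cases hh : |t| < r
        · have n3 : t ∈ Ioo 0 r := ⟨h, by linarith [(abs_lt.1 hh).2]⟩
          simp only [G, indicator_of_mem (hb.2 hh), indicator_of_mem n3, n2]
        · have n3 : t ∉ Ioo 0 r := fun q => hh (abs_lt.2 ⟨by linarith, q.2⟩)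
          simp only [G, indicator_of_notMem (fun q => hh (hb.1 q)), indicator_of_notMem n3]
          simp
    have hmeas : ∀ s : Set ℝ, MeasurableSet s →
        Measurable (s.indicator (fun t : ℝ => ENNReal.ofReal (|t| ^ d))) := fun s hs =>
      Measurable.indicator (by fun_prop) hs
    rw [lintegral_congr_ae hae, lintegral_add_left ((hmeas _ measurableSet_Ioo).mul_const _),
      lintegral_mul_const _ (hmeas _ measurableSet_Ioo),
      lintegral_mul_const _ (hmeas _ measurableSet_Ioo), lintegral_pos d hr, lintegral_neg' d hr,
      mul_add]
  rw [toSphere_eq_map, lintegral_smul_measure, lintegral_map hg hm,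
    ← lintegral_indicator measurableSet_ball]
  change ((d + 1 : ℕ) : ℝ≥0∞) * ∫⁻ y, G y = _
  rw [← (consE_mp d).lintegral_comp hG, lintegral_prod _ (by fun_prop)]
  have e2 : ∫⁻ t : ℝ, ∫⁻ x : Euc d, G (consE d (t, x)) =
      ∫⁻ t : ℝ, ∫⁻ x : Euc d, ENNReal.ofReal (|t| ^ d) * G (consE d (t, t • x)) := by
    apply lintegral_congr_ae
    filter_upwards [compl_mem_ae_iff.2 (measure_singleton (0:ℝ))] with t ht
    rw [lintegral_scale d ht, lintegral_const_mul]
    fun_prop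
  rw [e2, lintegral_lintegral_swap (by fun_prop), ← lintegral_const_mul' _ _ (by simp)]
  congr 1
  ext x
  rw [key, ← mul_assoc]
  congr 1
  rw [← ENNReal.ofReal_natCast, ← ENNReal.ofReal_mul (by positivity)]
  congr 1
  push_cast
  field_simp

theorem radial_cons_coe (d : ℕ) (x : Euc d) : (radial d (consE d (1, x)) : Euc (d+1)) =
    ‖consE d (1, x)‖⁻¹ • consE d (1, x) := by
  unfold radial
  rw [dif_pos (consE_ne d x)]

theorem continuous_radial_cons (d : ℕ) : Continuous (fun x => radial d (consE d (1, x))) := by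
  have hc : Continuous (fun x : Euc d => consE d (1, x)) :=
    (continuous_consE d).comp (by fun_prop)
  rw [continuous_induced_rng]
  have : (Subtype.val ∘ fun x => radial d (consE d (1, x))) =
      fun x => ‖consE d (1, x)‖⁻¹ • consE d (1, x) := by
    ext1 x; exact radial_cons_coe d x
  rw [this]
  exact (hc.norm.inv₀ (fun x => norm_ne_zero_iff.2 (consE_ne d x))).smul hc

theorem projE_smul (d : ℕ) {t : ℝ} (ht : t ≠ 0) (y : Euc (d+1)) : projE d (t • y) = projE d y := by
  ext i
  simp only [projE, tailE, PiLp.smul_apply, smul_eq_mul]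
  field_simp

theorem projE_radial (d : ℕ) (x : Euc d) : projE d (radial d (consE d (1, x))) = x := by
  rw [radial_cons_coe, projE_smul d (inv_ne_zero (norm_ne_zero_iff.2 (consE_ne d x)))]
  ext i
  simp [projE, tailE, consE]

theorem projE_neg (d : ℕ) (y : Euc (d+1)) : projE d (-y) = projE d y := by
  rw [← projE_smul d (t := -1) (by norm_num) y]; simp

theorem nice_map (d : ℕ) (μ : Measure (Sph d)) (hμ : NiceSphMeasure d μ) :
    NiceMeasure d (μ.map (fun y : Sph d => projE d y)) := by
  obtain ⟨hp, f, hf, hpos, rfl⟩ := hμ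
  have hpm : Measurable (fun y : Sph d => projE d y) :=
    (measurable_projE d).comp measurable_subtype_coe
  refine ⟨Measure.isProbabilityMeasure_map hpm.aemeasurable, ?_⟩
  set K : ℝ≥0∞ := ((volume : Measure (Euc (d + 1))).toSphere Set.univ)⁻¹ with hK
  have hK0 : K ≠ 0 := ENNReal.inv_ne_zero.2 (measure_ne_top _ _)
  have hKt : K ≠ ⊤ := ENNReal.inv_ne_top.2 (by
    rw [Ne, Measure.measure_univ_eq_zero]; exact Measure.toSphere_ne_zero _)
  have hKr : 0 < K.toReal := ENNReal.toReal_pos hK0 hKt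
  have hu := continuous_radial_cons d
  have hc : Continuous (fun x : Euc d => consE d (1, x)) :=
    (continuous_consE d).comp (by fun_prop)
  refine ⟨fun x => K.toReal * ((‖consE d (1, x)‖⁻¹) ^ (d+1) *
    (f (radial d (consE d (1, x))) + f (-radial d (consE d (1, x))))), ?_, ?_, ?_⟩
  · refine continuous_const.mul (Continuous.mul ?_ ((hf.comp hu).add (hf.comp hu.neg)))
    exact (hc.norm.inv₀ (fun x => norm_ne_zero_iff.2 (consE_ne d x))).pow _
  · intro x
    have := norm_pos_iff.2 (consE_ne d x)
    have := hpos (radial d (consE d (1, x)))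
    have := hpos (-radial d (consE d (1, x)))
    positivity
  · ext s hs
    have hfm : Measurable (fun y => ENNReal.ofReal (f y)) := hf.measurable.ennreal_ofReal
    rw [Measure.map_apply hpm hs, withDensity_apply _ (hpm hs), withDensity_apply _ hs,
      ← lintegral_indicator (hpm hs), ← lintegral_indicator hs, sphMeasure,
      lintegral_smul_measure, lintegral_toSphere d _ (hfm.indicator (hpm hs)), smul_eq_mul,
      ← lintegral_const_mul' _ _ hKt]
    congr 1
    ext x
    have e1 : radial d (consE d (1, x)) ∈ (fun y : Sph d => projE d y) ⁻¹' s ↔ x ∈ s := by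
      rw [mem_preimage, projE_radial]
    have e2 : -radial d (consE d (1, x)) ∈ (fun y : Sph d => projE d y) ⁻¹' s ↔ x ∈ s := by
      rw [mem_preimage]
      change projE d (-(radial d (consE d (1, x)) : Euc (d+1))) ∈ s ↔ _
      rw [projE_neg, projE_radial]
    by_cases hx : x ∈ s
    · rw [indicator_of_mem (e1.2 hx), indicator_of_mem (e2.2 hx), indicator_of_mem hx,
        ENNReal.ofReal_mul hKr.le, ENNReal.ofReal_mul (by positivity),
        ENNReal.ofReal_add (hpos _).le (hpos _).le, ENNReal.ofReal_toReal hKt]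
    · rw [indicator_of_notMem (fun h => hx (e1.1 h)), indicator_of_notMem (fun h => hx (e2.1 h)),
        indicator_of_notMem hx]
      simp

theorem inner_split (d : ℕ) (a b : Euc (d+1)) (ha : a 0 ≠ 0) :
    inner ℝ a b = a 0 * (inner ℝ (tailE d b) (projE d a) + b 0) := by
  simp only [PiLp.inner_apply, Fin.sum_univ_succ, projE, tailE, PiLp.smul_apply, smul_eq_mul,
    RCLike.inner_apply, conj_trivial]
  rw [mul_add, Finset.mul_sum, add_comm, mul_comm (b 0)]
  congr 1
  refine Finset.sum_congr rfl fun i _ => ?_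
  field_simp

theorem half_choice {α : Type*} [MeasurableSpace α] (μ : Measure α) (S P Q : Set α) (c : ℝ≥0∞)
    (hS : c ≤ μ S) (h : S ⊆ P ∪ Q) : c / 2 ≤ μ P ∨ c / 2 ≤ μ Q := by
  by_contra! hh
  have : c < c := calc
    c ≤ μ S := hS
    _ ≤ μ (P ∪ Q) := measure_mono h
    _ ≤ μ P + μ Q := measure_union_le _ _
    _ < c / 2 + c / 2 := ENNReal.add_lt_add hh.1 hh.2
    _ = c := ENNReal.add_halves c
  exact lt_irrefl _ this

/-- If every nice measure on ℝ^d admits a k-equipartition into n parts, then the pair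
(1/(2n), k/(2n)) belongs to C_d. -/
theorem equipartition_gives_pair (d k n : ℕ) (hd : 1 ≤ d) (hk : 1 ≤ k) (hn : 0 < n)
    (h : HasEquipartition d k n) :
    ((1 : ℝ) / (2 * n), (k : ℝ) / (2 * n)) ∈ CSet d := by

  classical
  refine ⟨by positivity, by positivity, ?_⟩
  intro μ1 μ2 h1 h2
  have hnice := nice_map d μ1 h1
  have hp1 := h1.1
  have hp2 := h2.1
  have hpm : Measurable (fun y : Sph d => projE d y) :=
    (measurable_projE d).comp measurable_subtype_coe
  obtain ⟨C, ⟨hcl, hconv, -, -⟩, hmeas, hav⟩ := h _ hnice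
  obtain ⟨hpν, g, -, -, hg⟩ := hnice
  have hac : μ1.map (fun y : Sph d => projE d y) ≪ volume := by
    rw [hg]; exact withDensity_absolutelyContinuous _ _
  set ν := μ1.map (fun y : Sph d => projE d y) with hν
  haveI : Nonempty (Fin d) := ⟨⟨0, hd⟩⟩
  -- measure of the interiors
  have hint : ∀ i, (n : ℝ≥0∞)⁻¹ ≤ ν (interior (C i)) := by
    intro i
    rw [← hmeas i]
    calc ν (C i) ≤ ν (interior (C i) ∪ frontier (C i)) := by
            apply measure_mono
            intro x hx
            by_cases hxi : x ∈ interior (C i)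
            · exact Or.inl hxi
            · exact Or.inr ⟨subset_closure hx, hxi⟩
      _ ≤ ν (interior (C i)) + ν (frontier (C i)) := measure_union_le _ _
      _ = _ := by rw [hac ((hconv i).addHaar_frontier volume), add_zero]
  have hz : ν {0} = 0 := hac (measure_singleton _)
  let φ : Sph d → Euc d → ℝ := fun b x =>
    inner ℝ (tailE d (b : Euc (d+1))) x + (b : Euc (d+1)) 0
  let Bp : Fin n → Set (Sph d) := fun i => {b | ∀ x ∈ interior (C i), 0 ≤ φ b x}
  let Bm : Fin n → Set (Sph d) := fun i => {b | ∀ x ∈ interior (C i), φ b x ≤ 0}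
  have hφ : ∀ x, Continuous (fun b => φ b x) := by
    intro x
    have : Continuous (tailE d) := by unfold tailE; fun_prop
    have := this.comp (continuous_subtype_val (p := (· ∈ sphere (0 : Euc (d+1)) 1)))
    simp only [φ]
    refine (this.inner continuous_const).add ?_
    fun_prop
  have hBm : ∀ i, MeasurableSet (Bp i ∪ Bm i) := by
    intro i
    apply MeasurableSet.union
    · apply IsClosed.measurableSet
      simp only [Bp, setOf_forall]
      exact isClosed_iInter fun x => isClosed_iInter fun _ => isClosed_le continuous_const (hφ x)
    · apply IsClosed.measurableSet
      simp only [Bm, setOf_forall]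
      exact isClosed_iInter fun x => isClosed_iInter fun _ => isClosed_le (hφ x) continuous_const
  have hkn : k ≤ n := by
    have := hav (EuclideanSpace.single ⟨0, hd⟩ 1) 0 (by
      intro h0
      have := congrArg norm h0
      simp at this)
    refine this.trans ((Set.ncard_le_card _).trans ?_)
    simp
  have hcount : ∀ b : Sph d, k ≤ (Finset.univ.filter (fun i => b ∈ Bp i ∪ Bm i)).card := by
    intro b
    by_cases hv : tailE d (b : Euc (d+1)) = 0
    · rw [Finset.filter_true_of_mem]
      · simpa using hkn
      · intro i _
        rcases le_total 0 ((b : Euc (d+1)) 0) with hb | hb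
        · left; intro x _; simpa [φ, hv] using hb
        · right; intro x _; simpa [φ, hv] using hb
    · refine (hav _ (-((b : Euc (d+1)) 0)) hv).trans ?_
      rw [← Set.ncard_coe_finset]
      apply Set.ncard_le_ncard _ (Set.toFinite _)
      intro i hi
      simp only [Finset.coe_filter, Finset.mem_univ, true_and, mem_setOf_eq]
      have hi' : Hyperplane (tailE d (b : Euc (d+1))) (-((b : Euc (d+1)) 0)) ∩ interior (C i) = ∅ :=
        hi
      have hne : ∀ x ∈ interior (C i), φ b x ≠ 0 := by
        intro x hx h0
        have : x ∈ (∅ : Set (Euc d)) := by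
          rw [← hi']
          exact ⟨eq_neg_of_add_eq_zero_left h0, hx⟩
        exact this
      by_contra hnot
      simp only [Bp, Bm, mem_union, mem_setOf_eq, not_or, not_forall, not_le] at hnot
      obtain ⟨⟨x, hx, hx0⟩, ⟨y, hy, hy0⟩⟩ := hnot
      have hcon : ContinuousOn (φ b) (interior (C i)) := by
        simp only [φ]; fun_prop
      have := (hconv i).interior.isPreconnected.intermediate_value hx hy hcon
        ⟨hx0.le, hy0.le⟩
      obtain ⟨z, hz, hz0⟩ := this
      exact hne z hz hz0
  -- averaging
  have hsum : (k : ℝ≥0∞) ≤ ∑ i, μ2 (Bp i ∪ Bm i) := by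
    calc (k : ℝ≥0∞) = ∫⁻ _, (k : ℝ≥0∞) ∂μ2 := by simp
      _ ≤ ∫⁻ b, ∑ i, (Bp i ∪ Bm i).indicator (fun _ => (1 : ℝ≥0∞)) b ∂μ2 := by
          apply lintegral_mono
          intro b
          simp only [indicator_apply]
          rw [Finset.sum_boole]
          exact_mod_cast hcount b
      _ = ∑ i, μ2 (Bp i ∪ Bm i) := by
          rw [lintegral_finsetSum _ (fun i _ => measurable_const.indicator (hBm i))]
          refine Finset.sum_congr rfl fun i _ => ?_
          rw [lintegral_indicator_const (hBm i), one_mul]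
  have hn0 : (n : ℝ≥0∞) ≠ 0 := by exact_mod_cast hn.ne'
  obtain ⟨i, hi⟩ : ∃ i, (k : ℝ≥0∞) / n ≤ μ2 (Bp i ∪ Bm i) := by
    by_contra! hh
    have : (∑ i, μ2 (Bp i ∪ Bm i)) < ∑ _i : Fin n, (k : ℝ≥0∞) / n :=
      ENNReal.sum_lt_sum_of_nonempty ⟨⟨0, hn⟩, Finset.mem_univ _⟩ (fun i _ => hh i)
    rw [Finset.sum_const, Finset.card_univ, Fintype.card_fin, nsmul_eq_mul,
      ENNReal.mul_div_cancel hn0 (by simp)] at this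
    exact absurd (hsum.trans_lt this) (lt_irrefl _)
  let Ap : Set (Sph d) := {a | 0 < (a : Euc (d+1)) 0 ∧ projE d a ∈ interior (C i)}
  let Am : Set (Sph d) := {a | (a : Euc (d+1)) 0 < 0 ∧ projE d a ∈ interior (C i)}
  have hA : (n : ℝ≥0∞)⁻¹ ≤ μ1 ((fun y : Sph d => projE d y) ⁻¹' (interior (C i) \ {0})) := by
    rw [← Measure.map_apply hpm (isOpen_interior.measurableSet.diff (measurableSet_singleton _)),
      ← hν, measure_sdiff_null hz]
    exact hint i
  have hAsub : (fun y : Sph d => projE d y) ⁻¹' (interior (C i) \ {0}) ⊆ Ap ∪ Am := by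
    rintro a ⟨ha, ha0⟩
    rcases lt_trichotomy ((a : Euc (d+1)) 0) 0 with hlt | heq | hgt
    · exact Or.inr ⟨hlt, ha⟩
    · exact absurd (by simp [projE, heq]) ha0
    · exact Or.inl ⟨hgt, ha⟩
  have r1 : ENNReal.ofReal ((1 : ℝ) / (2 * n)) = (n : ℝ≥0∞)⁻¹ / 2 := by
    rw [ENNReal.ofReal_div_of_pos (by positivity), ENNReal.ofReal_mul (by norm_num)]
    simp only [ENNReal.ofReal_one, ENNReal.ofReal_ofNat, ENNReal.ofReal_natCast, one_div]
    rw [ENNReal.mul_inv (by simp) (by simp), mul_comm, div_eq_mul_inv]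
  have r2 : ENNReal.ofReal ((k : ℝ) / (2 * n)) = (k : ℝ≥0∞) / n / 2 := by
    rw [ENNReal.ofReal_div_of_pos (by positivity), ENNReal.ofReal_mul (by norm_num)]
    simp only [ENNReal.ofReal_ofNat, ENNReal.ofReal_natCast]
    rw [div_eq_mul_inv, ENNReal.mul_inv (by simp) (by simp), mul_comm (2⁻¹ : ℝ≥0∞), ← mul_assoc]
    rfl
  have hAc := half_choice μ1 _ _ _ _ hA hAsub
  have hBc := half_choice μ2 _ _ _ _ hi Subset.rfl
  rw [← r1] at hAc
  rw [← r2] at hBc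
  have hin : ∀ a b : Sph d, (a : Euc (d+1)) 0 ≠ 0 →
      inner ℝ (a : Euc (d+1)) (b : Euc (d+1)) = (a : Euc (d+1)) 0 * φ b (projE d a) :=
    fun a b ha => inner_split d a b ha
  rcases hAc with hAc | hAc <;> rcases hBc with hBc | hBc
  · refine ⟨Ap, Bp i, hAc, hBc, Or.inl fun a ha b hb => ?_⟩
    rw [hin a b ha.1.ne']
    exact mul_nonneg ha.1.le (hb _ ha.2)
  · refine ⟨Ap, Bm i, hAc, hBc, Or.inr fun a ha b hb => ?_⟩
    rw [hin a b ha.1.ne']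
    exact mul_nonpos_of_nonneg_of_nonpos ha.1.le (hb _ ha.2)
  · refine ⟨Am, Bp i, hAc, hBc, Or.inr fun a ha b hb => ?_⟩
    rw [hin a b ha.1.ne]
    exact mul_nonpos_of_nonpos_of_nonneg ha.1.le (hb _ ha.2)
  · refine ⟨Am, Bm i, hAc, hBc, Or.inl fun a ha b hb => ?_⟩
    rw [hin a b ha.1.ne]
    exact mul_nonneg_of_nonpos_of_nonpos ha.1.le (hb _ ha.2)
end
end
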